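/- Let n ≥ 1, T > 0, c > 0 and let ψ : ℝⁿ × ℝ → ℝ be smooth (C^∞) with ∂_t ψ ≥ c everywhere and Δψ(x,0) ≥ c for all x ∈ B̄_1. Then there exists a function u, continuous on B̄_1 × [0,T], with continuous spatial gradient on B_1 × (0,T), such that for a.e. (x,t) ∈ B_1 × (0,T) the derivatives ∂_t u and D²u exist and ∂_t u(x,t) − Δu(x,t) = 1 if u(x,t) > 0 and = 0 if u(x,t) ≤ 0, u = ψ on (B̄_1 × {0}) ∪ (∂B_1 × [0,T]), and moreover u(x,t₂) − u(x,t₁) ≥ c(t₂ − t₁) for all x ∈ B_1 and 0 ≤ t₁ ≤ t₂ ≤ T. Consequently ∂_t u ≥ c wherever the time derivative exists. -/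

import Mathlib

open MeasureTheory Metric Set Filter

noncomputable section

abbrev Spc (n : ℕ) := EuclideanSpace ℝ (Fin n)

/-- Parabolic cylinder `Q_r(x,t)`. -/
def Qcyl (n : ℕ) (r : ℝ) (x : Spc n) (t : ℝ) : Set (Spc n × ℝ) :=
  {p : Spc n × ℝ | ‖p.1 - x‖ + Real.sqrt |p.2 - t| < r}

/-- Time derivative `∂ₜ u`. -/
def timeDeriv {n : ℕ} (u : Spc n × ℝ → ℝ) (p : Spc n × ℝ) : ℝ :=
  deriv (fun s => u (p.1, s)) p.2

/-- Spatial gradient `∇u`. -/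
def spGrad {n : ℕ} (u : Spc n × ℝ → ℝ) (p : Spc n × ℝ) : Spc n :=
  gradient (fun y => u (y, p.2)) p.1

/-- The point `p` translated by `h` in the `i`-th spatial direction. -/
def dirPoint {n : ℕ} (p : Spc n × ℝ) (i : Fin n) (h : ℝ) : Spc n × ℝ :=
  (p.1 + h • EuclideanSpace.single i (1 : ℝ), p.2)

/-- Second spatial partial `∂ᵢⱼ u`, as derivative of the `i`-th component of
the spatial gradient in direction `j`. -/
def secondPartial {n : ℕ} (u : Spc n × ℝ → ℝ) (i j : Fin n) (p : Spc n × ℝ) : ℝ :=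
  deriv (fun h : ℝ => spGrad u (dirPoint p j h) i) 0

/-- Spatial Laplacian `Δu`. -/
def lapl {n : ℕ} (u : Spc n × ℝ → ℝ) (p : Spc n × ℝ) : ℝ :=
  ∑ i, secondPartial u i i p

/-- `u` is a strong solution of `∂ₜ u - Δu = g · χ_{u>0}` on `U`:
continuous with continuous spatial gradient, and a.e. on `U` the time derivative and
the pure second spatial partials exist and the equation holds. -/
def IsStrongSolution {n : ℕ} (u : Spc n × ℝ → ℝ) (g : ℝ) (U : Set (Spc n × ℝ)) : Prop :=
  ContinuousOn u U ∧
  (∀ p ∈ U, HasGradientAt (fun y => u (y, p.2)) (spGrad u p) p.1) ∧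
  ContinuousOn (fun p => spGrad u p) U ∧
  (∀ᵐ p ∂(volume.restrict U),
    HasDerivAt (fun s => u (p.1, s)) (timeDeriv u p) p.2 ∧
    (∀ i : Fin n, HasDerivAt (fun h : ℝ => spGrad u (dirPoint p i h) i) (secondPartial u i i p) 0) ∧
    timeDeriv u p - lapl u p = (if 0 < u p then g else 0))

/-- The free boundary `Γ = ∂{u>0}` relative to the open set `U`. -/
def freeBdry {n : ℕ} (u : Spc n × ℝ → ℝ) (U : Set (Spc n × ℝ)) : Set (Spc n × ℝ) :=
  U ∩ frontier {p : Spc n × ℝ | 0 < u p}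

/-! ### Directional derivatives -/

/-- Directional derivative. -/
def dd {n : ℕ} (v : Spc n × ℝ) (f : Spc n × ℝ → ℝ) : Spc n × ℝ → ℝ := fun p => fderiv ℝ f p v

/-- Spatial unit vector. -/
def eX {n : ℕ} (i : Fin n) : Spc n × ℝ := (EuclideanSpace.single i (1 : ℝ), 0)

/-- Time unit vector. -/
def eT {n : ℕ} : Spc n × ℝ := (0, 1)

/-- The heat operator. -/
def Lop {n : ℕ} (f : Spc n × ℝ → ℝ) (p : Spc n × ℝ) : ℝ :=
  dd eT f p - ∑ i, dd (eX i) (dd (eX i) f) p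

/-- The adjoint heat operator. -/
def Ladj {n : ℕ} (f : Spc n × ℝ → ℝ) (p : Spc n × ℝ) : ℝ :=
  - dd eT f p - ∑ i, dd (eX i) (dd (eX i) f) p

abbrev Smooth {n : ℕ} (f : Spc n × ℝ → ℝ) : Prop := ContDiff ℝ (⊤ : ℕ∞) f

lemma Smooth.dd {n : ℕ} {f : Spc n × ℝ → ℝ} (hf : Smooth f) (v : Spc n × ℝ) :
    Smooth (dd v f) := by
  have h : ContDiff ℝ (⊤ : ℕ∞) (fderiv ℝ f) := hf.fderiv_right (by simp)
  exact h.clm_apply contDiff_const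

lemma Smooth.differentiable {n : ℕ} {f : Spc n × ℝ → ℝ} (hf : Smooth f) : Differentiable ℝ f :=
  ContDiff.differentiable hf (by simp)

lemma Smooth.Lop {n : ℕ} {f : Spc n × ℝ → ℝ} (hf : Smooth f) : Smooth (Lop f) := by
  have h1 := hf.dd eT
  have h2 : ∀ i : Fin n, Smooth (_root_.dd (eX i) (_root_.dd (eX i) f)) := fun i => (hf.dd _).dd _
  exact h1.sub (ContDiff.sum fun i _ => h2 i)

lemma Smooth.Ladj {n : ℕ} {f : Spc n × ℝ → ℝ} (hf : Smooth f) : Smooth (Ladj f) := by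
  have h1 := hf.dd eT
  have h2 : ∀ i : Fin n, Smooth (_root_.dd (eX i) (_root_.dd (eX i) f)) := fun i => (hf.dd _).dd _
  exact h1.neg.sub (ContDiff.sum fun i _ => h2 i)

lemma HasCompactSupport.dd {n : ℕ} {f : Spc n × ℝ → ℝ} (hf : HasCompactSupport f)
    (v : Spc n × ℝ) : HasCompactSupport (dd v f) :=
  hf.fderiv_apply (𝕜 := ℝ) v

lemma tsupport_dd {n : ℕ} (f : Spc n × ℝ → ℝ) (v : Spc n × ℝ) :
    tsupport (dd v f) ⊆ tsupport f :=
  tsupport_fderiv_apply_subset ℝ v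

/-- derivative along a line -/
lemma hasDerivAt_line {n : ℕ} {f : Spc n × ℝ → ℝ} {p v : Spc n × ℝ} {s : ℝ}
    (hf : DifferentiableAt ℝ f (p + s • v)) :
    HasDerivAt (fun s : ℝ => f (p + s • v)) (dd v f (p + s • v)) s := by
  have h1 : HasDerivAt (fun s : ℝ => p + s • v) v s := by
    simpa using ((hasDerivAt_id s).smul_const v).const_add p
  exact hf.hasFDerivAt.comp_hasDerivAt s h1

lemma dd_eq_of_line {n : ℕ} {f : Spc n × ℝ → ℝ} {p v : Spc n × ℝ} {d : ℝ}
    (hf : DifferentiableAt ℝ f p) (h : HasDerivAt (fun s : ℝ => f (p + s • v)) d 0) :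
    dd v f p = d := by
  have := hasDerivAt_line (f := f) (p := p) (v := v) (s := 0) (by simpa using hf)
  simpa using this.unique h

lemma first_diff {n : ℕ} {f : Spc n × ℝ → ℝ} (hf : Differentiable ℝ f) (p v : Spc n × ℝ)
    {h : ℝ} (hh : 0 < h) :
    ∃ ξ : ℝ, |ξ| ≤ h ∧ f (p + h • v) - f p = h * dd v f (p + ξ • v) := by
  obtain ⟨ξ, hξ, h1⟩ := exists_hasDerivAt_eq_slope (fun s : ℝ => f (p + s • v))
    (fun s => dd v f (p + s • v)) hh
    (fun s _ => (hasDerivAt_line (hf _)).continuousAt.continuousWithinAt)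
    (fun s _ => hasDerivAt_line (hf _))
  refine ⟨ξ, by rw [abs_of_pos hξ.1]; exact hξ.2.le, ?_⟩
  rw [h1]; simp; field_simp

lemma second_diff {n : ℕ} {f : Spc n × ℝ → ℝ} (hf : Smooth f) (p v : Spc n × ℝ)
    {h : ℝ} (hh : 0 < h) :
    ∃ ξ : ℝ, |ξ| ≤ h ∧ f (p + h • v) + f (p - h • v) - 2 * f p
      = h ^ 2 * dd v (dd v f) (p + ξ • v) := by
  set R := (f (p + h • v) + f (p - h • v) - 2 * f p) / h ^ 2 with hR
  have hd1 : ∀ s : ℝ, HasDerivAt (fun s : ℝ => f (p + s • v)) (dd v f (p + s • v)) s :=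
    fun s => hasDerivAt_line (hf.differentiable _)
  have hd2 : ∀ s : ℝ, HasDerivAt (fun s : ℝ => dd v f (p + s • v))
      (dd v (dd v f) (p + s • v)) s :=
    fun s => hasDerivAt_line ((hf.dd v).differentiable _)
  have hd1' : ∀ s : ℝ, HasDerivAt (fun s : ℝ => f (p + (-s) • v))
      (-dd v f (p + (-s) • v)) s := fun s => by
    have := (hd1 (-s)).scomp s (hasDerivAt_neg s)
    simpa [Function.comp_def] using this
  have hk : ∀ s : ℝ, HasDerivAt (fun s : ℝ => f (p + s • v) + f (p + (-s) • v) - s ^ 2 * R)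
      (dd v f (p + s • v) + -dd v f (p + (-s) • v) - 2 * s * R) s := fun s => by
    have := ((hd1 s).add (hd1' s)).sub ((hasDerivAt_pow 2 s).mul_const R)
    exact this.congr_deriv (by norm_num)
  obtain ⟨s, hs, h1⟩ := exists_hasDerivAt_eq_zero hh
    (fun s _ => (hk s).continuousAt.continuousWithinAt)
    (by
      have : R * h ^ 2 = f (p + h • v) + f (p - h • v) - 2 * f p := by
        rw [hR]; field_simp
      simp only [zero_smul, add_zero, neg_zero, neg_smul]
      rw [← sub_eq_add_neg]; linarith) (fun s _ => hk s)
  obtain ⟨ξ, hξ, h2⟩ := exists_hasDerivAt_eq_slope (fun s : ℝ => dd v f (p + s • v))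
    (fun s => dd v (dd v f) (p + s • v)) (show -s < s by linarith [hs.1])
    (fun s _ => (hd2 s).continuousAt.continuousWithinAt) (fun s _ => hd2 s)
  refine ⟨ξ, abs_le.2 ⟨by linarith [hξ.1, hs.2], by linarith [hξ.2, hs.2]⟩, ?_⟩
  have h3 : dd v (dd v f) (p + ξ • v) = R := by
    rw [h2, div_eq_iff (by linarith [hs.1])]; linarith
  rw [h3, hR]; field_simp

/-- comparison of the notions of the statement with directional derivatives -/
lemma spGrad_apply {n : ℕ} {f : Spc n × ℝ → ℝ} {p : Spc n × ℝ} (hf : DifferentiableAt ℝ f p)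
    (i : Fin n) : spGrad f p i = dd (eX i) f p := by
  have h1 : HasFDerivAt (fun y : Spc n => f (y, p.2))
      ((fderiv ℝ f p).comp (ContinuousLinearMap.inl ℝ (Spc n) ℝ)) p.1 := by
    have h2 : HasFDerivAt (fun y : Spc n => (y, p.2)) (ContinuousLinearMap.inl ℝ (Spc n) ℝ) p.1 :=
      hasFDerivAt_prodMk_left _ _
    exact (show HasFDerivAt f (fderiv ℝ f p) (p.1, p.2) from hf.hasFDerivAt).comp p.1 h2
  have h3 := h1.differentiableAt.hasGradientAt
  rw [hasGradientAt_iff_hasFDerivAt] at h3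
  have h4 := h3.unique h1
  have h5 := congrArg (fun A => A (EuclideanSpace.single i (1 : ℝ))) h4
  rw [InnerProductSpace.toDual_apply_apply, EuclideanSpace.inner_single_right] at h5
  simpa [spGrad, dd, eX] using h5

lemma dirPoint_eq {n : ℕ} (p : Spc n × ℝ) (i : Fin n) (h : ℝ) :
    dirPoint p i h = p + h • eX i := by
  simp [dirPoint, eX, Prod.ext_iff]

lemma secondPartial_hasDeriv {n : ℕ} {f F : Spc n × ℝ → ℝ} (hF : Smooth F) {p : Spc n × ℝ}
    (hfF : f =ᶠ[nhds p] F) (i : Fin n) :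
    HasDerivAt (fun h : ℝ => spGrad f (dirPoint p i h) i) (dd (eX i) (dd (eX i) F) p) 0 := by
  have h1 := hasDerivAt_line (f := dd (eX i) F) (p := p) (v := eX i) (s := 0)
    ((hF.dd _).differentiable _)
  simp only [zero_smul, add_zero] at h1
  refine h1.congr_of_eventuallyEq ?_
  have h2 : Tendsto (fun h : ℝ => p + h • eX i) (nhds 0) (nhds p) := by
    have : Continuous (fun h : ℝ => p + h • (eX i : Spc n × ℝ)) := by fun_prop
    simpa using this.tendsto 0
  have h3 := h2.eventually hfF.eventually_nhds
  filter_upwards [h3] with h hh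
  have h4 : DifferentiableAt ℝ f (p + h • eX i) := (hF.differentiable _).congr_of_eventuallyEq hh
  rw [dirPoint_eq, spGrad_apply h4, dd, dd, Filter.EventuallyEq.fderiv_eq hh]

lemma timeDeriv_hasDeriv {n : ℕ} {f F : Spc n × ℝ → ℝ} (hF : Differentiable ℝ F) {p : Spc n × ℝ}
    (hfF : f =ᶠ[nhds p] F) :
    HasDerivAt (fun s => f (p.1, s)) (dd eT F p) p.2 := by
  have h0 : HasDerivAt (fun s : ℝ => (p.1, s)) (eT : Spc n × ℝ) p.2 :=
    (hasDerivAt_const p.2 p.1).prodMk (hasDerivAt_id p.2)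
  have h1 : HasDerivAt (fun s => F (p.1, s)) (dd eT F p) p.2 :=
    (show HasFDerivAt F (fderiv ℝ F p) (p.1, p.2) from (hF p).hasFDerivAt).comp_hasDerivAt p.2 h0
  refine h1.congr_of_eventuallyEq ?_
  have h2 : Tendsto (fun s : ℝ => (p.1, s)) (nhds p.2) (nhds p) := h0.continuousAt.tendsto
  exact h2.eventually hfF

lemma lapl_eq {n : ℕ} {f F : Spc n × ℝ → ℝ} (hF : Smooth F) {p : Spc n × ℝ}
    (hfF : f =ᶠ[nhds p] F) : lapl f p = ∑ i, dd (eX i) (dd (eX i) F) p := by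
  refine Finset.sum_congr rfl fun i _ => ?_
  exact (secondPartial_hasDeriv hF hfF i).deriv

lemma timeDeriv_eq {n : ℕ} {f F : Spc n × ℝ → ℝ} (hF : Differentiable ℝ F) {p : Spc n × ℝ}
    (hfF : f =ᶠ[nhds p] F) : timeDeriv f p = dd eT F p :=
  (timeDeriv_hasDeriv hF hfF).deriv

/-! ### The explicit monotone scheme -/

/-- standard basis vector -/
abbrev ev {n : ℕ} (i : Fin n) : Spc n := EuclideanSpace.single i (1 : ℝ)

/-- averaging over the stencil -/
def Av {n : ℕ} (ε : ℝ) (v : Spc n → ℝ) (x : Spc n) : ℝ :=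
  (2 * (n : ℝ))⁻¹ * ∑ i : Fin n, (v (x + ε • ev i) + v (x - ε • ev i))

/-- time step -/
def tau (n : ℕ) (ε : ℝ) : ℝ := ε ^ 2 / (2 * n)

lemma tau_pos {n : ℕ} (hn : 1 ≤ n) {ε : ℝ} (hε : 0 < ε) : 0 < tau n ε := by
  have : (0 : ℝ) < n := by exact_mod_cast hn
  unfold tau; positivity

/-- The Heaviside function -/
def hv (s : ℝ) : ℝ := if 0 < s then 1 else 0

lemma hv_mono : Monotone hv := by
  intro a b hab
  unfold hv
  split_ifs with h1 h2
  · exact le_rfl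
  · exact absurd (h1.trans_le hab) h2
  · norm_num
  · exact le_rfl

lemma hv_nonneg (s : ℝ) : 0 ≤ hv s := by unfold hv; split_ifs <;> norm_num
lemma hv_le_one (s : ℝ) : hv s ≤ 1 := by unfold hv; split_ifs <;> norm_num
lemma hv_measurable : Measurable hv := hv_mono.measurable

/-- The scheme. -/
def sch {n : ℕ} (ψ : Spc n × ℝ → ℝ) (ε : ℝ) : ℕ → Spc n → ℝ
  | 0 => fun x => ψ (x, 0)
  | j + 1 => fun x =>
      if ‖x‖ < 1 then Av ε (sch ψ ε j) x + tau n ε * hv (sch ψ ε j x)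
      else ψ (x, ((j + 1 : ℕ) : ℝ) * tau n ε)

lemma norm_stencil {n : ℕ} {ε : ℝ} (hε : 0 ≤ ε) (i : Fin n) : ‖ε • (ev i : Spc n)‖ = ε := by
  rw [norm_smul]; simp [abs_of_nonneg hε]

lemma Av_mono {n : ℕ} {ε : ℝ} (hε : 0 ≤ ε) {v w : Spc n → ℝ} {x : Spc n}
    (h : ∀ y, ‖y - x‖ ≤ ε → v y ≤ w y) : Av ε v x ≤ Av ε w x := by
  unfold Av
  refine mul_le_mul_of_nonneg_left (Finset.sum_le_sum fun i _ => add_le_add (h _ ?_) (h _ ?_))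
    (by positivity)
  · simp [norm_stencil hε]
  · rw [sub_sub_cancel_left, norm_neg, norm_stencil hε]

lemma Av_add {n : ℕ} (ε : ℝ) (v w : Spc n → ℝ) (x : Spc n) :
    Av ε (fun y => v y + w y) x = Av ε v x + Av ε w x := by
  unfold Av
  rw [← mul_add, ← Finset.sum_add_distrib]
  congr 1
  refine Finset.sum_congr rfl fun i _ => by ring

lemma Av_sub {n : ℕ} (ε : ℝ) (v w : Spc n → ℝ) (x : Spc n) :
    Av ε (fun y => v y - w y) x = Av ε v x - Av ε w x := by
  unfold Av
  rw [← mul_sub, ← Finset.sum_sub_distrib]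
  congr 1
  refine Finset.sum_congr rfl fun i _ => by ring

lemma Av_const {n : ℕ} (hn : 1 ≤ n) (ε k : ℝ) (x : Spc n) : Av ε (fun _ => k) x = k := by
  have : (0 : ℝ) < n := by exact_mod_cast hn
  unfold Av
  simp
  field_simp
  ring

lemma Av_quad {n : ℕ} (hn : 1 ≤ n) (ε a C : ℝ) (x : Spc n) :
    Av ε (fun y => C * (a - ‖y‖ ^ 2)) x = C * (a - ‖x‖ ^ 2) - C * ε ^ 2 := by
  have hn' : (0 : ℝ) < n := by exact_mod_cast hn
  have h : ∀ i : Fin n, C * (a - ‖x + ε • ev i‖ ^ 2) + C * (a - ‖x - ε • ev i‖ ^ 2)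
      = 2 * (C * (a - ‖x‖ ^ 2) - C * ε ^ 2) := fun i => by
    rw [norm_add_sq_real, norm_sub_sq_real, norm_smul]
    simp
    ring
  unfold Av
  simp only [h]
  simp
  field_simp

lemma Av_le_const {n : ℕ} (hn : 1 ≤ n) {ε k : ℝ} (hε : 0 ≤ ε) {v : Spc n → ℝ} {x : Spc n}
    (h : ∀ y, ‖y - x‖ ≤ ε → v y ≤ k) : Av ε v x ≤ k := by
  have := Av_mono (w := fun _ => k) hε h
  rwa [Av_const hn] at this

lemma const_le_Av {n : ℕ} (hn : 1 ≤ n) {ε k : ℝ} (hε : 0 ≤ ε) {v : Spc n → ℝ} {x : Spc n}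
    (h : ∀ y, ‖y - x‖ ≤ ε → k ≤ v y) : k ≤ Av ε v x := by
  have := Av_mono (v := fun _ => k) hε h
  rwa [Av_const hn] at this

/-- The quantitative assumptions on the datum. -/
structure Dat {n : ℕ} (ψ : Spc n × ℝ → ℝ) (c S L K : ℝ) : Prop where
  hL0 : 0 ≤ L
  hK0 : 0 ≤ K
  hc : 0 < c
  lip : ∀ x y t s, ‖x‖ ≤ 2 → ‖y‖ ≤ 2 → t ∈ Icc 0 S → s ∈ Icc 0 S →
    |ψ (x, t) - ψ (y, s)| ≤ L * (‖x - y‖ + |t - s|)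
  cons : ∀ ε x t, 0 < ε → ε ≤ 1 → ‖x‖ ≤ 1 → t ∈ Icc 0 S →
    |Av ε (fun y => ψ (y, t)) x - ψ (x, t)| ≤ K * tau n ε
  mono : ∀ x t s, t ≤ s → c * (s - t) ≤ ψ (x, s) - ψ (x, t)

lemma sch_outside {n : ℕ} (ψ : Spc n × ℝ → ℝ) (ε : ℝ) (j : ℕ) {x : Spc n} (hx : 1 ≤ ‖x‖) :
    sch ψ ε j x = ψ (x, (j : ℝ) * tau n ε) := by
  cases j with
  | zero => simp [sch]
  | succ j => simp only [sch]; rw [if_neg (not_lt.2 hx)]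

lemma sch_inside {n : ℕ} (ψ : Spc n × ℝ → ℝ) (ε : ℝ) (j : ℕ) {x : Spc n} (hx : ‖x‖ < 1) :
    sch ψ ε (j + 1) x = Av ε (sch ψ ε j) x + tau n ε * hv (sch ψ ε j x) := by
  simp only [sch]; rw [if_pos hx]

section
variable {n : ℕ} {ψ : Spc n × ℝ → ℝ} {c S L K ε c' : ℝ}

lemma sch_rate (hn : 1 ≤ n) (hD : Dat ψ c S L K) (hε : 0 < ε) (hc' : c' ≤ c) (hc0 : 0 ≤ c')
    (hinit : ∀ x : Spc n, ‖x‖ < 1 → c' * tau n ε ≤ Av ε (fun y => ψ (y, 0)) x - ψ (x, 0))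
    (j : ℕ) (x : Spc n) : c' * tau n ε ≤ sch ψ ε (j + 1) x - sch ψ ε j x := by
  have hτ := tau_pos hn hε
  induction j generalizing x with
  | zero =>
    by_cases hx : ‖x‖ < 1
    · rw [sch_inside _ _ _ hx]
      have h1 := hinit x hx
      have h2 := mul_nonneg hτ.le (hv_nonneg (sch ψ ε 0 x))
      have h3 : sch ψ ε 0 = fun y => ψ (y, 0) := rfl
      rw [h3] at h2 ⊢
      linarith
    · rw [sch_outside _ _ _ (not_lt.1 hx), sch_outside _ _ _ (not_lt.1 hx)]
      have h1 := hD.mono x ((0 : ℕ) * tau n ε) ((0 + 1 : ℕ) * tau n ε) (by simp; exact hτ.le)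
      refine le_trans ?_ h1
      push_cast
      nlinarith
  | succ j ih =>
    by_cases hx : ‖x‖ < 1
    · have e1 := sch_inside ψ ε (j + 1) hx
      have e2 := sch_inside ψ ε j hx
      have h1 : c' * tau n ε ≤ Av ε (fun y => sch ψ ε (j + 1) y - sch ψ ε j y) x :=
        const_le_Av hn hε.le fun y _ => ih y
      rw [Av_sub] at h1
      have h2 : hv (sch ψ ε j x) ≤ hv (sch ψ ε (j + 1) x) := by
        apply hv_mono
        have := ih x
        have h4 : 0 ≤ c' * tau n ε := by positivity
        linarith
      have h3 := mul_le_mul_of_nonneg_left h2 hτ.le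
      linarith
    · rw [sch_outside _ _ _ (not_lt.1 hx), sch_outside _ _ _ (not_lt.1 hx)]
      have h1 := hD.mono x ((j + 1 : ℕ) * tau n ε) ((j + 1 + 1 : ℕ) * tau n ε)
        (by push_cast; nlinarith)
      refine le_trans ?_ h1
      push_cast
      nlinarith

lemma sch_rate_m (hn : 1 ≤ n) (hD : Dat ψ c S L K) (hε : 0 < ε) (hc' : c' ≤ c) (hc0 : 0 ≤ c')
    (hinit : ∀ x : Spc n, ‖x‖ < 1 → c' * tau n ε ≤ Av ε (fun y => ψ (y, 0)) x - ψ (x, 0))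
    (j m : ℕ) (x : Spc n) : c' * (m * tau n ε) ≤ sch ψ ε (j + m) x - sch ψ ε j x := by
  induction m with
  | zero => simp
  | succ m ih =>
    have := sch_rate hn hD hε hc' hc0 hinit (j + m) x
    rw [← add_assoc]
    push_cast
    linarith

lemma sch_barrier (hn : 1 ≤ n) (hD : Dat ψ c S L K) (hε : 0 < ε) (hε1 : ε ≤ 1)
    (j : ℕ) (hj : j * tau n ε ≤ S) (x : Spc n) (hx : ‖x‖ < 1 + ε) :
    |sch ψ ε j x - ψ (x, j * tau n ε)| ≤ (K + L + 1) / (2 * n) * ((1 + ε) ^ 2 - ‖x‖ ^ 2) := by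
  have hτ := tau_pos hn hε
  have hn' : (0 : ℝ) < n := by exact_mod_cast hn
  have hL0 := hD.hL0
  have hK0 := hD.hK0
  set C := (K + L + 1) / (2 * n) with hC
  have hC0 : 0 ≤ C := by positivity
  have hCε : C * ε ^ 2 = (K + L + 1) * tau n ε := by
    rw [hC, tau]; field_simp
  have hb : ∀ y : Spc n, ‖y‖ < 1 + ε → 0 ≤ C * ((1 + ε) ^ 2 - ‖y‖ ^ 2) := fun y hy => by
    apply mul_nonneg hC0
    have := norm_nonneg y
    nlinarith
  induction j generalizing x with
  | zero => simpa [sch] using hb x hx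
  | succ j ih =>
    by_cases hx1 : ‖x‖ < 1
    · have hjS : (j : ℝ) * tau n ε ≤ S := le_trans (by push_cast; nlinarith) hj
      have hj0 : 0 ≤ (j : ℝ) * tau n ε := by positivity
      have hst : ∀ y : Spc n, ‖y - x‖ ≤ ε → ‖y‖ < 1 + ε := fun y hy => by
        have := norm_add_le (y - x) x
        rw [sub_add_cancel] at this
        linarith
      rw [sch_inside _ _ _ hx1]
      have h1 := hD.cons ε x (j * tau n ε) hε hε1 hx1.le ⟨hj0, hjS⟩
      have h2 := hD.lip x x (j * tau n ε) ((j + 1 : ℕ) * tau n ε) (by linarith) (by linarith)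
        ⟨hj0, hjS⟩ ⟨by positivity, hj⟩
      have h2' : ‖x - x‖ + |(j : ℝ) * tau n ε - ((j + 1 : ℕ) : ℝ) * tau n ε| = tau n ε := by
        push_cast
        rw [sub_self, norm_zero, zero_add, show (j : ℝ) * tau n ε - (j + 1) * tau n ε = -tau n ε by
          ring, abs_neg, abs_of_pos hτ]
      rw [h2'] at h2
      have h3 : Av ε (fun y => sch ψ ε j y - ψ (y, j * tau n ε)) x
          ≤ C * ((1 + ε) ^ 2 - ‖x‖ ^ 2) - C * ε ^ 2 := by
        rw [← Av_quad hn ε ((1 + ε) ^ 2) C x]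
        exact Av_mono hε.le fun y hy => (abs_le.1 (ih hjS y (hst y hy))).2
      have h4 : -(C * ((1 + ε) ^ 2 - ‖x‖ ^ 2) - C * ε ^ 2) ≤
          Av ε (fun y => sch ψ ε j y - ψ (y, j * tau n ε)) x := by
        have : Av ε (fun y : Spc n => (-C) * ((1 + ε) ^ 2 - ‖y‖ ^ 2)) x ≤
          Av ε (fun y => sch ψ ε j y - ψ (y, j * tau n ε)) x := by
          refine Av_mono hε.le fun y hy => ?_
          have := (abs_le.1 (ih hjS y (hst y hy))).1
          linarith
        rw [Av_quad hn] at this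
        linarith
      rw [Av_sub] at h3 h4
      have h5 := mul_nonneg hτ.le (hv_nonneg (sch ψ ε j x))
      have h6 := mul_le_mul_of_nonneg_left (hv_le_one (sch ψ ε j x)) hτ.le
      rw [abs_le] at h1 h2 ⊢
      constructor <;> nlinarith [h1.1, h1.2, h2.1, h2.2]
    · rw [sch_outside _ _ _ (not_lt.1 hx1)]
      simpa using hb x hx

lemma sch_init (hn : 1 ≤ n) (hD : Dat ψ c S L K) (hε : 0 < ε) (hε1 : ε ≤ 1)
    (j : ℕ) (hj : j * tau n ε ≤ S) (x : Spc n) (hx : ‖x‖ ≤ 2) :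
    |sch ψ ε j x - ψ (x, 0)| ≤ (K + L + 1) * (j * tau n ε) := by
  have hτ := tau_pos hn hε
  have hL0 := hD.hL0
  have hK0 := hD.hK0
  have hS : 0 ≤ S := le_trans (by positivity) hj
  induction j generalizing x with
  | zero => simp [sch]
  | succ j ih =>
    by_cases hx1 : ‖x‖ < 1
    · have hjS : (j : ℝ) * tau n ε ≤ S := le_trans (by push_cast; nlinarith) hj
      have hst : ∀ y : Spc n, ‖y - x‖ ≤ ε → ‖y‖ ≤ 2 := fun y hy => by
        have := norm_add_le (y - x) x
        rw [sub_add_cancel] at this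
        linarith
      rw [sch_inside _ _ _ hx1]
      have h1 := hD.cons ε x 0 hε hε1 hx1.le ⟨le_rfl, hS⟩
      have h3 : Av ε (fun y => sch ψ ε j y - ψ (y, 0)) x ≤ (K + L + 1) * (j * tau n ε) :=
        Av_le_const hn hε.le fun y hy => (abs_le.1 (ih hjS y (hst y hy))).2
      have h4 : -((K + L + 1) * (j * tau n ε)) ≤ Av ε (fun y => sch ψ ε j y - ψ (y, 0)) x :=
        const_le_Av hn hε.le fun y hy => (abs_le.1 (ih hjS y (hst y hy))).1
      rw [Av_sub] at h3 h4
      have h5 := mul_nonneg hτ.le (hv_nonneg (sch ψ ε j x))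
      have h6 := mul_le_mul_of_nonneg_left (hv_le_one (sch ψ ε j x)) hτ.le
      have h7 : 0 ≤ L * tau n ε := by positivity
      rw [abs_le] at h1 ⊢
      push_cast
      constructor <;> nlinarith [h1.1, h1.2]
    · rw [sch_outside _ _ _ (not_lt.1 hx1)]
      have h2 := hD.lip x x ((j + 1 : ℕ) * tau n ε) 0 hx hx ⟨by positivity, hj⟩ ⟨le_rfl, hS⟩
      refine h2.trans ?_
      rw [sub_self, norm_zero, zero_add, sub_zero, abs_of_nonneg (by positivity)]
      have : 0 ≤ ((j + 1 : ℕ) : ℝ) * tau n ε := by positivity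
      nlinarith

set_option maxHeartbeats 1000000 in
lemma sch_cone (hn : 1 ≤ n) (hD : Dat ψ c S L K) (hε : 0 < ε) (hε1 : ε ≤ 1)
    (hinit : ∀ x : Spc n, ‖x‖ < 1 → c / 2 * tau n ε ≤ Av ε (fun y => ψ (y, 0)) x - ψ (x, 0))
    (j m : ℕ) (hj : (j + m : ℕ) * tau n ε ≤ S) (x y : Spc n) (hx : ‖x‖ ≤ 2) (hy : ‖y‖ ≤ 2)
    (hm : 2 * (L + 3 * ((K + L + 1) / (2 * n))) / c * (‖x - y‖ + ε) ≤ m * tau n ε) :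
    sch ψ ε j y ≤ sch ψ ε (j + m) x := by
  have hτ := tau_pos hn hε
  have hn' : (0 : ℝ) < n := by exact_mod_cast hn
  have hL0 := hD.hL0
  have hK0 := hD.hK0
  have hc := hD.hc
  set C := (K + L + 1) / (2 * n) with hC
  have hC0 : 0 ≤ C := by positivity
  have hm' : (L + 3 * C) * (‖x - y‖ + ε) ≤ c / 2 * (m * tau n ε) := by
    have := mul_le_mul_of_nonneg_left hm (by positivity : 0 ≤ c / 2)
    refine le_trans (le_of_eq ?_) this
    field_simp
  have hd := norm_nonneg (x - y)
  have hmt : 0 ≤ (m : ℝ) * tau n ε := by positivity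
  have hjt : 0 ≤ (j : ℝ) * tau n ε := by positivity
  have hS : 0 ≤ S := le_trans (by positivity) hj
  -- comparison of the data
  have hdata : ∀ (j : ℕ) (x y : Spc n), (j + m : ℕ) * tau n ε ≤ S → ‖x‖ ≤ 2 → ‖y‖ ≤ 2 →
      (L + 3 * C) * (‖x - y‖ + ε) ≤ c / 2 * (m * tau n ε) →
      ψ (y, j * tau n ε) + 3 * C * (‖x - y‖ + ε) ≤ ψ (x, (j + m : ℕ) * tau n ε) := by
    intro j x y hj hx hy hm'
    have hd := norm_nonneg (x - y)
    have hjt : 0 ≤ (j : ℝ) * tau n ε := by positivity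
    push_cast at hj ⊢
    have h1 := hD.mono x (j * tau n ε) ((j + m) * tau n ε) (by nlinarith)
    have h2 := hD.lip y x (j * tau n ε) (j * tau n ε) hy hx ⟨hjt, by nlinarith⟩ ⟨hjt, by nlinarith⟩
    rw [norm_sub_rev, sub_self, abs_zero, add_zero] at h2
    have h3 := (abs_le.1 h2).2
    have h4 : 0 ≤ L * ε := by positivity
    have h5 : 0 ≤ c * (m * tau n ε) := by positivity
    nlinarith
  clear hd hjt hm
  induction j generalizing x y with
  | zero =>
    have hd := norm_nonneg (x - y)
    have h1 := sch_rate_m hn hD hε (by linarith) (by linarith) hinit 0 m x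
    have h2 := hD.lip y x 0 0 hy hx ⟨le_rfl, hS⟩ ⟨le_rfl, hS⟩
    rw [norm_sub_rev, sub_self, abs_zero, add_zero] at h2
    have h3 := (abs_le.1 h2).2
    have h4 : 0 ≤ L * ε := by positivity
    have h5 : 0 ≤ 3 * C * (‖x - y‖ + ε) := by positivity
    simp only [sch] at h1 ⊢
    nlinarith
  | succ j ih =>
    have hd := norm_nonneg (x - y)
    have hjt : 0 ≤ ((j + 1 : ℕ) : ℝ) * tau n ε := by positivity
    have hjS : ((j + m : ℕ) : ℝ) * tau n ε ≤ S :=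
      le_trans (by push_cast; nlinarith) hj
    have hbar : ∀ x y : Spc n, 1 ≤ ‖x‖ → ‖y‖ < 1 →
        C * ((1 + ε) ^ 2 - ‖y‖ ^ 2) ≤ 3 * C * (‖x - y‖ + ε) := fun x y hx hy => by
      have h1 := norm_add_le (x - y) y
      rw [sub_add_cancel] at h1
      have h2 := norm_nonneg y
      have h3 := norm_nonneg (x - y)
      have : (1 + ε) ^ 2 - ‖y‖ ^ 2 ≤ 3 * (‖x - y‖ + ε) := by nlinarith
      nlinarith
    have hjm : ((j + 1 + m : ℕ) : ℝ) = ((j + m + 1 : ℕ) : ℝ) := by push_cast; ring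
    have hjy : ((j + 1 : ℕ) : ℝ) * tau n ε ≤ S := le_trans (by push_cast; nlinarith) hj
    by_cases hy1 : ‖y‖ < 1
    · by_cases hx1 : ‖x‖ < 1
      · have he : j + 1 + m = (j + m) + 1 := by ring
        rw [he, sch_inside _ _ _ hx1, sch_inside _ _ _ hy1]
        have hstep : ∀ w : Spc n, ‖w‖ ≤ ε → sch ψ ε j (y + w) ≤ sch ψ ε (j + m) (x + w) := by
          intro w hw
          have h1 := norm_add_le x w
          have h2 := norm_add_le y w
          have h3 : x + w - (y + w) = x - y := by abel
          exact ih hjS (x + w) (y + w) (by linarith) (by linarith) (by rw [h3]; exact hm')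
        have h1 : Av ε (sch ψ ε j) y ≤ Av ε (sch ψ ε (j + m)) x := by
          unfold Av
          refine mul_le_mul_of_nonneg_left (Finset.sum_le_sum fun i _ => add_le_add ?_ ?_)
            (by positivity)
          · exact hstep _ (norm_stencil hε.le i).le
          · rw [sub_eq_add_neg, sub_eq_add_neg]
            exact hstep _ (by rw [norm_neg]; exact (norm_stencil hε.le i).le)
        have h2 : sch ψ ε j y ≤ sch ψ ε (j + m) x := by
          simpa using hstep 0 (by simpa using hε.le)
        have h3 := mul_le_mul_of_nonneg_left (hv_mono h2) hτ.le
        linarith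
      · have h1 := hdata (j + 1) x y hj hx hy hm'
        rw [sch_outside _ _ _ (not_lt.1 hx1)]
        have h2 := (abs_le.1 (sch_barrier hn hD hε hε1 (j + 1) hjy y (by linarith))).2
        have h3 := hbar x y (not_lt.1 hx1) hy1
        linarith
    · have h1 := hdata (j + 1) x y hj hx hy hm'
      rw [sch_outside _ _ _ (not_lt.1 hy1)]
      by_cases hx1 : ‖x‖ < 1
      · have h2 := (abs_le.1 (sch_barrier hn hD hε hε1 (j + 1 + m) hj x (by linarith))).1
        have h3 := hbar y x (not_lt.1 hy1) hx1
        rw [norm_sub_rev] at h3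
        linarith
      · rw [sch_outside _ _ _ (not_lt.1 hx1)]
        have : 0 ≤ 3 * C * (‖x - y‖ + ε) := by positivity
        linarith

lemma sch_measurable (hψ : Continuous ψ) (ε : ℝ) (j : ℕ) : Measurable (sch ψ ε j) := by
  induction j with
  | zero => exact (hψ.comp (by fun_prop)).measurable
  | succ j ih =>
    have h : Measurable (Av ε (sch ψ ε j)) := by
      unfold Av
      refine Measurable.const_mul (Finset.measurable_sum _ fun i _ => ?_) _
      exact (ih.comp (measurable_id.add_const _)).add (ih.comp (measurable_id.sub_const _))
    refine Measurable.ite (measurableSet_lt measurable_norm measurable_const) ?_ ?_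
    · exact h.add ((hv_measurable.comp ih).const_mul _)
    · exact (hψ.comp (by fun_prop)).measurable

end

/-! ### Verification of the assumptions on the datum -/

lemma Av_smooth {n : ℕ} (hn : 1 ≤ n) {φ : Spc n × ℝ → ℝ} (hφ : Smooth φ) {ε : ℝ} (hε : 0 < ε)
    (x : Spc n) (t : ℝ) : ∃ ξ : Fin n → ℝ, (∀ i, |ξ i| ≤ ε) ∧
      Av ε (fun y => φ (y, t)) x - φ (x, t)
        = tau n ε * ∑ i, dd (eX i) (dd (eX i) φ) ((x, t) + ξ i • eX i) := by
  have hn' : (0 : ℝ) < n := by exact_mod_cast hn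
  choose ξ hξ h using fun i : Fin n => second_diff hφ (x, t) (eX i) hε
  refine ⟨ξ, hξ, ?_⟩
  have h1 : ∀ i : Fin n, φ (x + ε • ev i, t) + φ (x - ε • ev i, t)
      = ε ^ 2 * dd (eX i) (dd (eX i) φ) ((x, t) + ξ i • eX i) + 2 * φ (x, t) := fun i => by
    rw [← h i]
    simp [eX]
  unfold Av tau
  simp only [h1]
  rw [Finset.sum_add_distrib, ← Finset.mul_sum]
  simp
  field_simp
  ring

lemma compact_bd {n : ℕ} {f : Spc n × ℝ → ℝ} (hf : Continuous f) (r S : ℝ) :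
    ∃ M, 0 ≤ M ∧ ∀ x t, ‖x‖ ≤ r → t ∈ Icc 0 S → |f (x, t)| ≤ M := by
  have hK : IsCompact (closedBall (0 : Spc n) r ×ˢ Icc (0 : ℝ) S) :=
    (isCompact_closedBall _ _).prod isCompact_Icc
  obtain ⟨M, hM⟩ := hK.exists_bound_of_continuousOn hf.continuousOn
  refine ⟨max M 0, le_max_right _ _, fun x t hx ht => le_trans ?_ (le_max_left _ _)⟩
  exact hM (x, t) ⟨by simpa using hx, ht⟩

lemma exists_dat {n : ℕ} (hn : 1 ≤ n) {c S : ℝ} (hc : 0 < c) {ψ : Spc n × ℝ → ℝ} (hψ : Smooth ψ)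
    (hψt : ∀ p : Spc n × ℝ, c ≤ timeDeriv ψ p) : ∃ L K, Dat ψ c S L K := by
  have hK : IsCompact (closedBall (0 : Spc n) 2 ×ˢ Icc (0 : ℝ) S) :=
    (isCompact_closedBall _ _).prod isCompact_Icc
  have hcv : Convex ℝ (closedBall (0 : Spc n) 2 ×ˢ Icc (0 : ℝ) S) :=
    (convex_closedBall _ _).prod (convex_Icc _ _)
  obtain ⟨L, hL⟩ := hK.exists_bound_of_continuousOn
    (hψ.continuous_fderiv (by simp)).continuousOn
  choose M hM0 hM using fun i : Fin n => compact_bd ((hψ.dd (eX i)).dd (eX i)).continuous 2 S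
  refine ⟨max L 0, ∑ i, M i, le_max_right _ _, Finset.sum_nonneg fun i _ => hM0 i, hc, ?_, ?_, ?_⟩
  · intro x y t s hx hy ht hs
    have h1 := hcv.norm_image_sub_le_of_norm_fderiv_le (𝕜 := ℝ) (f := ψ) (C := max L 0)
      (fun p _ => hψ.differentiable p) (fun p hp => (hL p hp).trans (le_max_left _ _))
      (x := (y, s)) (y := (x, t)) ⟨by simpa using hy, hs⟩ ⟨by simpa using hx, ht⟩
    refine h1.trans (mul_le_mul_of_nonneg_left ?_ (le_max_right _ _))
    rw [Prod.mk_sub_mk, Prod.norm_mk, Real.norm_eq_abs]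
    exact max_le (by linarith [abs_nonneg (t - s)]) (by linarith [norm_nonneg (x - y)])
  · intro ε x t hε hε1 hx ht
    obtain ⟨ξ, hξ, h⟩ := Av_smooth hn hψ hε x t
    have hτ := tau_pos hn hε
    rw [h, abs_mul, abs_of_pos hτ, mul_comm]
    refine mul_le_mul_of_nonneg_right ((Finset.abs_sum_le_sum_abs _ _).trans
      (Finset.sum_le_sum fun i _ => ?_)) hτ.le
    have h2 : (x, t) + ξ i • (eX i : Spc n × ℝ) = (x + ξ i • ev i, t) := by simp [eX]
    rw [h2]
    refine hM i _ _ ?_ ht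
    refine (norm_add_le _ _).trans ?_
    have : ‖ξ i • (ev i : Spc n)‖ ≤ 1 := by
      rw [norm_smul]; simpa using (hξ i).trans hε1
    linarith
  · intro x t s hts
    rcases hts.eq_or_lt with rfl | hlt
    · simp
    have hd : ∀ r, HasDerivAt (fun s => ψ (x, s)) (timeDeriv ψ (x, r)) r := fun r => by
      have := timeDeriv_hasDeriv hψ.differentiable (p := (x, r)) (EventuallyEq.refl _ _)
      rwa [← timeDeriv_eq hψ.differentiable (EventuallyEq.refl _ _)] at this
    obtain ⟨ξ, hξ, h1⟩ := exists_hasDerivAt_eq_slope (fun s => ψ (x, s)) _ hlt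
      (fun r _ => (hd r).continuousAt.continuousWithinAt) (fun r _ => hd r)
    have h2 := hψt (x, ξ)
    rw [h1, le_div_iff₀ (by linarith)] at h2
    exact h2

lemma init_ok {n : ℕ} (hn : 1 ≤ n) {c : ℝ} {ψ : Spc n × ℝ → ℝ} (hψ : Smooth ψ)
    (hψlap : ∀ x ∈ closedBall (0 : Spc n) 1, c ≤ lapl ψ (x, 0)) {δ : ℝ} (hδ : 0 < δ) :
    ∃ ε₀ > 0, ∀ ε, 0 < ε → ε ≤ ε₀ → ∀ x : Spc n, ‖x‖ < 1 →
      (c - δ) * tau n ε ≤ Av ε (fun y => ψ (y, 0)) x - ψ (x, 0) := by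
  have hn' : (0 : ℝ) < n := by exact_mod_cast hn
  have hK : IsCompact (closedBall (0 : Spc n) 2 ×ˢ Icc (0 : ℝ) 1) :=
    (isCompact_closedBall _ _).prod isCompact_Icc
  have huc : ∀ i : Fin n, ∃ η > 0, ∀ p ∈ (closedBall (0 : Spc n) 2 ×ˢ Icc (0 : ℝ) 1),
      ∀ q ∈ (closedBall (0 : Spc n) 2 ×ˢ Icc (0 : ℝ) 1), dist p q < η →
      dist (dd (eX i) (dd (eX i) ψ) p) (dd (eX i) (dd (eX i) ψ) q) < δ / n := fun i =>
    Metric.uniformContinuousOn_iff.1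
      (hK.uniformContinuousOn_of_continuous ((hψ.dd (eX i)).dd (eX i)).continuous.continuousOn)
      (δ / n) (by positivity)
  choose η hη huc using huc
  haveI : Nonempty (Fin n) := ⟨⟨0, hn⟩⟩
  obtain ⟨i₀, hi₀⟩ := Finite.exists_min η
  refine ⟨min 1 (η i₀ / 2), lt_min one_pos (by have := hη i₀; positivity), ?_⟩
  intro ε hε hεε x hx
  obtain ⟨ξ, hξ, h⟩ := Av_smooth hn hψ hε x 0
  have hτ := tau_pos hn hε
  rw [h, mul_comm]
  refine mul_le_mul_of_nonneg_left ?_ hτ.le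
  have h1 := hψlap x (by simpa using hx.le)
  rw [lapl_eq hψ (EventuallyEq.refl _ _)] at h1
  have h2 : ∑ i, (dd (eX i) (dd (eX i) ψ) (x, 0) - δ / n)
      ≤ ∑ i, dd (eX i) (dd (eX i) ψ) ((x, 0) + ξ i • eX i) := by
    refine Finset.sum_le_sum fun i _ => ?_
    have h2 : (x, (0 : ℝ)) + ξ i • (eX i : Spc n × ℝ) = (x + ξ i • ev i, 0) := by simp [eX]
    have h3 : ‖ξ i • (ev i : Spc n)‖ ≤ ε := by
      rw [norm_smul]; simpa using (hξ i)
    have h3' : ε ≤ 1 := hεε.trans (min_le_left _ _)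
    have h4 := huc i (x, 0) ⟨by simp; linarith, by simp⟩ ((x, (0 : ℝ)) + ξ i • eX i) (by
      rw [h2]
      refine ⟨?_, by simp⟩
      simp only [mem_closedBall, dist_zero_right]
      refine (norm_add_le _ _).trans (by linarith)) (by
      rw [h2, dist_comm, dist_eq_norm, Prod.mk_sub_mk, Prod.norm_mk, add_sub_cancel_left]
      have := hεε.trans (min_le_right _ _)
      have h5 := hη i₀
      have h6 := hi₀ i
      simp only [sub_self, norm_zero]
      exact max_lt (by linarith) (by linarith))
    rw [Real.dist_eq] at h4
    linarith [(abs_lt.1 h4).2]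
  rw [Finset.sum_sub_distrib] at h2
  simp only [Finset.sum_const, Finset.card_univ, Fintype.card_fin, nsmul_eq_mul] at h2
  have : (n : ℝ) * (δ / n) = δ := by field_simp
  linarith

/-! ### Compactness -/

lemma bdd_le {a : ℕ → ℝ} {M : ℝ} (h : ∀ k, |a k| ≤ M) :
    IsBoundedUnder (· ≤ ·) atTop a := isBoundedUnder_of ⟨M, fun k => (abs_le.1 (h k)).2⟩

lemma bdd_ge {a : ℕ → ℝ} {M : ℝ} (h : ∀ k, |a k| ≤ M) :
    IsBoundedUnder (· ≥ ·) atTop a := isBoundedUnder_of ⟨-M, fun k => (abs_le.1 (h k)).1⟩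

lemma limsup_add_le_of {a b : ℕ → ℝ} {M d : ℝ} (ha : ∀ k, |a k| ≤ M) (hb : ∀ k, |b k| ≤ M)
    (h : ∀ᶠ k in atTop, a k + d ≤ b k) : limsup a atTop + d ≤ limsup b atTop := by
  refine le_of_forall_gt_imp_ge_of_dense fun e he => ?_
  have h1 := eventually_lt_of_limsup_lt he (bdd_le hb)
  have h2 : limsup a atTop ≤ e - d := by
    refine limsup_le_of_le (bdd_ge ha).isCoboundedUnder_flip ?_
    filter_upwards [h, h1] with k hk hk1
    linarith
  linarith

lemma limsup_le_of' {a : ℕ → ℝ} {M d : ℝ} (ha : ∀ k, |a k| ≤ M)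
    (h : ∀ᶠ k in atTop, a k ≤ d) : limsup a atTop ≤ d :=
  limsup_le_of_le (bdd_ge ha).isCoboundedUnder_flip h

lemma le_limsup_of' {a : ℕ → ℝ} {M d : ℝ} (ha : ∀ k, |a k| ≤ M)
    (h : ∀ᶠ k in atTop, d ≤ a k) : d ≤ limsup a atTop :=
  le_limsup_of_frequently_le h.frequently (bdd_le ha)

lemma exists_subseq {E : Type*} (D : ℕ → E) (U : ℕ → E → ℝ) (M : ℝ) (hM : ∀ k p, |U k p| ≤ M) :
    ∃ φ : ℕ → ℕ, StrictMono φ ∧ ∀ m, ∃ l, Tendsto (fun k => U (φ k) (D m)) atTop (nhds l) := by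
  have hK : IsCompact (Set.univ.pi fun _ : ℕ => Icc (-M) M) :=
    isCompact_univ_pi fun _ => isCompact_Icc
  obtain ⟨a, -, φ, hφ, h⟩ := hK.tendsto_subseq (x := fun k m => U k (D m))
    (fun k m _ => abs_le.1 (hM k (D m)))
  exact ⟨φ, hφ, fun m => ⟨a m, (tendsto_pi_nhds.1 h) m⟩⟩

/-- asymptotic cone monotonicity -/
def ConeSeq {n : ℕ} (U : ℕ → Spc n × ℝ → ℝ) (C S : ℝ) : Prop :=
  ∀ δ > 0, ∀ᶠ k in atTop, ∀ x y : Spc n, ∀ t t' : ℝ, ‖x‖ ≤ 2 → ‖y‖ ≤ 2 → 0 ≤ t → t' ≤ S →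
    t + C * ‖x - y‖ + δ ≤ t' → U k (y, t) ≤ U k (x, t')

lemma ae_tendsto {n : ℕ} (U : ℕ → Spc n × ℝ → ℝ) (M C S : ℝ) (hC : 0 ≤ C)
    (hM : ∀ k p, |U k p| ≤ M)
    (hmeas : ∀ k, Measurable (U k)) (hcone : ConeSeq U C S)
    (hD : ∀ m, ∃ l, Tendsto (fun k => U k (TopologicalSpace.denseSeq (Spc n × ℝ) m))
      atTop (nhds l)) :
    ∀ᵐ p ∂(volume : Measure (Spc n × ℝ)), p ∈ ball (0 : Spc n) 2 ×ˢ Ioo 0 S →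
      Tendsto (fun k => U k p) atTop (nhds (limsup (fun k => U k p) atTop)) := by
  set u : Spc n × ℝ → ℝ := fun p => limsup (fun k => U k p) atTop with hu
  set l : Spc n × ℝ → ℝ := fun p => liminf (fun k => U k p) atTop with hl
  have hum : Measurable u := Measurable.limsup hmeas
  have hlm : Measurable l := Measurable.liminf hmeas
  -- the key comparison
  have key : ∀ x : Spc n, ‖x‖ < 2 → ∀ s t : ℝ, 0 < s → s < t → t < S → u (x, s) ≤ l (x, t) := by
    intro x hx s t hs hst htS
    set δ := (t - s) / 8 with hδ
    have hδ0 : 0 < δ := by rw [hδ]; linarith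
    set ρ := min (2 - ‖x‖) (δ / (C + 1)) with hρ
    have hρ0 : 0 < ρ := lt_min (by linarith) (by positivity)
    have hO : IsOpen (ball x ρ ×ˢ Ioo (s + 3 * δ) (t - 3 * δ)) := isOpen_ball.prod isOpen_Ioo
    obtain ⟨m, hm⟩ := (TopologicalSpace.denseRange_denseSeq (Spc n × ℝ)).exists_mem_open hO
      ⟨(x, (s + t) / 2), by simpa using hρ0, by constructor <;> (rw [hδ]; linarith)⟩
    obtain ⟨a, ha⟩ := hD m
    set d := TopologicalSpace.denseSeq (Spc n × ℝ) m
    obtain ⟨hd1, hd2, hd3⟩ := hm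
    rw [mem_ball, dist_eq_norm] at hd1
    have h1 : ‖d.1‖ ≤ 2 := by
      have := norm_add_le (d.1 - x) x
      rw [sub_add_cancel] at this
      linarith [min_le_left (2 - ‖x‖) (δ / (C + 1))]
    have h2 : C * ‖d.1 - x‖ ≤ δ := by
      have h3 : ‖d.1 - x‖ ≤ δ / (C + 1) := hd1.le.trans (min_le_right _ _)
      rw [le_div_iff₀ (by linarith)] at h3
      linarith [norm_nonneg (d.1 - x)]
    have h2' : C * ‖x - d.1‖ ≤ δ := by rwa [norm_sub_rev]
    have hev := hcone δ hδ0
    have h3 : u (x, s) ≤ a := by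
      rw [← ha.limsup_eq]
      have := limsup_add_le_of (a := fun k => U k (x, s)) (b := fun k => U k d) (d := 0) (M := M)
        (fun k => hM k _) (fun k => hM k _) (by
          filter_upwards [hev] with k hk
          have := hk d.1 x s d.2 h1 hx.le hs.le (by linarith) (by linarith)
          simpa using this)
      simpa using this
    have h4 : a ≤ l (x, t) := by
      refine le_of_forall_lt_imp_le_of_dense fun e he => ?_
      refine le_liminf_of_le (bdd_le fun k => hM k _).isCoboundedUnder_flip ?_
      filter_upwards [hev, ha.eventually_const_lt he] with k hk hk2
      exact hk2.le.trans (hk x d.1 d.2 t hx.le h1 (by linarith) htS.le (by linarith))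
    exact h3.trans h4
  have hle : ∀ p, l p ≤ u p := fun p => liminf_le_limsup (bdd_le fun k => hM k _)
    (bdd_ge fun k => hM k _)
  set B : Set (Spc n × ℝ) := (ball (0 : Spc n) 2 ×ˢ Ioo 0 S) ∩ {p | l p = u p}ᶜ with hB
  have hBm : MeasurableSet B :=
    (measurableSet_ball.prod measurableSet_Ioo).inter (measurableSet_eq_fun hlm hum).compl
  have hB0 : (volume : Measure (Spc n × ℝ)) B = 0 := by
    rw [Measure.volume_eq_prod, Measure.measure_prod_null hBm]
    refine Eventually.of_forall fun x => ?_
    by_cases hx : ‖x‖ < 2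
    · have hmono : MonotoneOn (fun t => u (x, t)) (Ioo 0 S) := by
        intro s hs t ht hst
        rcases hst.eq_or_lt with rfl | h
        · exact le_rfl
        · exact (key x hx s t hs.1 h ht.2).trans (hle _)
      have hcount := hmono.countable_not_continuousWithinAt
      refine measure_mono_null ?_ (hcount.measure_zero volume)
      rintro t ⟨⟨-, ht⟩, hne⟩
      refine ⟨ht, fun hcont => hne ?_⟩
      refine le_antisymm (hle _) ?_
      have h1 : ContinuousAt (fun t => u (x, t)) t := hcont.continuousAt (isOpen_Ioo.mem_nhds ht)
      have h2 : Tendsto (fun s => u (x, s)) (nhdsWithin t (Iio t)) (nhds (u (x, t))) :=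
        h1.tendsto.mono_left nhdsWithin_le_nhds
      refine le_of_tendsto h2 ?_
      have h3 : Ioo 0 t ∈ nhdsWithin t (Iio t) := Ioo_mem_nhdsLT ht.1
      filter_upwards [h3] with s hs
      exact key x hx s t hs.1 hs.2 ht.2
    · have : Prod.mk x ⁻¹' B = ∅ := by
        ext t
        simp only [hB, mem_preimage, mem_inter_iff, mem_prod, mem_ball, dist_zero_right]
        simp [hx]
      simp [this]
  have hae : ∀ᵐ p ∂(volume : Measure (Spc n × ℝ)), p ∉ B := measure_eq_zero_iff_ae_notMem.1 hB0
  filter_upwards [hae] with p hp hp2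
  have h1 : l p = u p := by
    by_contra h
    exact hp ⟨hp2, h⟩
  exact tendsto_of_liminf_eq_limsup h1 rfl (bdd_le fun k => hM k _) (bdd_ge fun k => hM k _)

/-! ### The space-time interpolation of the scheme -/

/-- interpolated scheme, cut off outside a bounded region -/
def Ue {n : ℕ} (ψ : Spc n × ℝ → ℝ) (S ε : ℝ) (p : Spc n × ℝ) : ℝ :=
  if ‖p.1‖ ≤ 2 ∧ 0 ≤ p.2 ∧ p.2 ≤ S then sch ψ ε ⌊p.2 / tau n ε⌋₊ p.1 else 0

section
variable {n : ℕ} {ψ : Spc n × ℝ → ℝ} {c S L K ε c' : ℝ}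

lemma floor_facts {τ t : ℝ} (hτ : 0 < τ) (ht : 0 ≤ t) :
    (⌊t / τ⌋₊ : ℝ) * τ ≤ t ∧ t < (⌊t / τ⌋₊ : ℝ) * τ + τ := by
  have h1 := Nat.floor_le (div_nonneg ht hτ.le)
  have h2 := Nat.lt_floor_add_one (t / τ)
  rw [le_div_iff₀ hτ] at h1
  rw [div_lt_iff₀ hτ] at h2
  exact ⟨h1, by linarith⟩

lemma Ue_eq {x : Spc n} {t : ℝ} (hx : ‖x‖ ≤ 2) (ht : 0 ≤ t) (htS : t ≤ S) :
    Ue ψ S ε (x, t) = sch ψ ε ⌊t / tau n ε⌋₊ x := if_pos ⟨hx, ht, htS⟩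

lemma Ue_measurable (hψ : Continuous ψ) : Measurable (Ue ψ S ε) := by
  refine Measurable.ite ?_ ?_ measurable_const
  · exact (measurableSet_le measurable_fst.norm measurable_const).inter
      ((measurableSet_le measurable_const measurable_snd).inter
      (measurableSet_le measurable_snd measurable_const))
  · have h1 : Measurable (fun q : Spc n × ℕ => sch ψ ε q.2 q.1) :=
      measurable_from_prod_countable_left fun j => sch_measurable hψ ε j
    have h2 : Measurable (fun p : Spc n × ℝ => (p.1, ⌊p.2 / tau n ε⌋₊)) :=
      measurable_fst.prodMk (Nat.measurable_floor.comp (measurable_snd.div_const _))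
    exact h1.comp h2

lemma Ue_bdd (hn : 1 ≤ n) (hD : Dat ψ c S L K) (hS : 0 ≤ S) (hψ : Continuous ψ) :
    ∃ M, 0 ≤ M ∧ ∀ ε, 0 < ε → ε ≤ 1 → ∀ p, |Ue ψ S ε p| ≤ M := by
  obtain ⟨M, hM0, hM⟩ := compact_bd hψ 2 S
  have hL0 := hD.hL0
  have hK0 := hD.hK0
  refine ⟨M + (K + L + 1) * S, by positivity, fun ε hε hε1 p => ?_⟩
  have hτ := tau_pos hn hε
  unfold Ue
  split_ifs with h
  · obtain ⟨hx, ht, htS⟩ := h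
    obtain ⟨h1, h2⟩ := floor_facts hτ ht
    have h3 := sch_init hn hD hε hε1 _ (h1.trans htS) p.1 hx
    have h4 := hM p.1 0 hx ⟨le_rfl, hS⟩
    have h5 : (K + L + 1) * (⌊p.2 / tau n ε⌋₊ * tau n ε) ≤ (K + L + 1) * S :=
      mul_le_mul_of_nonneg_left (h1.trans htS) (by positivity)
    have h6 := abs_add_le (sch ψ ε ⌊p.2 / tau n ε⌋₊ p.1 - ψ (p.1, 0)) (ψ (p.1, 0))
    rw [sub_add_cancel] at h6
    linarith
  · rw [abs_zero]; positivity

lemma Ue_init (hn : 1 ≤ n) (hD : Dat ψ c S L K) (hε : 0 < ε) (hε1 : ε ≤ 1)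
    (x : Spc n) (hx : ‖x‖ ≤ 2) (t : ℝ) (ht : 0 ≤ t) (htS : t ≤ S) :
    |Ue ψ S ε (x, t) - ψ (x, 0)| ≤ (K + L + 1) * t := by
  have hL0 := hD.hL0
  have hK0 := hD.hK0
  rw [Ue_eq hx ht htS]
  obtain ⟨h1, h2⟩ := floor_facts (tau_pos hn hε) ht
  exact (sch_init hn hD hε hε1 _ (h1.trans htS) x hx).trans
    (mul_le_mul_of_nonneg_left h1 (by positivity))

lemma Ue_barrier (hn : 1 ≤ n) (hD : Dat ψ c S L K) (hε : 0 < ε) (hε1 : ε ≤ 1)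
    (x : Spc n) (hx : ‖x‖ ≤ 1) (t : ℝ) (ht : 0 ≤ t) (htS : t ≤ S) :
    |Ue ψ S ε (x, t) - ψ (x, t)| ≤
      (K + L + 1) / (2 * n) * ((1 + ε) ^ 2 - ‖x‖ ^ 2) + L * tau n ε := by
  have hL0 := hD.hL0
  have hτ := tau_pos hn hε
  rw [Ue_eq (by linarith) ht htS]
  obtain ⟨h1, h2⟩ := floor_facts hτ ht
  have h3 := sch_barrier hn hD hε hε1 _ (h1.trans htS) x (by linarith)
  have h4 := hD.lip x x (⌊t / tau n ε⌋₊ * tau n ε) t (by linarith) (by linarith)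
    ⟨by positivity, h1.trans htS⟩ ⟨ht, htS⟩
  have h5 : |(⌊t / tau n ε⌋₊ : ℝ) * tau n ε - t| ≤ tau n ε := by
    rw [abs_le]; constructor <;> linarith
  rw [sub_self, norm_zero, zero_add] at h4
  have h6 := h4.trans (mul_le_mul_of_nonneg_left h5 hL0)
  have h7 := abs_sub_le (sch ψ ε ⌊t / tau n ε⌋₊ x) (ψ (x, ⌊t / tau n ε⌋₊ * tau n ε)) (ψ (x, t))
  linarith

lemma floor_diff {τ t t' : ℝ} (hτ : 0 < τ) (ht : 0 ≤ t) (htt : t ≤ t') :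
    ∃ m : ℕ, ⌊t' / τ⌋₊ = ⌊t / τ⌋₊ + m ∧ t' - t - τ ≤ m * τ := by
  obtain ⟨h1, h2⟩ := floor_facts hτ ht
  obtain ⟨h3, h4⟩ := floor_facts hτ (ht.trans htt)
  have h5 : ⌊t / τ⌋₊ ≤ ⌊t' / τ⌋₊ := Nat.floor_le_floor (by gcongr)
  obtain ⟨m, hm⟩ := Nat.exists_eq_add_of_le h5
  refine ⟨m, hm, ?_⟩
  rw [hm] at h4
  push_cast at h4
  linarith

lemma Ue_rate (hn : 1 ≤ n) (hD : Dat ψ c S L K) (hε : 0 < ε) (hc' : c' ≤ c) (hc0 : 0 ≤ c')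
    (hinit : ∀ x : Spc n, ‖x‖ < 1 → c' * tau n ε ≤ Av ε (fun y => ψ (y, 0)) x - ψ (x, 0))
    (x : Spc n) (hx : ‖x‖ ≤ 2) (t t' : ℝ) (ht : 0 ≤ t) (htt : t ≤ t') (htS : t' ≤ S) :
    c' * (t' - t - tau n ε) ≤ Ue ψ S ε (x, t') - Ue ψ S ε (x, t) := by
  rw [Ue_eq hx ht (htt.trans htS), Ue_eq hx (ht.trans htt) htS]
  obtain ⟨m, hm, h⟩ := floor_diff (tau_pos hn hε) ht htt
  rw [hm]
  exact (mul_le_mul_of_nonneg_left h hc0).trans (sch_rate_m hn hD hε hc' hc0 hinit _ m x)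

lemma Ue_cone (hn : 1 ≤ n) (hD : Dat ψ c S L K) (hε : 0 < ε) (hε1 : ε ≤ 1)
    (hinit : ∀ x : Spc n, ‖x‖ < 1 → c / 2 * tau n ε ≤ Av ε (fun y => ψ (y, 0)) x - ψ (x, 0))
    (x y : Spc n) (hx : ‖x‖ ≤ 2) (hy : ‖y‖ ≤ 2) (t t' : ℝ) (ht : 0 ≤ t) (htS : t' ≤ S)
    (h : t + (2 * (L + 3 * ((K + L + 1) / (2 * n))) / c * (‖x - y‖ + ε) + tau n ε) ≤ t') :
    Ue ψ S ε (y, t) ≤ Ue ψ S ε (x, t') := by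
  have hL0 := hD.hL0
  have hK0 := hD.hK0
  have hc := hD.hc
  have hτ := tau_pos hn hε
  have h0 : 0 ≤ 2 * (L + 3 * ((K + L + 1) / (2 * n))) / c * (‖x - y‖ + ε) := by positivity
  have htt : t ≤ t' := by linarith
  rw [Ue_eq hy ht (htt.trans htS), Ue_eq hx (ht.trans htt) htS]
  obtain ⟨m, hm, h1⟩ := floor_diff hτ ht htt
  obtain ⟨h3, h4⟩ := floor_facts hτ (ht.trans htt)
  rw [hm] at h3 ⊢
  exact sch_cone hn hD hε hε1 hinit _ m (h3.trans htS) x y hx hy (by linarith)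

/-- the discrete equation -/
lemma Ue_step (hn : 1 ≤ n) (hε : 0 < ε) (hε1 : ε ≤ 1) (x : Spc n) (hx : ‖x‖ < 1)
    (t : ℝ) (ht : 0 ≤ t) (htS : t + tau n ε ≤ S) :
    Ue ψ S ε (x, t + tau n ε) = Av ε (fun y => Ue ψ S ε (y, t)) x
      + tau n ε * hv (Ue ψ S ε (x, t)) := by
  have hτ := tau_pos hn hε
  rw [Ue_eq (by linarith) (by linarith) htS, Ue_eq (by linarith) ht (by linarith)]
  have h1 : (t + tau n ε) / tau n ε = t / tau n ε + 1 := by field_simp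
  rw [h1, Nat.floor_add_one (by positivity), sch_inside _ _ _ hx]
  congr 1
  unfold Av
  congr 1
  refine Finset.sum_congr rfl fun i _ => ?_
  have h2 := norm_stencil hε.le i
  have h3 := norm_add_le x (ε • ev i)
  have h4 := norm_sub_le x (ε • ev i)
  beta_reduce
  rw [Ue_eq (by linarith) ht (by linarith), Ue_eq (by linarith) ht (by linarith)]

end

/-! ### The weak equation in the limit -/

instance instHaarE (n : ℕ) : (volume : Measure (Spc n × ℝ)).IsAddHaarMeasure :=
  inferInstanceAs ((volume : Measure (Spc n)).prod (volume : Measure ℝ)).IsAddHaarMeasure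

lemma int_mul {n : ℕ} {U φ : Spc n × ℝ → ℝ} (hU : Integrable U) (hφ : Continuous φ)
    (hc : HasCompactSupport φ) : Integrable (fun p => U p * φ p) := by
  obtain ⟨B, hB⟩ := hc.exists_bound_of_continuous hφ
  exact hU.mul_bdd (c := B) hφ.aestronglyMeasurable (Eventually.of_forall hB)

lemma int_shift {n : ℕ} (U φ : Spc n × ℝ → ℝ) (v : Spc n × ℝ) :
    ∫ p, U (p + v) * φ p = ∫ p, U p * φ (p - v) := by
  have := integral_sub_right_eq_self (μ := (volume : Measure (Spc n × ℝ)))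
    (fun p => U (p + v) * φ p) v
  rw [← this]
  simp

/-- the discrete adjoint operator -/
def Dk {n : ℕ} (φ : Spc n × ℝ → ℝ) (ε : ℝ) (p : Spc n × ℝ) : ℝ :=
  (φ (p - tau n ε • eT) - Av ε (fun y => φ (y, p.2)) p.1) / tau n ε

lemma Dk_eq {n : ℕ} (hn : 1 ≤ n) {φ : Spc n × ℝ → ℝ} (hφ : Smooth φ) {ε : ℝ} (hε : 0 < ε)
    (p : Spc n × ℝ) : ∃ (s : ℝ) (ξ : Fin n → ℝ), |s| ≤ tau n ε ∧ (∀ i, |ξ i| ≤ ε) ∧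
      Dk φ ε p = - dd eT φ (p - s • eT) - ∑ i, dd (eX i) (dd (eX i) φ) (p + ξ i • eX i) := by
  have hτ := tau_pos hn hε
  obtain ⟨ξ, hξ, h1⟩ := Av_smooth hn hφ hε p.1 p.2
  obtain ⟨s, hs, h2⟩ := first_diff hφ.differentiable p (-eT) hτ
  refine ⟨s, ξ, hs, hξ, ?_⟩
  unfold Dk
  simp only [Prod.mk.eta] at h1
  rw [smul_neg, ← sub_eq_add_neg, smul_neg, ← sub_eq_add_neg] at h2
  have h3 : dd (-eT) φ (p - s • eT) = - dd eT φ (p - s • eT) := by simp [dd]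
  rw [h3] at h2
  rw [div_eq_iff hτ.ne']
  linarith

lemma Dk_bound {n : ℕ} (hn : 1 ≤ n) {φ : Spc n × ℝ → ℝ} (hφ : Smooth φ)
    (hc : HasCompactSupport φ) : ∃ B, 0 ≤ B ∧ ∀ ε, 0 < ε → ∀ p, |Dk φ ε p| ≤ B := by
  obtain ⟨B, hB⟩ := (hc.dd eT).exists_bound_of_continuous (hφ.dd eT).continuous
  choose B' hB' using fun i : Fin n => ((hc.dd (eX i)).dd (eX i)).exists_bound_of_continuous
    ((hφ.dd (eX i)).dd (eX i)).continuous
  have h0 : 0 ≤ B := (norm_nonneg _).trans (hB 0)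
  have h0' : ∀ i, 0 ≤ B' i := fun i => (norm_nonneg _).trans (hB' i 0)
  refine ⟨B + ∑ i, B' i, add_nonneg h0 (Finset.sum_nonneg fun i _ => h0' i), fun ε hε p => ?_⟩
  obtain ⟨s, ξ, -, -, h⟩ := Dk_eq hn hφ hε p
  rw [h]
  refine (abs_sub _ _).trans (add_le_add ?_ ?_)
  · rw [abs_neg]; exact hB _
  · exact (Finset.abs_sum_le_sum_abs _ _).trans (Finset.sum_le_sum fun i _ => hB' i _)

lemma tau_tendsto {n : ℕ} {e : ℕ → ℝ} (he : Tendsto e atTop (nhds 0)) :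
    Tendsto (fun k => tau n (e k)) atTop (nhds 0) := by
  have : Continuous (tau n) := by unfold tau; fun_prop
  have h := (this.tendsto 0).comp he
  simpa [tau, Function.comp_def] using h

lemma Dk_tendsto {n : ℕ} (hn : 1 ≤ n) {φ : Spc n × ℝ → ℝ} (hφ : Smooth φ) {e : ℕ → ℝ}
    (he0 : ∀ k, 0 < e k) (he : Tendsto e atTop (nhds 0)) (p : Spc n × ℝ) :
    Tendsto (fun k => Dk φ (e k) p) atTop (nhds (Ladj φ p)) := by
  choose s ξ hs hξ h using fun k => Dk_eq hn hφ (he0 k) p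
  have hs0 : Tendsto s atTop (nhds 0) :=
    squeeze_zero_norm hs (tau_tendsto he)
  have hξ0 : ∀ i, Tendsto (fun k => ξ k i) atTop (nhds 0) := fun i =>
    squeeze_zero_norm (fun k => hξ k i) he
  simp only [h]
  unfold Ladj
  have hl : ∀ (a : ℕ → ℝ) (v : Spc n × ℝ), Tendsto a atTop (nhds 0) →
      Tendsto (fun k => p + a k • v) atTop (nhds p) := fun a v ha => by
    simpa using (ha.smul_const v).const_add p
  refine Tendsto.sub (Tendsto.neg ?_) (tendsto_finsetSum _ fun i _ => ?_)
  · have h1 := hl s (-eT) hs0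
    simp only [smul_neg, ← sub_eq_add_neg] at h1
    exact ((hφ.dd eT).continuous.tendsto p).comp h1
  · exact (((hφ.dd (eX i)).dd (eX i)).continuous.tendsto p).comp (hl _ _ (hξ0 i))

lemma Ue_zero {n : ℕ} {ψ : Spc n × ℝ → ℝ} {S ε : ℝ} {p : Spc n × ℝ}
    (hp : p ∉ closedBall (0 : Spc n) 2 ×ˢ Icc 0 S) : Ue ψ S ε p = 0 := by
  refine if_neg fun h => hp ⟨by simpa using h.1, h.2⟩

lemma region_integrable (n : ℕ) (S M : ℝ) :
    Integrable ((closedBall (0 : Spc n) 2 ×ˢ Icc 0 S).indicator (fun _ => M))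
      (volume : Measure (Spc n × ℝ)) := by
  have hK : IsCompact (closedBall (0 : Spc n) 2 ×ˢ Icc (0 : ℝ) S) :=
    (isCompact_closedBall _ _).prod isCompact_Icc
  rw [integrable_indicator_iff hK.measurableSet]
  exact integrableOn_const hK.measure_lt_top.ne

lemma Ue_le_ind {n : ℕ} {ψ : Spc n × ℝ → ℝ} {S ε M : ℝ} (hM : ∀ p, |Ue ψ S ε p| ≤ M)
    (p : Spc n × ℝ) :
    |Ue ψ S ε p| ≤ (closedBall (0 : Spc n) 2 ×ˢ Icc 0 S).indicator (fun _ => M) p := by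
  by_cases hp : p ∈ closedBall (0 : Spc n) 2 ×ˢ Icc 0 S
  · rw [indicator_of_mem hp]; exact hM p
  · rw [indicator_of_notMem hp, Ue_zero hp, abs_zero]

lemma Ue_integrable {n : ℕ} {ψ : Spc n × ℝ → ℝ} {S ε M : ℝ} (hψ : Continuous ψ)
    (hM : ∀ p, |Ue ψ S ε p| ≤ M) : Integrable (Ue ψ S ε) :=
  (region_integrable n S M).mono' (Ue_measurable hψ).aestronglyMeasurable
    (Eventually.of_forall fun p => Ue_le_ind hM p)

lemma shift_prod {n : ℕ} (p : Spc n × ℝ) (i : Fin n) (ε : ℝ) :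
    (p.1 + ε • ev i, p.2) = p + ε • eX i ∧ (p.1 - ε • ev i, p.2) = p - ε • eX i := by
  constructor <;> simp [eX, Prod.ext_iff]

lemma weak_discrete {n : ℕ} (hn : 1 ≤ n) {ψ φ : Spc n × ℝ → ℝ} {S S' ε M : ℝ}
    (hψ : Continuous ψ) (hM : ∀ p, |Ue ψ S ε p| ≤ M) (hε : 0 < ε) (hε1 : ε ≤ 1)
    (hφ : Smooth φ) (hc : HasCompactSupport φ)
    (hsupp : tsupport φ ⊆ ball (0 : Spc n) 1 ×ˢ Ioo 0 S') (hS : S' + tau n ε ≤ S) :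
    ∫ p, Ue ψ S ε p * Dk φ ε p = ∫ p, hv (Ue ψ S ε p) * φ p := by
  have hτ := tau_pos hn hε
  have hU := Ue_integrable hψ hM
  set U := Ue ψ S ε with hUdef
  have hcont := hφ.continuous
  have hpt : ∀ p, U (p + tau n ε • eT) * φ p - Av ε (fun y => U (y, p.2)) p.1 * φ p
      = tau n ε * (hv (U p) * φ p) := by
    intro p
    by_cases hp : φ p = 0
    · simp [hp]
    · have hp' := hsupp (subset_tsupport _ hp)
      obtain ⟨h1, h2, h3⟩ := hp'
      have := Ue_step (ψ := ψ) (S := S) hn hε hε1 p.1 (by simpa using h1) p.2 h2.le (by linarith)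
      have h4 : p + tau n ε • eT = (p.1, p.2 + tau n ε) := by simp [eT, Prod.ext_iff]
      rw [h4, hUdef, this]
      ring
  have hUs : ∀ v, Integrable (fun p => U (p + v) * φ p) := fun v =>
    int_mul (hU.comp_add_right v) hcont hc
  have hUs' : ∀ v, Integrable (fun p => U (p - v) * φ p) := fun v =>
    int_mul (hU.comp_sub_right v) hcont hc
  have hφs : ∀ v, Integrable (fun p => U p * φ (p - v)) := fun v =>
    int_mul (φ := fun p => φ (p - v)) hU (by fun_prop)
      (hc.comp_homeomorph (Homeomorph.subRight v))
  have hφs' : ∀ v, Integrable (fun p => U p * φ (p + v)) := fun v => by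
    simpa using hφs (-v)
  have hshift' : ∀ v, ∫ p, U (p - v) * φ p = ∫ p, U p * φ (p + v) := fun v => by
    simpa [← sub_eq_add_neg] using int_shift U φ (-v)
  have hA1 : ∀ p, Av ε (fun y => U (y, p.2)) p.1 * φ p = (2 * (n : ℝ))⁻¹ *
      ∑ i, (U (p + ε • eX i) * φ p + U (p - ε • eX i) * φ p) := fun p => by
    unfold Av
    simp only [(shift_prod p _ ε).1, (shift_prod p _ ε).2]
    rw [mul_assoc, Finset.sum_mul]
    congr 1
    exact Finset.sum_congr rfl fun i _ => by ring
  have hA2 : ∀ p, U p * Av ε (fun y => φ (y, p.2)) p.1 = (2 * (n : ℝ))⁻¹ *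
      ∑ i, (U p * φ (p - ε • eX i) + U p * φ (p + ε • eX i)) := fun p => by
    unfold Av
    simp only [(shift_prod p _ ε).1, (shift_prod p _ ε).2]
    rw [mul_left_comm, Finset.mul_sum]
    congr 1
    exact Finset.sum_congr rfl fun i _ => by ring
  have hI1 : Integrable (fun p => Av ε (fun y => U (y, p.2)) p.1 * φ p) := by
    simp only [hA1]
    exact (integrable_finsetSum _ fun i _ => (hUs _).add (hUs' _)).const_mul _
  have hI2 : Integrable (fun p => U p * Av ε (fun y => φ (y, p.2)) p.1) := by
    simp only [hA2]
    exact (integrable_finsetSum _ fun i _ => (hφs _).add (hφs' _)).const_mul _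
  have hAv : ∫ p, Av ε (fun y => U (y, p.2)) p.1 * φ p
      = ∫ p, U p * Av ε (fun y => φ (y, p.2)) p.1 := by
    simp only [hA1, hA2]
    rw [integral_const_mul, integral_const_mul, integral_finsetSum, integral_finsetSum]
    · congr 1
      refine Finset.sum_congr rfl fun i _ => ?_
      rw [integral_add (hUs _) (hUs' _), integral_add (hφs _) (hφs' _), int_shift, hshift']
    · exact fun i _ => (hφs _).add (hφs' _)
    · exact fun i _ => (hUs _).add (hUs' _)
  have h1 : ∫ p, tau n ε * (hv (U p) * φ p) = ∫ p, U p * (φ (p - tau n ε • eT)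
      - Av ε (fun y => φ (y, p.2)) p.1) := by
    simp only [← hpt, mul_sub]
    rw [integral_sub (hUs _) hI1, integral_sub (hφs _) hI2, hAv, int_shift]
  rw [integral_const_mul] at h1
  have h2 : ∫ p, U p * Dk φ ε p = (∫ p, U p * (φ (p - tau n ε • eT)
      - Av ε (fun y => φ (y, p.2)) p.1)) / tau n ε := by
    rw [← integral_div]
    refine integral_congr_ae (Eventually.of_forall fun p => ?_)
    simp only [Dk]
    ring
  rw [h2, ← h1]
  field_simp

/-- weak formulation of the equation `∂ₜ u - Δ u = g` in `Ω` -/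
def WeakEq {n : ℕ} (u g : Spc n × ℝ → ℝ) (Ω : Set (Spc n × ℝ)) : Prop :=
  ∀ φ : Spc n × ℝ → ℝ, Smooth φ → HasCompactSupport φ → tsupport φ ⊆ Ω →
    ∫ p, u p * Ladj φ p = ∫ p, g p * φ p

lemma weak_limit {n : ℕ} (hn : 1 ≤ n) {ψ u : Spc n × ℝ → ℝ} {S S' M : ℝ} {e : ℕ → ℝ}
    (hψ : Continuous ψ) (hM : ∀ k p, |Ue ψ S (e k) p| ≤ M) (hM0 : 0 ≤ M)
    (he0 : ∀ k, 0 < e k) (he1 : ∀ k, e k ≤ 1) (he : Tendsto e atTop (nhds 0))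
    (hS : S' < S)
    (hconv : ∀ᵐ p ∂(volume : Measure (Spc n × ℝ)), p ∈ ball (0 : Spc n) 2 ×ˢ Ioo 0 S →
      Tendsto (fun k => Ue ψ S (e k) p) atTop (nhds (u p)))
    (hne : ∀ᵐ p ∂(volume : Measure (Spc n × ℝ)), p ∈ ball (0 : Spc n) 2 ×ˢ Ioo 0 S →
      u p ≠ 0) :
    WeakEq u (fun p => hv (u p)) (ball (0 : Spc n) 1 ×ˢ Ioo 0 S') := by
  intro φ hφ hc hsupp
  have hsub : ball (0 : Spc n) 1 ×ˢ Ioo 0 S' ⊆ ball (0 : Spc n) 2 ×ˢ Ioo 0 S :=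
    prod_mono (ball_subset_ball (by norm_num)) (Ioo_subset_Ioo_right hS.le)
  obtain ⟨B, hB0, hB⟩ := Dk_bound hn hφ hc
  have h1 : Tendsto (fun k => ∫ p, Ue ψ S (e k) p * Dk φ (e k) p) atTop
      (nhds (∫ p, u p * Ladj φ p)) := by
    refine tendsto_integral_of_dominated_convergence
      (fun p => (closedBall (0 : Spc n) 2 ×ˢ Icc 0 S).indicator (fun _ => M) p * B)
      (fun k => ?_) ((region_integrable n S M).mul_const B) (fun k => ?_) ?_
    · refine ((Ue_measurable hψ).mul ?_).aestronglyMeasurable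
      have h2 := hφ.continuous
      have h3 : Continuous (Dk φ (e k)) := by
        unfold Dk Av
        fun_prop
      exact h3.measurable
    · refine Eventually.of_forall fun p => ?_
      rw [norm_mul]
      exact mul_le_mul (Ue_le_ind (hM k) p) (hB _ (he0 k) p) (norm_nonneg _)
        (indicator_nonneg (fun _ _ => hM0) p)
    · filter_upwards [hconv] with p hp
      have hD := Dk_tendsto hn hφ he0 he p
      by_cases hpΩ : p ∈ ball (0 : Spc n) 2 ×ˢ Ioo 0 S
      · exact (hp hpΩ).mul hD
      · have hp1 : p ∉ tsupport φ := fun h => hpΩ (hsub (hsupp h))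
        have h0 : Ladj φ p = 0 := by
          unfold Ladj
          have h2 : ∀ v, dd v φ p = 0 := fun v =>
            image_eq_zero_of_notMem_tsupport fun h => hp1 (tsupport_dd φ v h)
          have h3 : ∀ i : Fin n, dd (eX i) (dd (eX i) φ) p = 0 := fun i =>
            image_eq_zero_of_notMem_tsupport fun h =>
              hp1 (tsupport_dd φ _ (tsupport_dd (dd (eX i) φ) _ h))
          simp [h2, h3]
        rw [h0] at hD ⊢
        rw [mul_zero]
        refine squeeze_zero_norm (a := fun k => M * |Dk φ (e k) p|) (fun k => ?_) ?_
        · rw [norm_mul]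
          exact mul_le_mul_of_nonneg_right (hM k p) (norm_nonneg _)
        · simpa using hD.abs.const_mul M
  have h2 : Tendsto (fun k => ∫ p, hv (Ue ψ S (e k) p) * φ p) atTop
      (nhds (∫ p, hv (u p) * φ p)) := by
    refine tendsto_integral_of_dominated_convergence (fun p => ‖φ p‖)
      (fun k => ?_) (hφ.continuous.integrable_of_hasCompactSupport hc).norm (fun k => ?_) ?_
    · exact ((hv_measurable.comp (Ue_measurable hψ)).mul
        hφ.continuous.measurable).aestronglyMeasurable
    · refine Eventually.of_forall fun p => ?_
      rw [norm_mul]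
      refine mul_le_of_le_one_left (norm_nonneg _) ?_
      rw [Real.norm_eq_abs, abs_of_nonneg (hv_nonneg _)]
      exact hv_le_one _
    · filter_upwards [hconv, hne] with p hp hp0
      by_cases hpφ : φ p = 0
      · simp [hpφ]
      have hpΩ := hsub (hsupp (subset_tsupport _ hpφ))
      refine Tendsto.mul_const _ ?_
      refine (tendsto_congr' ?_).2 tendsto_const_nhds
      rcases lt_or_gt_of_ne (hp0 hpΩ) with h | h
      · filter_upwards [(hp hpΩ).eventually_lt_const h] with k hk
        rw [hv, hv, if_neg hk.not_gt, if_neg h.not_gt]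
      · filter_upwards [(hp hpΩ).eventually_const_lt h] with k hk
        rw [hv, hv, if_pos hk, if_pos h]
  refine tendsto_nhds_unique h1 (h2.congr' ?_)
  have h3 : ∀ᶠ k in atTop, tau n (e k) < S - S' :=
    (tau_tendsto he).eventually_lt_const (by linarith)
  filter_upwards [h3] with k hk
  exact (weak_discrete hn hψ (hM k) (he0 k) (he1 k) hφ hc hsupp (by linarith)).symm

/-- the properties of the limit -/
structure Sol {n : ℕ} (ψ : Spc n × ℝ → ℝ) (c S M C C₁ C₂ : ℝ) (u : Spc n × ℝ → ℝ) : Prop where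
  hC0 : 0 ≤ C
  hC1 : 0 ≤ C₁
  meas : Measurable u
  bdd : ∀ p, |u p| ≤ M
  barrier : ∀ x t, ‖x‖ ≤ 1 → 0 ≤ t → t ≤ S → |u (x, t) - ψ (x, t)| ≤ C * (1 - ‖x‖ ^ 2)
  init : ∀ x t, ‖x‖ ≤ 1 → 0 ≤ t → t ≤ S → |u (x, t) - ψ (x, 0)| ≤ C₂ * t
  rate : ∀ x t s, ‖x‖ ≤ 2 → 0 ≤ t → t ≤ s → s ≤ S → c * (s - t) ≤ u (x, s) - u (x, t)
  cone : ∀ x y t s, ‖x‖ ≤ 1 → ‖y‖ ≤ 1 → 0 ≤ t → s ≤ S → t + C₁ * ‖x - y‖ < s →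
    u (y, t) ≤ u (x, s)
  weak : ∀ S' < S, WeakEq u (fun p => hv (u p)) (ball (0 : Spc n) 1 ×ˢ Ioo 0 S')

lemma exists_sol {n : ℕ} (hn : 1 ≤ n) {c S : ℝ} (hc : 0 < c) (hS : 0 < S)
    {ψ : Spc n × ℝ → ℝ} (hψ : Smooth ψ)
    (hψt : ∀ p : Spc n × ℝ, c ≤ timeDeriv ψ p)
    (hψlap : ∀ x ∈ closedBall (0 : Spc n) 1, c ≤ lapl ψ (x, 0)) :
    ∃ M C C₁ C₂ u, Sol ψ c S M C C₁ C₂ u := by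
  obtain ⟨L, K, hD⟩ := exists_dat (S := S) hn hc hψ hψt
  have hL0 := hD.hL0
  have hK0 := hD.hK0
  have hn' : (0 : ℝ) < n := by exact_mod_cast hn
  have hψc := hψ.continuous
  obtain ⟨M, hM0, hM⟩ := Ue_bdd hn hD hS.le hψc
  set C := (K + L + 1) / (2 * n) with hC
  set C₁ := 2 * (L + 3 * C) / c with hC₁
  have hC0 : 0 ≤ C := by positivity
  have hC10 : 0 ≤ C₁ := by positivity
  set e₀ : ℕ → ℝ := fun k => 1 / ((k : ℝ) + 1) with he₀
  have he₀0 : ∀ k, 0 < e₀ k := fun k => by positivity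
  have he₀1 : ∀ k, e₀ k ≤ 1 := fun k => by
    rw [he₀]; simp only; rw [div_le_one (by positivity)]
    linarith [Nat.cast_nonneg (α := ℝ) k]
  have he₀t : Tendsto e₀ atTop (nhds 0) := tendsto_one_div_add_atTop_nhds_zero_nat
  obtain ⟨f, hf, hconvD⟩ := exists_subseq (TopologicalSpace.denseSeq (Spc n × ℝ))
    (fun k => Ue ψ S (e₀ k)) M (fun k p => hM _ (he₀0 k) (he₀1 k) p)
  set e : ℕ → ℝ := fun k => e₀ (f k) with he
  have he0 : ∀ k, 0 < e k := fun k => he₀0 _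
  have he1 : ∀ k, e k ≤ 1 := fun k => he₀1 _
  have het : Tendsto e atTop (nhds 0) := he₀t.comp hf.tendsto_atTop
  have hUM : ∀ k p, |Ue ψ S (e k) p| ≤ M := fun k p => hM _ (he0 k) (he1 k) p
  have hτt := tau_tendsto (n := n) het
  have hcone : ConeSeq (fun k => Ue ψ S (e k)) C₁ S := by
    intro δ hδ
    obtain ⟨ε₀, hε₀, hin⟩ := init_ok hn hψ hψlap (δ := c / 2) (by positivity)
    have h1 : Tendsto (fun k => C₁ * e k + tau n (e k)) atTop (nhds 0) := by
      simpa using (het.const_mul C₁).add hτt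
    filter_upwards [het.eventually_lt_const hε₀, h1.eventually_lt_const hδ] with k hk1 hk2
    intro x y t t' hx hy ht ht' htt
    refine Ue_cone hn hD (he0 k) (he1 k) (fun x hx => ?_) x y hx hy t t' ht ht' ?_
    · have := hin (e k) (he0 k) hk1.le x hx
      rwa [sub_half] at this
    · rw [← hC, ← hC₁, mul_add]; linarith
  have hmeas : ∀ k, Measurable (Ue ψ S (e k)) := fun k => Ue_measurable hψc
  set u : Spc n × ℝ → ℝ := fun p => limsup (fun k => Ue ψ S (e k) p) atTop with hu
  have hum : Measurable u := Measurable.limsup hmeas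
  have hconv := ae_tendsto (fun k => Ue ψ S (e k)) M C₁ S hC10 hUM hmeas hcone hconvD
  have hrate : ∀ x t s, ‖x‖ ≤ 2 → 0 ≤ t → t ≤ s → s ≤ S →
      c * (s - t) ≤ u (x, s) - u (x, t) := by
    intro x t s hx ht hts hs
    refine le_of_forall_pos_sub_le fun δ hδ => ?_
    obtain ⟨η, hη0, hηc, hη⟩ : ∃ η > 0, η ≤ c ∧ η * (s - t) ≤ δ / 2 := by
      refine ⟨min c (δ / (2 * (s - t + 1))), lt_min hc (by
        have : 0 < s - t + 1 := by linarith
        positivity), min_le_left _ _, ?_⟩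
      have h1 : 0 < s - t + 1 := by linarith
      calc _ ≤ δ / (2 * (s - t + 1)) * (s - t + 1) :=
            mul_le_mul (min_le_right _ _) (by linarith) (by linarith) (by positivity)
        _ = δ / 2 := by field_simp
    obtain ⟨ε₀, hε₀, hin⟩ := init_ok hn hψ hψlap hη0
    have h1 : Tendsto (fun k => c * tau n (e k)) atTop (nhds 0) := by
      simpa using hτt.const_mul c
    have := limsup_add_le_of (a := fun k => Ue ψ S (e k) (x, t))
      (b := fun k => Ue ψ S (e k) (x, s)) (d := c * (s - t) - δ) (fun k => hUM k _)
      (fun k => hUM k _) (by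
        filter_upwards [het.eventually_lt_const hε₀, h1.eventually_lt_const (half_pos hδ)]
          with k hk1 hk2
        have h2 := Ue_rate (S := S) (c' := c - η) hn hD (he0 k) (by linarith) (by linarith)
          (hin (e k) (he0 k) hk1.le) x hx t s ht hts hs
        have h3 : 0 ≤ η * tau n (e k) := mul_nonneg hη0.le (tau_pos hn (he0 k)).le
        nlinarith)
    simp only [hu]
    linarith
  have hne : ∀ᵐ p ∂(volume : Measure (Spc n × ℝ)), p ∈ ball (0 : Spc n) 2 ×ˢ Ioo 0 S →
      u p ≠ 0 := by
    set Z : Set (Spc n × ℝ) := (ball (0 : Spc n) 2 ×ˢ Ioo 0 S) ∩ {p | u p = 0} with hZ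
    have hZm : MeasurableSet Z :=
      (measurableSet_ball.prod measurableSet_Ioo).inter (measurableSet_eq_fun hum measurable_const)
    have hZ0 : (volume : Measure (Spc n × ℝ)) Z = 0 := by
      rw [Measure.volume_eq_prod, Measure.measure_prod_null hZm]
      refine Eventually.of_forall fun x => ?_
      have hss : (Prod.mk x ⁻¹' Z).Subsingleton := by
        rintro t ⟨⟨hx, ht⟩, h0⟩ s ⟨⟨-, hs⟩, h0'⟩
        have hx' : ‖x‖ ≤ 2 := by
          have := mem_ball_zero_iff.1 hx
          exact this.le
        simp only [mem_setOf_eq] at h0 h0'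
        by_contra hne
        rcases lt_or_gt_of_ne hne with h | h
        · have := hrate x t s hx' ht.1.le h.le hs.2.le
          rw [h0, h0'] at this
          nlinarith
        · have := hrate x s t hx' hs.1.le h.le ht.2.le
          rw [h0, h0'] at this
          nlinarith
      exact hss.countable.measure_zero _
    have hae : ∀ᵐ p ∂(volume : Measure (Spc n × ℝ)), p ∉ Z := measure_eq_zero_iff_ae_notMem.1 hZ0
    filter_upwards [hae] with p hp hp2 h0
    exact hp ⟨hp2, h0⟩
  refine ⟨M, C, C₁, K + L + 1, u, hC0, hC10, hum, ?_, ?_, ?_, hrate, ?_, ?_⟩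
  · intro p
    exact abs_le.2 ⟨le_limsup_of' (fun k => hUM k p) (Eventually.of_forall fun k =>
      (abs_le.1 (hUM k p)).1), limsup_le_of' (fun k => hUM k p) (Eventually.of_forall fun k =>
      (abs_le.1 (hUM k p)).2)⟩
  · intro x t hx ht hts
    refine le_of_forall_pos_le_add fun δ hδ => ?_
    have h1 : Tendsto (fun k => C * ((1 + e k) ^ 2 - ‖x‖ ^ 2) + L * tau n (e k)) atTop
        (nhds (C * (1 - ‖x‖ ^ 2))) := by
      have h2 := (((het.const_add 1).pow 2).sub_const (‖x‖ ^ 2)).const_mul C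
      have h3 := h2.add (hτt.const_mul L)
      simpa using h3
    have h4 : ∀ᶠ k in atTop, |Ue ψ S (e k) (x, t) - ψ (x, t)| ≤ C * (1 - ‖x‖ ^ 2) + δ := by
      filter_upwards [h1.eventually_lt_const (lt_add_of_pos_right _ hδ)] with k hk
      exact (Ue_barrier hn hD (he0 k) (he1 k) x hx t ht hts).trans hk.le
    rw [abs_le]
    constructor
    · have := le_limsup_of' (d := ψ (x, t) - (C * (1 - ‖x‖ ^ 2) + δ))
        (fun k => hUM k (x, t)) (h4.mono fun k hk => by linarith [(abs_le.1 hk).1])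
      simp only [hu]
      linarith
    · have := limsup_le_of' (d := ψ (x, t) + (C * (1 - ‖x‖ ^ 2) + δ))
        (fun k => hUM k (x, t)) (h4.mono fun k hk => by linarith [(abs_le.1 hk).2])
      simp only [hu]
      linarith
  · intro x t hx ht hts
    have h4 : ∀ k, |Ue ψ S (e k) (x, t) - ψ (x, 0)| ≤ (K + L + 1) * t := fun k =>
      Ue_init hn hD (he0 k) (he1 k) x (by linarith) t ht hts
    rw [abs_le]
    constructor
    · have := le_limsup_of' (d := ψ (x, 0) - (K + L + 1) * t)
        (fun k => hUM k (x, t)) (Eventually.of_forall fun k => by linarith [(abs_le.1 (h4 k)).1])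
      simp only [hu]
      linarith
    · have := limsup_le_of' (d := ψ (x, 0) + (K + L + 1) * t)
        (fun k => hUM k (x, t)) (Eventually.of_forall fun k => by linarith [(abs_le.1 (h4 k)).2])
      simp only [hu]
      linarith
  · intro x y t s hx hy ht hs hts
    have := limsup_add_le_of (a := fun k => Ue ψ S (e k) (y, t))
      (b := fun k => Ue ψ S (e k) (x, s)) (d := 0) (fun k => hUM k _)
      (fun k => hUM k _) (by
        filter_upwards [hcone (s - (t + C₁ * ‖x - y‖)) (by linarith)] with k hk
        have := hk x y t s (by linarith) (by linarith) ht hs (by linarith)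
        simpa using this)
    simpa using this
  · intro S' hS'
    exact weak_limit hn hψc hUM hM0 he0 he1 het hS' hconv hne

/-! ### The heat kernel -/

/-- auxiliary profile -/
def Fk (a s : ℝ) : ℝ := if 0 < s then s ^ a * Real.exp (-(1 / (4 * s))) else 0

lemma Fk_tendsto (a : ℝ) : Tendsto (Fk a) (nhds 0) (nhds 0) := by
  have h1 : Tendsto (fun x : ℝ => x ^ (-a) * Real.exp (-(1 / 4) * x)) atTop (nhds 0) :=
    tendsto_rpow_mul_exp_neg_mul_atTop_nhds_zero _ _ (by norm_num)
  have h2 := h1.comp tendsto_inv_nhdsGT_zero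
  have h3 : Tendsto (Fk a) (nhdsWithin 0 (Ioi 0)) (nhds 0) := by
    refine h2.congr' ?_
    filter_upwards [self_mem_nhdsWithin] with s hs
    have hs' : 0 < s := hs
    simp only [Function.comp, Fk, if_pos hs']
    rw [Real.inv_rpow hs'.le, Real.rpow_neg hs'.le, inv_inv]
    congr 2
    field_simp
  have h4 : Tendsto (Fk a) (nhdsWithin 0 (Iic 0)) (nhds 0) := by
    refine tendsto_const_nhds.congr' ?_
    filter_upwards [self_mem_nhdsWithin] with s hs
    exact (if_neg (not_lt.2 hs)).symm
  have := h4.sup h3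
  rwa [← nhdsWithin_union, Iic_union_Ioi, nhdsWithin_univ] at this

lemma Fk_deriv (a s : ℝ) : HasDerivAt (Fk a) (a * Fk (a - 1) s + 1 / 4 * Fk (a - 2) s) s := by
  rcases lt_trichotomy s 0 with hs | rfl | hs
  · have h1 : Fk a =ᶠ[nhds s] fun _ => 0 := by
      filter_upwards [gt_mem_nhds hs] with y hy
      exact if_neg hy.not_gt
    have h2 := (hasDerivAt_const s (0 : ℝ)).congr_of_eventuallyEq h1
    simpa [Fk, hs.not_gt] using h2
  · have h0 : ∀ b, Fk b 0 = 0 := fun b => if_neg (lt_irrefl _)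
    rw [h0, h0, mul_zero, mul_zero, add_zero, hasDerivAt_iff_tendsto_slope]
    refine ((Fk_tendsto (a - 1)).mono_left nhdsWithin_le_nhds).congr' ?_
    filter_upwards [self_mem_nhdsWithin] with y hy
    rw [slope_def_field, h0, sub_zero, sub_zero]
    unfold Fk
    split_ifs with h
    · rw [Real.rpow_sub_one h.ne']; ring
    · simp
  · have h1 : Fk a =ᶠ[nhds s] fun y => y ^ a * Real.exp (-(1 / (4 * y))) := by
      filter_upwards [lt_mem_nhds hs] with y hy
      exact if_pos hy
    have h2 : HasDerivAt (fun y : ℝ => -(1 / (4 * y))) (1 / (4 * s ^ 2)) s := by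
      have := ((((hasDerivAt_id s).const_mul 4).inv (by simp [hs.ne'])).neg)
      refine (this.congr_deriv ?_).congr_of_eventuallyEq ?_
      · simp; field_simp
      · exact Eventually.of_forall fun y => by simp
    have h3 := ((Real.hasDerivAt_rpow_const (p := a) (Or.inl hs.ne')).mul h2.exp)
    refine (h3.congr_deriv ?_).congr_of_eventuallyEq h1
    simp only [Fk, if_pos hs]
    rw [Real.rpow_sub_one hs.ne', show a - 2 = a - 1 - 1 by ring, Real.rpow_sub_one hs.ne',
      Real.rpow_sub_one hs.ne']
    field_simp

lemma Fk_smooth (a : ℝ) : ContDiff ℝ (⊤ : ℕ∞) (Fk a) := by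
  rw [contDiff_infty]
  intro m
  induction m generalizing a with
  | zero => exact contDiff_zero.2 (Differentiable.continuous fun s => (Fk_deriv a s).differentiableAt)
  | succ m ih =>
    push_cast
    rw [contDiff_succ_iff_deriv]
    refine ⟨fun s => (Fk_deriv a s).differentiableAt, by simp, ?_⟩
    have : deriv (Fk a) = fun s => a * Fk (a - 1) s + 1 / 4 * Fk (a - 2) s :=
      funext fun s => (Fk_deriv a s).deriv
    rw [this]
    exact (contDiff_const.mul (ih _)).add (contDiff_const.mul (ih _))

/-- the heat kernel -/
def hk {n : ℕ} (p : Spc n × ℝ) : ℝ :=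
  if 0 < p.2 then (4 * Real.pi * p.2) ^ (-(n / 2 : ℝ)) * Real.exp (-(‖p.1‖ ^ 2 / (4 * p.2))) else 0

lemma hk_nonneg {n : ℕ} (p : Spc n × ℝ) : 0 ≤ hk p := by
  unfold hk; split_ifs <;> positivity

lemma hk_eq_Fk {n : ℕ} {p : Spc n × ℝ} (hp : p.1 ≠ 0) :
    hk p = (4 * Real.pi) ^ (-(n / 2 : ℝ)) * (‖p.1‖ ^ n)⁻¹ * Fk (-(n / 2 : ℝ)) (p.2 / ‖p.1‖ ^ 2) := by
  have h0 : 0 < ‖p.1‖ := norm_pos_iff.2 hp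
  unfold hk Fk
  by_cases ht : 0 < p.2
  · rw [if_pos ht, if_pos (by positivity), Real.div_rpow ht.le (by positivity),
      Real.mul_rpow (by positivity) ht.le]
    have h1 : (‖p.1‖ ^ 2) ^ (-(n / 2 : ℝ)) = (‖p.1‖ ^ n)⁻¹ := by
      rw [← Real.rpow_natCast, ← Real.rpow_mul h0.le, ← Real.rpow_natCast,
        ← Real.rpow_neg h0.le]
      congr 1; push_cast; ring
    have h2 : ‖p.1‖ ^ 2 / (4 * p.2) = 1 / (4 * (p.2 / ‖p.1‖ ^ 2)) := by field_simp
    rw [h1, h2]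
    field_simp
  · rw [if_neg ht, if_neg]
    · simp
    · intro h
      exact ht (by rw [div_pos_iff_of_pos_right (by positivity)] at h; exact h)

lemma hk_smoothAt {n : ℕ} {p : Spc n × ℝ} (hp : p ≠ 0) : ContDiffAt ℝ (⊤ : ℕ∞) (hk (n := n)) p := by
  by_cases hx : p.1 = 0
  · have ht : p.2 ≠ 0 := fun h => hp (Prod.ext hx h)
    rcases lt_or_gt_of_ne ht with h | h
    · have h1 : hk (n := n) =ᶠ[nhds p] fun _ => 0 := by
        filter_upwards [(isOpen_lt continuous_snd continuous_const).mem_nhds h] with y hy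
        exact if_neg (not_lt.2 (le_of_lt hy))
      exact contDiffAt_const.congr_of_eventuallyEq h1
    · have h1 : hk (n := n) =ᶠ[nhds p] fun p => (4 * Real.pi * p.2) ^ (-(n / 2 : ℝ)) *
          Real.exp (-(‖p.1‖ ^ 2 / (4 * p.2))) := by
        filter_upwards [(isOpen_lt continuous_const continuous_snd).mem_nhds h] with y hy
        exact if_pos hy
      refine ContDiffAt.congr_of_eventuallyEq ?_ h1
      refine ContDiffAt.mul ?_ ?_
      · refine ContDiffAt.rpow_const_of_ne (contDiffAt_const.mul contDiffAt_snd) ?_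
        have : 0 < p.2 := h
        positivity
      · refine ContDiffAt.exp (ContDiffAt.neg (ContDiffAt.div ?_ ?_ ?_))
        · exact contDiffAt_fst.norm_sq ℝ
        · exact contDiffAt_const.mul contDiffAt_snd
        · have : 0 < p.2 := h
          positivity
  · have h0 : 0 < ‖p.1‖ := norm_pos_iff.2 hx
    have h1 : hk (n := n) =ᶠ[nhds p] fun p => (4 * Real.pi) ^ (-(n / 2 : ℝ)) * (‖p.1‖ ^ n)⁻¹ *
        Fk (-(n / 2 : ℝ)) (p.2 / ‖p.1‖ ^ 2) := by
      filter_upwards [(isOpen_ne.preimage continuous_fst).mem_nhds hx] with y hy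
      exact hk_eq_Fk hy
    refine ContDiffAt.congr_of_eventuallyEq ?_ h1
    have hN : ContDiffAt ℝ (⊤ : ℕ∞) (fun p : Spc n × ℝ => ‖p.1‖) p := contDiffAt_fst.norm ℝ hx
    refine ContDiffAt.mul (contDiffAt_const.mul ((hN.pow n).inv (by positivity))) ?_
    exact (Fk_smooth _).contDiffAt.comp p (contDiffAt_snd.div (hN.pow 2) (by positivity))

lemma smoothAt_dd {n : ℕ} {f : Spc n × ℝ → ℝ} {p : Spc n × ℝ}
    (hf : ContDiffAt ℝ (⊤ : ℕ∞) f p) (v : Spc n × ℝ) : ContDiffAt ℝ (⊤ : ℕ∞) (dd v f) p := by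
  have h : ContDiffAt ℝ (⊤ : ℕ∞) (fderiv ℝ f) p := hf.fderiv_right (by simp)
  exact h.clm_apply contDiffAt_const

lemma smoothAt_Lop {n : ℕ} {f : Spc n × ℝ → ℝ} {p : Spc n × ℝ}
    (hf : ContDiffAt ℝ (⊤ : ℕ∞) f p) : ContDiffAt ℝ (⊤ : ℕ∞) (Lop f) p :=
  (smoothAt_dd hf eT).sub (ContDiffAt.sum fun i _ => smoothAt_dd (smoothAt_dd hf (eX i)) (eX i))

lemma dd_congr {n : ℕ} {f g : Spc n × ℝ → ℝ} {p : Spc n × ℝ} (h : f =ᶠ[nhds p] g)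
    (v : Spc n × ℝ) : dd v f =ᶠ[nhds p] dd v g := by
  filter_upwards [h.eventually_nhds] with q hq
  unfold dd
  rw [Filter.EventuallyEq.fderiv_eq hq]

lemma Lop_congr {n : ℕ} {f g : Spc n × ℝ → ℝ} {p : Spc n × ℝ} (h : f =ᶠ[nhds p] g) :
    Lop f =ᶠ[nhds p] Lop g := by
  have h1 := dd_congr h eT
  have h2 : ∀ᶠ q in nhds p, ∀ i : Fin n, dd (eX i) (dd (eX i) f) q = dd (eX i) (dd (eX i) g) q :=
    eventually_all.2 fun i => dd_congr (dd_congr h (eX i)) (eX i)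
  filter_upwards [h1, h2] with q h1 h2
  simp only [Lop, h1, h2]

lemma hk_zero_of_nonpos {n : ℕ} {p : Spc n × ℝ} (hp : p.2 ≤ 0) : hk p = 0 := if_neg (not_lt.2 hp)

lemma snd_ne {n : ℕ} {p : Spc n × ℝ} (hp : p.2 ≠ 0) : p ≠ 0 := fun h => hp (by rw [h]; rfl)

lemma norm_line {n : ℕ} (x : Spc n) (i : Fin n) (s : ℝ) :
    ‖x + s • ev i‖ ^ 2 = ‖x‖ ^ 2 + 2 * s * x i + s ^ 2 := by
  have h : inner ℝ x (ev i) = x i := by simp [ev, EuclideanSpace.inner_single_right]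
  rw [norm_add_sq_real, norm_smul, inner_smul_right, h]
  simp
  ring

lemma hk_line {n : ℕ} {p : Spc n × ℝ} (hp : 0 < p.2) (i : Fin n) (s : ℝ) :
    hk (p + s • eX i) = (4 * Real.pi * p.2) ^ (-(n / 2 : ℝ)) *
      Real.exp (-((‖p.1‖ ^ 2 + 2 * s * p.1 i + s ^ 2) / (4 * p.2))) := by
  have h1 : (p + s • eX i).2 = p.2 := by simp [eX]
  have h2 : (p + s • eX i).1 = p.1 + s • ev i := by simp [eX]
  unfold hk
  rw [h1, if_pos hp, h2, norm_line]

lemma hk_dx {n : ℕ} {p : Spc n × ℝ} (hp : 0 < p.2) (i : Fin n) :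
    dd (eX i) hk p = -(p.1 i / (2 * p.2)) * hk p := by
  refine dd_eq_of_line ((hk_smoothAt (snd_ne hp.ne')).differentiableAt (by simp)) ?_
  simp only [hk_line hp]
  have h1 : HasDerivAt (fun s : ℝ => -((‖p.1‖ ^ 2 + 2 * s * p.1 i + s ^ 2) / (4 * p.2)))
      (-(p.1 i / (2 * p.2))) 0 := by
    have := (((((hasDerivAt_id (0 : ℝ)).const_mul 2).mul_const (p.1 i)).const_add (‖p.1‖ ^ 2)).add
      (hasDerivAt_pow 2 (0 : ℝ))).div_const (4 * p.2) |>.neg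
    refine this.congr_deriv ?_
    simp; field_simp; norm_num; ring
  have h2 := h1.exp.const_mul ((4 * Real.pi * p.2) ^ (-(n / 2 : ℝ)))
  refine h2.congr_deriv ?_
  unfold hk
  rw [if_pos hp]
  simp
  ring

lemma hk_dxx {n : ℕ} {p : Spc n × ℝ} (hp : 0 < p.2) (i : Fin n) :
    dd (eX i) (dd (eX i) hk) p = (p.1 i ^ 2 / (4 * p.2 ^ 2) - 1 / (2 * p.2)) * hk p := by
  refine dd_eq_of_line ((smoothAt_dd (hk_smoothAt (snd_ne hp.ne')) _).differentiableAt (by simp)) ?_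
  have h0 : ∀ s : ℝ, dd (eX i) hk (p + s • eX i)
      = -((p.1 i + s) / (2 * p.2)) * hk (p + s • eX i) := fun s => by
    have h2 : (p + s • eX i).2 = p.2 := by simp [eX]
    have h3 : (p + s • eX i).1 i = p.1 i + s := by simp [eX]
    rw [hk_dx (by rw [h2]; exact hp), h2, h3]
  simp only [h0]
  have h1 : HasDerivAt (fun s : ℝ => -((p.1 i + s) / (2 * p.2))) (-(1 / (2 * p.2))) 0 :=
    (((hasDerivAt_id (0 : ℝ)).const_add (p.1 i)).div_const (2 * p.2)).neg
  have h2 := hasDerivAt_line (f := hk) (p := p) (v := eX i) (s := 0)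
    (by simpa using (hk_smoothAt (snd_ne hp.ne')).differentiableAt (by simp))
  refine (h1.mul h2).congr_deriv ?_
  simp only [zero_smul, add_zero]
  rw [hk_dx hp]
  field_simp
  ring

lemma hk_dt {n : ℕ} {p : Spc n × ℝ} (hp : 0 < p.2) :
    dd eT hk p = (‖p.1‖ ^ 2 / (4 * p.2 ^ 2) - n / (2 * p.2)) * hk p := by
  refine dd_eq_of_line ((hk_smoothAt (snd_ne hp.ne')).differentiableAt (by simp)) ?_
  have h0 : (fun s : ℝ => hk (p + s • eT)) =ᶠ[nhds 0] fun s =>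
      (4 * Real.pi * (p.2 + s)) ^ (-(n / 2 : ℝ)) *
      Real.exp (-(‖p.1‖ ^ 2 / (4 * (p.2 + s)))) := by
    filter_upwards [lt_mem_nhds (show -p.2 < 0 by linarith)] with s hs
    have h1 : (p + s • eT).2 = p.2 + s := by simp [eT]
    have h2 : (p + s • eT).1 = p.1 := by simp [eT]
    unfold hk
    rw [h1, h2, if_pos (by linarith)]
  refine HasDerivAt.congr_of_eventuallyEq ?_ h0
  have hpi := Real.pi_pos
  have hid : HasDerivAt (fun s : ℝ => p.2 + s) 1 0 := (hasDerivAt_id (0 : ℝ)).const_add p.2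
  have h1 : HasDerivAt (fun s : ℝ => 4 * Real.pi * (p.2 + s)) (4 * Real.pi) 0 := by
    simpa using hid.const_mul (4 * Real.pi)
  have h2 := h1.rpow_const (p := -(n / 2 : ℝ)) (Or.inl (by simp; exact hp.ne'))
  have h3 : HasDerivAt (fun s : ℝ => -(‖p.1‖ ^ 2 / (4 * (p.2 + s))))
      (‖p.1‖ ^ 2 / (4 * p.2 ^ 2)) 0 := by
    have := ((hasDerivAt_const (0 : ℝ) (‖p.1‖ ^ 2)).div (hid.const_mul 4)
      (by simp [hp.ne'])).neg
    refine this.congr_deriv ?_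
    simp; field_simp
  refine (h2.mul h3.exp).congr_deriv ?_
  unfold hk
  rw [if_pos hp]
  simp only [add_zero]
  rw [Real.rpow_sub_one (by positivity)]
  field_simp
  ring

lemma hk_Lop_pos {n : ℕ} {p : Spc n × ℝ} (hp : 0 < p.2) : Lop hk p = 0 := by
  unfold Lop
  simp only [hk_dxx hp, hk_dt hp]
  rw [← Finset.sum_mul, ← sub_mul, Finset.sum_sub_distrib, ← Finset.sum_div]
  have : ∑ i, p.1 i ^ 2 = ‖p.1‖ ^ 2 := by
    rw [EuclideanSpace.norm_sq_eq]; simp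
  rw [this]
  simp
  left
  ring

lemma hk_dx_neg {n : ℕ} {p : Spc n × ℝ} (hp : p.2 < 0) : hk (n := n) =ᶠ[nhds p] fun _ => 0 := by
  filter_upwards [(isOpen_lt continuous_snd continuous_const).mem_nhds hp] with y hy
  exact hk_zero_of_nonpos (le_of_lt hy)

lemma dd_zero {n : ℕ} (v : Spc n × ℝ) : dd v (fun _ => (0 : ℝ)) = fun _ => 0 := by
  ext p; simp [dd]

lemma Lop_zero {n : ℕ} : Lop (n := n) (fun _ => (0 : ℝ)) = fun _ => 0 := by
  ext p; simp [Lop, dd_zero]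

lemma hk_Lop {n : ℕ} {p : Spc n × ℝ} (hp : p ≠ 0) : Lop hk p = 0 := by
  rcases lt_trichotomy p.2 0 with h | h | h
  · rw [(Lop_congr (hk_dx_neg h)).eq_of_nhds, Lop_zero]
  · have hc := (smoothAt_Lop (hk_smoothAt hp)).continuousAt
    have h1 : Tendsto (fun s : ℝ => p + s • eT) (nhdsWithin 0 (Ioi 0)) (nhds p) := by
      have : Continuous (fun s : ℝ => p + s • (eT : Spc n × ℝ)) := by fun_prop
      simpa using (this.tendsto 0).mono_left nhdsWithin_le_nhds
    refine tendsto_nhds_unique (hc.tendsto.comp h1) (tendsto_const_nhds.congr' ?_)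
    filter_upwards [self_mem_nhdsWithin] with s hs
    have hs' : 0 < s := hs
    exact (hk_Lop_pos (by simp [eT, h, hs'])).symm
  · exact hk_Lop_pos h

lemma hk_dx_nonpos {n : ℕ} {p : Spc n × ℝ} (hp : p ≠ 0) (ht : p.2 ≤ 0) (i : Fin n) :
    dd (eX i) hk p = 0 := by
  refine dd_eq_of_line ((hk_smoothAt hp).differentiableAt (by simp)) ?_
  have : (fun s : ℝ => hk (p + s • eX i)) = fun _ => 0 := by
    ext s
    exact hk_zero_of_nonpos (by simpa [eX] using ht)
  rw [this]
  exact hasDerivAt_const _ _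

/-- Gaussian profile -/
def Gk {n : ℕ} (b : ℝ) (q : Spc n × ℝ) : ℝ :=
  (4 * Real.pi * q.2) ^ (-(n / 2 : ℝ)) * Real.exp (-(‖q.1‖ ^ 2 / (b * q.2)))

lemma Gk_measurable {n : ℕ} (b : ℝ) : Measurable (Gk (n := n) b) := by
  unfold Gk; fun_prop

lemma Gk_slice {n : ℕ} {b t : ℝ} (hb : 0 < b) (ht : 0 < t) :
    Integrable (fun y : Spc n => Gk b (y, t)) ∧ ∫ y : Spc n, Gk b (y, t) = (b / 4) ^ (n / 2 : ℝ) := by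
  have h0 : 0 < 1 / (b * t) := by positivity
  have h1 := GaussianFourier.integral_rexp_neg_mul_sq_norm (V := Spc n) h0
  have h2 : (∫ y : Spc n, Gk b (y, t)) = (b / 4) ^ (n / 2 : ℝ) := by
    have : ∀ y : Spc n, Gk b (y, t) = (4 * Real.pi * t) ^ (-(n / 2 : ℝ)) *
        Real.exp (-(1 / (b * t)) * ‖y‖ ^ 2) := by
      intro y; unfold Gk; congr 2; field_simp
    simp only [this]
    rw [integral_const_mul, h1]
    simp only [finrank_euclideanSpace, Fintype.card_fin]
    rw [Real.rpow_neg (by positivity), ← Real.inv_rpow (by positivity), ← Real.mul_rpow (by positivity) (by positivity)]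
    congr 1
    have := Real.pi_pos
    field_simp
  refine ⟨Integrable.of_integral_ne_zero ?_, h2⟩
  rw [h2]; positivity

lemma gauss_int {n : ℕ} {b : ℝ} (hb : 0 < b) {θ : ℝ → ℝ} (hθ : Integrable θ) (h0 : ∀ t ≤ 0, θ t = 0) :
    Integrable (fun q : Spc n × ℝ => θ q.2 * Gk b q) ∧
      ∫ q : Spc n × ℝ, θ q.2 * Gk b q = (b / 4) ^ (n / 2 : ℝ) * ∫ t, θ t := by
  have hG : ∀ (t : ℝ) (y : Spc n), 0 < t → 0 ≤ Gk b (y, t) := fun t y ht => by unfold Gk; positivity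
  have hI : Integrable (fun q : Spc n × ℝ => θ q.2 * Gk b q) := by
    rw [Measure.volume_eq_prod, integrable_prod_iff']
    · constructor
      · refine Eventually.of_forall fun t => ?_
        rcases le_or_gt t 0 with ht | ht
        · simp [h0 t ht]
        · exact (Gk_slice hb ht).1.const_mul (θ t)
      · refine (hθ.norm.const_mul ((b / 4) ^ (n / 2 : ℝ))).congr (Eventually.of_forall fun t => ?_)
        rcases le_or_gt t 0 with ht | ht
        · simp [h0 t ht]
        · simp only [norm_mul]
          rw [integral_const_mul]
          have : ∀ y : Spc n, ‖Gk b (y, t)‖ = Gk b (y, t) := fun y => Real.norm_of_nonneg (hG t y ht)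
          simp only [this, (Gk_slice hb ht).2, mul_comm]
    · exact hθ.aestronglyMeasurable.comp_snd.mul (Gk_measurable b).aestronglyMeasurable
  refine ⟨hI, ?_⟩
  rw [Measure.volume_eq_prod] at hI ⊢
  rw [integral_prod_symm _ hI, ← integral_const_mul]
  refine integral_congr_ae (Eventually.of_forall fun t => ?_)
  rcases le_or_gt t 0 with ht | ht
  · simp [h0 t ht]
  · simp only
    rw [integral_const_mul, (Gk_slice hb ht).2, mul_comm]

/-- time weight -/
def tw (t : ℝ) : ℝ := (Ioo (0 : ℝ) 1).indicator (fun t => t ^ (-(1 / 2) : ℝ)) t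

lemma tw_int : Integrable tw := by
  unfold tw
  rw [integrable_indicator_iff measurableSet_Ioo]
  exact (intervalIntegral.integrableOn_Ioo_rpow_iff one_pos).2 (by norm_num)

/-- dominating function -/
def dm {n : ℕ} (q : Spc n × ℝ) : ℝ := tw q.2 * Gk 8 q

lemma dm_int {n : ℕ} : Integrable (dm (n := n)) :=
  (gauss_int (by norm_num) tw_int (fun t ht => indicator_of_notMem (fun h => not_lt.2 ht h.1) _)).1

lemma dm_eq {n : ℕ} {q : Spc n × ℝ} (h0 : 0 < q.2) (h1 : q.2 < 1) :
    dm q = q.2 ^ (-(1 / 2) : ℝ) * Gk 8 q := by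
  unfold dm tw; rw [indicator_of_mem (show q.2 ∈ Ioo (0:ℝ) 1 from ⟨h0, h1⟩)]

lemma dm_nonneg {n : ℕ} (q : Spc n × ℝ) : 0 ≤ dm q := by
  by_cases h : q.2 ∈ Ioo (0:ℝ) 1
  · rw [dm_eq h.1 h.2]; have := h.1; unfold Gk; positivity
  · unfold dm tw; rw [indicator_of_notMem h, zero_mul]

lemma hk_eq_Gk {n : ℕ} {q : Spc n × ℝ} (h0 : 0 < q.2) : hk q = Gk 4 q := if_pos h0

lemma hk_le_dm {n : ℕ} {q : Spc n × ℝ} (h1 : q.2 < 1) : hk q ≤ dm q := by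
  rcases le_or_gt q.2 0 with h0 | h0
  · rw [hk_zero_of_nonpos h0]; exact dm_nonneg q
  rw [dm_eq h0 h1, hk_eq_Gk h0]
  have h2 : (1:ℝ) ≤ q.2 ^ (-(1 / 2) : ℝ) := Real.one_le_rpow_of_pos_of_le_one_of_nonpos h0 h1.le (by norm_num)
  have h3 : Gk 4 q ≤ Gk 8 q := by
    unfold Gk
    gcongr
    norm_num
  have : 0 ≤ Gk 8 q := by unfold Gk; positivity
  nlinarith

lemma hk_dx_le_dm {n : ℕ} {q : Spc n × ℝ} (hq : q ≠ 0) (h1 : q.2 < 1) (i : Fin n) :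
    |dd (eX i) hk q| ≤ dm q := by
  rcases le_or_gt q.2 0 with h0 | h0
  · rw [hk_dx_nonpos hq h0, abs_zero]; exact dm_nonneg q
  rw [dm_eq h0 h1, hk_dx h0, hk_eq_Gk h0, abs_mul, abs_neg]
  set s := Real.sqrt q.2 with hs
  have hs0 : 0 < s := Real.sqrt_pos.2 h0
  have hss : q.2 = s ^ 2 := (Real.sq_sqrt h0.le).symm
  have e1 : q.2 ^ (-(1 / 2) : ℝ) = 1 / s := by
    rw [Real.rpow_neg h0.le, ← Real.sqrt_eq_rpow, one_div]
  have hxi : |q.1 i| ≤ ‖q.1‖ := by simpa using PiLp.norm_apply_le q.1 i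
  have hG : Gk 4 q = Real.exp (-(‖q.1‖ ^ 2 / (8 * q.2))) * Gk 8 q := by
    unfold Gk
    rw [mul_left_comm, ← Real.exp_add]; congr 2; field_simp; ring
  have hG8 : 0 ≤ Gk 8 q := by unfold Gk; positivity
  rw [hG, abs_of_nonneg (by positivity : 0 ≤ Real.exp (-(‖q.1‖ ^ 2 / (8 * q.2))) * Gk 8 q), e1, ← mul_assoc]
  refine mul_le_mul_of_nonneg_right ?_ hG8
  rw [abs_div, abs_of_pos (by positivity : 0 < 2 * q.2), Real.exp_neg, hss]
  set w := ‖q.1‖ / s with hw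
  have hw0 : 0 ≤ w := by positivity
  have hE : 1 + w ^ 2 / 8 ≤ Real.exp (‖q.1‖ ^ 2 / (8 * s ^ 2)) := by
    have := Real.add_one_le_exp (‖q.1‖ ^ 2 / (8 * s ^ 2))
    have e : ‖q.1‖ ^ 2 / (8 * s ^ 2) = w ^ 2 / 8 := by rw [hw]; field_simp
    rw [e] at this ⊢; linarith
  have h4 : |q.1 i| / (2 * s ^ 2) ≤ (w / 2) / s := by
    rw [hw, div_div, div_div]
    have : s * (2 * s) = 2 * s ^ 2 := by ring
    rw [this]
    gcongr
  rw [← div_eq_mul_inv, div_le_iff₀ (Real.exp_pos _)]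
  refine h4.trans ?_
  rw [div_eq_mul_one_div, mul_comm]
  refine mul_le_mul_of_nonneg_left ?_ (by positivity)
  nlinarith [sq_nonneg (w - 2)]

lemma hk_measurable {n : ℕ} : Measurable (hk (n := n)) := by
  unfold hk
  exact Measurable.ite (measurableSet_lt measurable_const measurable_snd) (by fun_prop) measurable_const

/-- time cutoffs -/
def Hc (k : ℕ) (t : ℝ) : ℝ := Real.smoothTransition (t * (k + 1) - 1)

lemma Hc_smooth (k : ℕ) : ContDiff ℝ (⊤ : ℕ∞) (Hc k) :=
  Real.smoothTransition.contDiff.comp ((contDiff_id.mul contDiff_const).sub contDiff_const)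

lemma Hc_zero {k : ℕ} {t : ℝ} (h : t * (k + 1) ≤ 1) : Hc k t = 0 :=
  Real.smoothTransition.zero_of_nonpos (by linarith)

lemma Hc_one {k : ℕ} {t : ℝ} (h : 2 ≤ t * (k + 1)) : Hc k t = 1 :=
  Real.smoothTransition.one_of_one_le (by linarith)

lemma Hc_nonneg (k : ℕ) (t : ℝ) : 0 ≤ Hc k t := Real.smoothTransition.nonneg _

lemma Hc_le_one (k : ℕ) (t : ℝ) : Hc k t ≤ 1 := Real.smoothTransition.le_one _

lemma Hc_mono (k : ℕ) : Monotone (Hc k) := by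
  intro a b hab
  refine Real.smoothTransition.monotone ?_
  have : (0:ℝ) ≤ k + 1 := by positivity
  nlinarith

lemma Hc_tendsto {t : ℝ} (ht : 0 < t) : ∀ᶠ k in atTop, Hc k t = 1 := by
  have h : Tendsto (fun k : ℕ => t * ((k:ℝ) + 1)) atTop atTop :=
    (tendsto_atTop_add_const_right _ _ tendsto_natCast_atTop_atTop).const_mul_atTop ht
  filter_upwards [h.eventually_ge_atTop 2] with k hk
  exact Hc_one hk

lemma Hd_nonneg (k : ℕ) (t : ℝ) : 0 ≤ deriv (Hc k) t := (Hc_mono k).deriv_nonneg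

lemma Hd_zero_left {k : ℕ} {t : ℝ} (h : t * (k + 1) < 1) : deriv (Hc k) t = 0 := by
  have : Hc k =ᶠ[nhds t] fun _ => 0 := by
    filter_upwards [(isOpen_lt (by fun_prop : Continuous fun t : ℝ => t * ((k:ℝ) + 1)) continuous_const).mem_nhds h] with s hs
    exact Hc_zero (le_of_lt hs)
  rw [this.deriv_eq, deriv_const]

lemma Hd_zero_right {k : ℕ} {t : ℝ} (h : 2 < t * (k + 1)) : deriv (Hc k) t = 0 := by
  have : Hc k =ᶠ[nhds t] fun _ => 1 := by
    filter_upwards [(isOpen_lt continuous_const (by fun_prop : Continuous fun t : ℝ => t * ((k:ℝ) + 1))).mem_nhds h] with s hs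
    exact Hc_one (le_of_lt hs)
  rw [this.deriv_eq, deriv_const]

lemma Hd_cont (k : ℕ) : Continuous (deriv (Hc k)) := (Hc_smooth k).continuous_deriv (by simp)

lemma Hd_int (k : ℕ) : Integrable (deriv (Hc k)) := by
  refine (Hd_cont k).integrable_of_hasCompactSupport (HasCompactSupport.intro (isCompact_Icc (a := (0:ℝ)) (b := 2)) ?_)
  intro t ht
  have hk : (0:ℝ) ≤ k := by positivity
  rcases lt_or_ge t 0 with h | h
  · exact Hd_zero_left (by nlinarith)
  · have : 2 < t := by by_contra h2; exact ht ⟨h, not_lt.1 h2⟩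
    exact Hd_zero_right (by nlinarith)

lemma Hd_integral (k : ℕ) : ∫ t, deriv (Hc k) t = 1 := by
  have h := integral_of_hasDerivAt_of_tendsto (f := Hc k) (f' := deriv (Hc k)) (m := 0) (n := 1)
    (fun x => ((Hc_smooth k).differentiable (by simp) x).hasDerivAt) (Hd_int k) ?_ ?_
  · simpa using h
  · refine tendsto_const_nhds.congr' ?_
    filter_upwards [eventually_lt_atBot (0:ℝ)] with t ht
    have hk : (0:ℝ) ≤ k := by positivity
    exact (Hc_zero (by nlinarith)).symm
  · refine tendsto_const_nhds.congr' ?_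
    filter_upwards [eventually_gt_atTop (2:ℝ)] with t ht
    have hk : (0:ℝ) ≤ k := by positivity
    exact (Hc_one (by nlinarith)).symm

/-- convolution -/
def cv {n : ℕ} (u f : Spc n × ℝ → ℝ) (p : Spc n × ℝ) : ℝ := ∫ q, u q * f (p - q)

lemma cv_eq {n : ℕ} (u f : Spc n × ℝ → ℝ) (p : Spc n × ℝ) : cv u f p = ∫ q, u (p - q) * f q := by
  unfold cv
  rw [← integral_sub_left_eq_self (fun q => u q * f (p - q)) volume p]
  simp

lemma Gk_nonneg {n : ℕ} {b : ℝ} {q : Spc n × ℝ} (h : 0 ≤ q.2) : 0 ≤ Gk b q := by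
  unfold Gk; positivity

lemma Gk_tail {n : ℕ} {q : Spc n × ℝ} {δ : ℝ} (hδ : 0 < δ) (h : 0 < q.2) (hq : δ ≤ ‖q.1‖) :
    Gk 4 q ≤ 8 * q.2 / δ ^ 2 * Gk 8 q := by
  have hG : Gk 4 q = Real.exp (-(‖q.1‖ ^ 2 / (8 * q.2))) * Gk 8 q := by
    unfold Gk
    rw [mul_left_comm, ← Real.exp_add]; congr 2; field_simp; ring
  rw [hG]
  refine mul_le_mul_of_nonneg_right ?_ (Gk_nonneg h.le)
  rw [Real.exp_neg, show 8 * q.2 / δ ^ 2 = (δ ^ 2 / (8 * q.2))⁻¹ by rw [inv_div]]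
  gcongr
  calc δ ^ 2 / (8 * q.2) ≤ ‖q.1‖ ^ 2 / (8 * q.2) := by gcongr
    _ ≤ _ := (by linarith [Real.add_one_le_exp (‖q.1‖ ^ 2 / (8 * q.2))])

lemma approx_id {n : ℕ} {u ζ : Spc n × ℝ → ℝ} {M : ℝ} {p : Spc n × ℝ} (hu : Measurable u)
    (hM : ∀ q, |u q| ≤ M) (hc : ContinuousAt u p) (hζ : Continuous ζ) (hζ0 : ζ 0 = 1)
    (hζ1 : ∀ q, |ζ q| ≤ 1) :
    Tendsto (fun k : ℕ => cv u (fun q => deriv (Hc k) q.2 * (ζ q * hk q)) p) atTop (nhds (u p)) := by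
  have hM0 : 0 ≤ M := (abs_nonneg _).trans (hM 0)
  have hHk : ∀ (k : ℕ) (q : Spc n × ℝ), deriv (Hc k) q.2 * hk q = deriv (Hc k) q.2 * Gk 4 q := by
    intro k q
    rcases le_or_gt q.2 0 with h | h
    · have : (0:ℝ) ≤ k := by positivity
      rw [Hd_zero_left (by nlinarith), zero_mul, zero_mul]
    · rw [hk_eq_Gk h]
  have h0 : ∀ k : ℕ, ∀ t ≤ 0, deriv (Hc k) t = 0 := fun k t ht => Hd_zero_left (by
    have : (0:ℝ) ≤ k := by positivity
    nlinarith)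
  have i4 := fun k => gauss_int (n := n) (b := 4) (by norm_num) (Hd_int k) (h0 k)
  have i8 := fun k => gauss_int (n := n) (b := 8) (by norm_num) (Hd_int k) (h0 k)
  have hcv : ∀ k, cv u (fun q => deriv (Hc k) q.2 * (ζ q * hk q)) p =
      ∫ q, (ζ q * u (p - q)) * (deriv (Hc k) q.2 * Gk 4 q) := by
    intro k
    rw [cv_eq]
    refine integral_congr_ae (Eventually.of_forall fun q => ?_)
    simp only
    rw [← hHk]; ring
  have hmeas : Measurable fun q => ζ q * u (p - q) :=
    hζ.measurable.mul (hu.comp (measurable_const.sub measurable_id))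
  have hbd : ∀ q, |ζ q * u (p - q)| ≤ M := fun q => by
    rw [abs_mul]; calc _ ≤ 1 * M := mul_le_mul (hζ1 q) (hM _) (abs_nonneg _) zero_le_one
      _ = M := one_mul M
  rw [Metric.tendsto_atTop']
  intro ε hε
  have hca : ContinuousAt (fun q => ζ q * u (p - q)) 0 := by
    refine hζ.continuousAt.mul (ContinuousAt.comp (g := u) (by simpa using hc) (by fun_prop))
  obtain ⟨δ, hδ, hδ2⟩ := Metric.continuousAt_iff.1 hca (ε / 2) (by positivity)
  simp only [hζ0, sub_zero, one_mul, dist_zero_right, Real.dist_eq] at hδ2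
  set K := 2 * M * (16 / δ ^ 2) * (8 / 4 : ℝ) ^ (n / 2 : ℝ) with hK
  have hK0 : 0 ≤ K := by positivity
  obtain ⟨N, hN⟩ := exists_nat_gt (max (2 / δ) (2 * K / ε))
  refine ⟨N, fun k hk => ?_⟩
  have hkN : (N:ℝ) < k := by exact_mod_cast hk
  have hk1 : 2 / δ < (k:ℝ) + 1 := by linarith [le_max_left (2 / δ) (2 * K / ε)]
  have hk2 : 2 * K / ε < (k:ℝ) + 1 := by linarith [le_max_right (2 / δ) (2 * K / ε)]
  have hkp : (0:ℝ) < k + 1 := by positivity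
  have hpt : ∀ q : Spc n × ℝ, ‖(ζ q * u (p - q) - u p) * (deriv (Hc k) q.2 * Gk 4 q)‖ ≤
      ε / 2 * (deriv (Hc k) q.2 * Gk 4 q) + 2 * M * (16 / δ ^ 2) / (k + 1) * (deriv (Hc k) q.2 * Gk 8 q) := by
    intro q
    by_cases hz : deriv (Hc k) q.2 = 0
    · simp [hz]
    have hq2 : q.2 * (k + 1) ≤ 2 := by by_contra h; exact hz (Hd_zero_right (not_le.1 h))
    have hq1 : 0 < q.2 := by by_contra h; exact hz (h0 k _ (not_lt.1 h))
    have hd := Hd_nonneg k q.2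
    have g4 := Gk_nonneg (b := 4) hq1.le
    have g8 := Gk_nonneg (b := 8) hq1.le
    rw [norm_mul, Real.norm_eq_abs, Real.norm_of_nonneg (mul_nonneg hd g4)]
    by_cases hq : ‖q‖ < δ
    · have := (hδ2 hq).le
      have h2 : 0 ≤ 2 * M * (16 / δ ^ 2) / (k + 1) * (deriv (Hc k) q.2 * Gk 8 q) := by positivity
      have := mul_le_mul_of_nonneg_right this (mul_nonneg hd g4)
      linarith
    · have hx : δ ≤ ‖q.1‖ := by
        rw [Prod.norm_def] at hq
        by_contra h
        refine hq (max_lt (not_le.1 h) ?_)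
        rw [Real.norm_of_nonneg hq1.le]
        rw [div_lt_iff₀ hδ] at hk1
        nlinarith
      have ht := Gk_tail hδ hq1 hx
      have h3 : 8 * q.2 / δ ^ 2 ≤ 16 / δ ^ 2 / (k + 1) := by
        rw [div_right_comm]
        gcongr
        rw [le_div_iff₀ hkp]; linarith
      have h4 : Gk 4 q ≤ 16 / δ ^ 2 / (k + 1) * Gk 8 q := ht.trans (mul_le_mul_of_nonneg_right h3 g8)
      have h5 : |ζ q * u (p - q) - u p| ≤ 2 * M := by
        have h6 := hbd q
        have h7 := hM p
        rw [abs_le] at *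
        constructor <;> linarith
      have h8 : 0 ≤ ε / 2 * (deriv (Hc k) q.2 * Gk 4 q) := by positivity
      calc _ ≤ 2 * M * (deriv (Hc k) q.2 * (16 / δ ^ 2 / (k + 1) * Gk 8 q)) := by gcongr
        _ = 2 * M * (16 / δ ^ 2) / (k + 1) * (deriv (Hc k) q.2 * Gk 8 q) := by ring
        _ ≤ _ := by linarith
  have hI1 : Integrable (fun q => (ζ q * u (p - q)) * (deriv (Hc k) q.2 * Gk 4 q)) :=
    (i4 k).1.bdd_mul (c := M) hmeas.aestronglyMeasurable (Eventually.of_forall hbd)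
  have e1 : cv u (fun q => deriv (Hc k) q.2 * (ζ q * _root_.hk q)) p - u p =
      ∫ q, (ζ q * u (p - q) - u p) * (deriv (Hc k) q.2 * Gk 4 q) := by
    simp only [sub_mul]
    rw [integral_sub hI1 ((i4 k).1.const_mul _), hcv, integral_const_mul, (i4 k).2, Hd_integral]
    simp
  rw [Real.dist_eq, e1]
  have := norm_integral_le_of_norm_le (((i4 k).1.const_mul (ε / 2)).add
    ((i8 k).1.const_mul (2 * M * (16 / δ ^ 2) / (k + 1)))) (Eventually.of_forall hpt)
  refine lt_of_le_of_lt this ?_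
  simp only [Pi.add_apply]
  rw [integral_add ((i4 k).1.const_mul (ε / 2)) ((i8 k).1.const_mul _), integral_const_mul,
    integral_const_mul, (i4 k).2, (i8 k).2, Hd_integral]
  have e2 : 2 * M * (16 / δ ^ 2) / (k + 1) * ((8 / 4 : ℝ) ^ (n / 2 : ℝ) * 1) = K / (k + 1) := by
    rw [hK]; ring
  rw [e2]
  have : K / (k + 1) < ε / 2 := by
    rw [div_lt_iff₀ hkp]
    rw [div_lt_iff₀ hε] at hk2
    linarith
  simp
  linarith

lemma dd_mul {n : ℕ} {f g : Spc n × ℝ → ℝ} {p : Spc n × ℝ} (hf : DifferentiableAt ℝ f p)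
    (hg : DifferentiableAt ℝ g p) (v : Spc n × ℝ) :
    dd v (fun q => f q * g q) p = f p * dd v g p + g p * dd v f p := by
  unfold dd
  rw [fderiv_fun_mul hf hg]; simp

lemma dd_sub {n : ℕ} {f g : Spc n × ℝ → ℝ} {p : Spc n × ℝ} (hf : DifferentiableAt ℝ f p)
    (hg : DifferentiableAt ℝ g p) (v : Spc n × ℝ) :
    dd v (fun q => f q - g q) p = dd v f p - dd v g p := by
  unfold dd
  rw [fderiv_fun_sub hf hg]; simp

lemma smoothAt_ev {n : ℕ} {f : Spc n × ℝ → ℝ} {p : Spc n × ℝ}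
    (hf : ContDiffAt ℝ (⊤ : ℕ∞) f p) : ∀ᶠ q in nhds p, DifferentiableAt ℝ f q := by
  have h1 : ContDiffAt ℝ 1 f p := hf.of_le (by norm_cast)
  filter_upwards [h1.eventually (by simp)] with q hq
  exact hq.differentiableAt (by simp)

lemma smoothAt_diff {n : ℕ} {f : Spc n × ℝ → ℝ} {p : Spc n × ℝ}
    (hf : ContDiffAt ℝ (⊤ : ℕ∞) f p) : DifferentiableAt ℝ f p := hf.differentiableAt (by simp)

lemma Lop_sub {n : ℕ} {f g : Spc n × ℝ → ℝ} {p : Spc n × ℝ} (hf : ContDiffAt ℝ (⊤ : ℕ∞) f p)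
    (hg : ContDiffAt ℝ (⊤ : ℕ∞) g p) : Lop (fun q => f q - g q) p = Lop f p - Lop g p := by
  have h2 : ∀ i, dd (eX i) (dd (eX i) (fun q => f q - g q)) p =
      dd (eX i) (dd (eX i) f) p - dd (eX i) (dd (eX i) g) p := by
    intro i
    have : dd (eX i) (fun q => f q - g q) =ᶠ[nhds p] fun q => dd (eX i) f q - dd (eX i) g q := by
      filter_upwards [smoothAt_ev hf, smoothAt_ev hg] with q h1 h2
      exact dd_sub h1 h2 _
    rw [(dd_congr this _).eq_of_nhds,
      dd_sub (smoothAt_diff (smoothAt_dd hf _)) (smoothAt_diff (smoothAt_dd hg _))]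
  unfold Lop
  rw [dd_sub (smoothAt_diff hf) (smoothAt_diff hg)]
  simp only [h2, Finset.sum_sub_distrib]
  ring

lemma dd_time {n : ℕ} {h : ℝ → ℝ} (hh : Differentiable ℝ h) (p v : Spc n × ℝ) :
    dd v (fun q => h q.2) p = v.2 * deriv h p.2 := by
  unfold dd
  have := ((hh p.2).hasDerivAt.hasFDerivAt).comp p (hasFDerivAt_snd (𝕜 := ℝ) (E := Spc n) (F := ℝ) (p := p))
  have e : HasFDerivAt (fun q : Spc n × ℝ => h q.2) _ p := this
  rw [e.fderiv]; simp

lemma Lop_time_mul {n : ℕ} {h : ℝ → ℝ} {f : Spc n × ℝ → ℝ} {p : Spc n × ℝ} (hh : ContDiff ℝ (⊤ : ℕ∞) h)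
    (hf : ContDiffAt ℝ (⊤ : ℕ∞) f p) :
    Lop (fun q => h q.2 * f q) p = h p.2 * Lop f p + deriv h p.2 * f p := by
  have hd : Differentiable ℝ h := hh.differentiable (by simp)
  have hd2 : ∀ q : Spc n × ℝ, DifferentiableAt ℝ (fun q : Spc n × ℝ => h q.2) q := fun q =>
    (hd.comp differentiable_snd) q
  have hx : ∀ (i : Fin n) (g : Spc n × ℝ → ℝ) (q), DifferentiableAt ℝ g q →
      dd (eX i) (fun q => h q.2 * g q) q = h q.2 * dd (eX i) g q := by
    intro i g q hg
    rw [dd_mul (hd2 q) hg, dd_time hd]; simp [eX]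
  have h2 : ∀ i, dd (eX i) (dd (eX i) (fun q => h q.2 * f q)) p =
      h p.2 * dd (eX i) (dd (eX i) f) p := by
    intro i
    have : dd (eX i) (fun q => h q.2 * f q) =ᶠ[nhds p] fun q => h q.2 * dd (eX i) f q := by
      filter_upwards [smoothAt_ev hf] with q h1
      exact hx i f q h1
    rw [(dd_congr this _).eq_of_nhds, hx _ _ _ (smoothAt_diff (smoothAt_dd hf _))]
  unfold Lop
  rw [dd_mul (hd2 p) (smoothAt_diff hf), dd_time hd]
  simp only [h2, ← Finset.mul_sum, eT]
  ring

/-- localized approximate fundamental solution -/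
structure Param {n : ℕ} (r : ℝ) (Γ ω : Spc n × ℝ → ℝ) (Γe : ℕ → Spc n × ℝ → ℝ)
    (G : Fin n → Spc n × ℝ → ℝ) : Prop where
  ω_smooth : Smooth ω
  ω_supp : tsupport ω ⊆ closedBall 0 r
  e_smooth : ∀ k, Smooth (Γe k)
  e_supp : ∀ k, tsupport (Γe k) ⊆ closedBall 0 r
  Γ_int : Integrable Γ
  Γ_zero : ∀ p, r < ‖p‖ → Γ p = 0
  Γ_lim : Tendsto (fun k => ∫ p, |Γe k p - Γ p|) atTop (nhds 0)
  G_int : ∀ i, Integrable (G i)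
  G_lim : ∀ i, Tendsto (fun k => ∫ p, |dd (eX i) (Γe k) p - G i p|) atTop (nhds 0)
  lim : ∀ (u : Spc n × ℝ → ℝ) (M : ℝ) (p : Spc n × ℝ), Measurable u → (∀ q, |u q| ≤ M) →
    ContinuousAt u p → Tendsto (fun k => cv u (Lop (Γe k)) p) atTop (nhds (u p + cv u ω p))

lemma tsupp_of_zero {n : ℕ} {f : Spc n × ℝ → ℝ} {r : ℝ} (h : ∀ p, r < ‖p‖ → f p = 0) :
    tsupport f ⊆ closedBall 0 r := by
  refine closure_minimal (fun p hp => ?_) isClosed_closedBall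
  rw [mem_closedBall_zero_iff]
  by_contra h2
  exact hp (h p (not_le.1 h2))

lemma hc_of_tsupp {n : ℕ} {f : Spc n × ℝ → ℝ} {r : ℝ} (h : tsupport f ⊆ closedBall 0 r) :
    HasCompactSupport f := (isCompact_closedBall 0 r).of_isClosed_subset (isClosed_tsupport f) h

/-- general dominated convergence with time cutoffs -/
lemma Hc_dct {n : ℕ} {f : Spc n × ℝ → ℝ} (hf : Integrable f) (h0 : ∀ᵐ p, p.2 ≤ 0 → f p = 0) :
    Tendsto (fun k => ∫ p, |Hc k p.2 * f p - f p|) atTop (nhds 0) := by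
  have : Tendsto (fun k => ∫ p, |Hc k p.2 * f p - f p|) atTop (nhds (∫ _ : Spc n × ℝ, (0:ℝ))) := by
    refine tendsto_integral_of_dominated_convergence (fun p => |f p|) ?_ hf.abs ?_ ?_
    · intro k
      have h1 : AEStronglyMeasurable (fun p : Spc n × ℝ => Hc k p.2) volume :=
        ((Hc_smooth k).continuous.comp continuous_snd).aestronglyMeasurable
      exact ((h1.mul hf.1).sub hf.1).norm
    · intro k
      refine Eventually.of_forall fun p => ?_
      have e : Hc k p.2 * f p - f p = -((1 - Hc k p.2) * f p) := by ring
      rw [Real.norm_eq_abs, abs_abs, e, abs_neg, abs_mul, abs_of_nonneg (by linarith [Hc_le_one k p.2])]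
      have := Hc_nonneg k p.2
      nlinarith [abs_nonneg (f p)]
    · filter_upwards [h0] with p hp
      rcases le_or_gt p.2 0 with h | h
      · simp [hp h]
      · refine tendsto_const_nhds.congr' ?_
        filter_upwards [Hc_tendsto h] with k hk
        simp [hk]
  simpa using this

lemma ae_ne_zero {n : ℕ} : ∀ᵐ p : Spc n × ℝ, p ≠ 0 := by
  simp [ae_iff]

lemma exists_param {n : ℕ} {r : ℝ} (hr : 0 < r) (hr1 : r < 1) :
    ∃ (Γ ω : Spc n × ℝ → ℝ) (Γe : ℕ → Spc n × ℝ → ℝ) (G : Fin n → Spc n × ℝ → ℝ), Param r Γ ω Γe G := by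
  let ζ : ContDiffBump (0 : Spc n × ℝ) := ⟨r / 2, r, by positivity, by linarith⟩
  have hζs : Smooth (n := n) ζ := ζ.contDiff
  have hζ0 : ∀ p : Spc n × ℝ, r < ‖p‖ → ζ p = 0 := fun p hp =>
    ζ.zero_of_le_dist (by rw [dist_zero_right]; exact hp.le)
  have hζabs : ∀ q, |ζ q| ≤ 1 := fun q => by rw [abs_of_nonneg ζ.nonneg]; exact ζ.le_one
  have hζ1 : ∀ᶠ p in nhds (0 : Spc n × ℝ), ζ p = 1 := ζ.eventuallyEq_one
  let W : Spc n × ℝ → ℝ := fun p => ζ p * hk p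
  let R : Spc n × ℝ → ℝ := fun p => hk p - W p
  have hWs : ∀ p ≠ 0, ContDiffAt ℝ (⊤ : ℕ∞) W p := fun p hp => hζs.contDiffAt.mul (hk_smoothAt hp)
  have hRs : Smooth R := by
    rw [Smooth, contDiff_iff_contDiffAt]
    intro p
    by_cases hp : p = 0
    · subst hp
      have : R =ᶠ[nhds 0] fun _ => 0 := by
        filter_upwards [hζ1] with q hq
        simp [R, W, hq]
      exact contDiffAt_const.congr_of_eventuallyEq this
    · exact (hk_smoothAt hp).sub (hWs p hp)
  have hLW : ∀ p ≠ 0, Lop W p = - Lop R p := by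
    intro p hp
    have := Lop_sub (hk_smoothAt hp) (hWs p hp)
    rw [hk_Lop hp] at this
    show _ = - Lop (fun q => hk q - W q) p
    rw [this]; ring
  let ω : Spc n × ℝ → ℝ := fun p => - Lop R p
  have hωs : Smooth ω := hRs.Lop.neg
  have hW0 : ∀ p, r < ‖p‖ → W p = 0 := fun p hp => by simp [W, hζ0 p hp]
  have hW0' : ∀ p, r < ‖p‖ → W =ᶠ[nhds p] fun _ => 0 := fun p hp => by
    filter_upwards [(isOpen_lt continuous_const continuous_norm).mem_nhds hp] with q hq
    exact hW0 q hq
  have hne : ∀ p : Spc n × ℝ, r < ‖p‖ → p ≠ 0 := fun p hp h => by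
    rw [h, norm_zero] at hp; linarith
  have hω0 : ∀ p, r < ‖p‖ → ω p = 0 := by
    intro p hp
    show - Lop R p = 0
    rw [← hLW p (hne p hp), (Lop_congr (hW0' p hp)).eq_of_nhds, Lop_zero]
  have hωsupp := tsupp_of_zero hω0
  have hωneg : ∀ᵐ p : Spc n × ℝ, p.2 ≤ 0 → ω p = 0 := by
    have hneg : ∀ p : Spc n × ℝ, p.2 < 0 → ω p = 0 := by
      intro p hp
      have : R =ᶠ[nhds p] fun _ => 0 := by
        filter_upwards [(isOpen_lt continuous_snd continuous_const).mem_nhds hp] with q hq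
        simp [R, W, hk_zero_of_nonpos (le_of_lt hq)]
      show - Lop R p = 0
      rw [(Lop_congr this).eq_of_nhds, Lop_zero]; simp
    refine Eventually.of_forall fun p hp => ?_
    have hcl : IsClosed {p : Spc n × ℝ | ω p = 0} := isClosed_eq hωs.continuous continuous_const
    have hmem : p ∈ closure {p : Spc n × ℝ | p.2 < 0} := by
      have ht : Tendsto (fun s : ℝ => (p.1, p.2 - s)) (nhdsWithin 0 (Ioi 0)) (nhds p) := by
        have : Tendsto (fun s : ℝ => (p.1, p.2 - s)) (nhds 0) (nhds (p.1, p.2 - 0)) :=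
          (by fun_prop : Continuous fun s : ℝ => (p.1, p.2 - s)).tendsto 0
        simpa using this.mono_left nhdsWithin_le_nhds
      refine mem_closure_of_tendsto ht ?_
      filter_upwards [self_mem_nhdsWithin] with s hs
      have : 0 < s := hs
      show p.2 - s < 0
      linarith
    exact closure_minimal (fun p hp => hneg p hp) hcl hmem
  -- norms
  have hlt : ∀ p : Spc n × ℝ, ¬ r < ‖p‖ → p.2 < 1 := fun p hp => by
    have h1 : |p.2| ≤ ‖p‖ := by rw [← Real.norm_eq_abs]; exact norm_snd_le p
    have := le_abs_self p.2
    linarith [not_lt.1 hp]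
  have hWint : Integrable W := by
    refine dm_int.mono' (hζs.continuous.measurable.mul hk_measurable).aestronglyMeasurable
      (Eventually.of_forall fun p => ?_)
    by_cases hp : r < ‖p‖
    · rw [hW0 p hp, norm_zero]; exact dm_nonneg p
    · simp only [W]
      rw [norm_mul, Real.norm_eq_abs, Real.norm_of_nonneg (hk_nonneg p)]
      calc _ ≤ 1 * hk p := mul_le_mul_of_nonneg_right (hζabs p) (hk_nonneg p)
        _ ≤ _ := by rw [one_mul]; exact hk_le_dm (hlt p hp)
  let G : Fin n → Spc n × ℝ → ℝ := fun i => dd (eX i) W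
  have hGeq : ∀ i, ∀ p ≠ 0, G i p = ζ p * dd (eX i) hk p + hk p * dd (eX i) ζ p := by
    intro i p hp
    exact dd_mul (hζs.differentiable p) (smoothAt_diff (hk_smoothAt hp)) _
  have hGint : ∀ i, Integrable (G i) := by
    intro i
    obtain ⟨C, hC⟩ : ∃ C, ∀ p, ‖dd (eX i) ζ p‖ ≤ C := by
      have hcs : HasCompactSupport (ζ : Spc n × ℝ → ℝ) := ζ.hasCompactSupport
      exact (hcs.dd (eX i)).exists_bound_of_continuous (hζs.dd _).continuous
    have hm : AEStronglyMeasurable (G i) volume :=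
      (measurable_fderiv_apply_const ℝ W (eX i)).aestronglyMeasurable
    refine (dm_int.const_mul (1 + C)).mono' hm ?_
    filter_upwards [ae_ne_zero] with p hp
    have hC0 : 0 ≤ C := (norm_nonneg _).trans (hC 0)
    by_cases hpr : r < ‖p‖
    · have : G i p = 0 := by
        show dd (eX i) W p = 0
        rw [(dd_congr (hW0' p hpr) _).eq_of_nhds, dd_zero]
      rw [this, norm_zero]
      exact mul_nonneg (by linarith) (dm_nonneg p)
    · rw [hGeq i p hp]
      have h1 := hk_dx_le_dm hp (hlt p hpr) i
      have h2 := hk_le_dm (hlt p hpr)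
      have h3 : |ζ p * dd (eX i) hk p| ≤ 1 * dm p := by
        rw [abs_mul]; exact mul_le_mul (hζabs p) h1 (abs_nonneg _) zero_le_one
      have h4 : |hk p * dd (eX i) ζ p| ≤ dm p * C := by
        rw [abs_mul, abs_of_nonneg (hk_nonneg p)]
        exact mul_le_mul h2 (hC p) (abs_nonneg _) (dm_nonneg p)
      rw [Real.norm_eq_abs]
      refine (abs_add_le _ _).trans ?_
      linarith
  let Γe : ℕ → Spc n × ℝ → ℝ := fun k p => Hc k p.2 * W p
  have hkpos : ∀ k : ℕ, (0:ℝ) < k + 1 := fun k => by positivity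
  have he0 : ∀ k, Γe k =ᶠ[nhds 0] fun _ => 0 := by
    intro k
    have : {p : Spc n × ℝ | p.2 * ((k:ℝ) + 1) < 1} ∈ nhds (0 : Spc n × ℝ) :=
      (isOpen_lt (by fun_prop) continuous_const).mem_nhds (by simp)
    filter_upwards [this] with p hp
    simp [Γe, Hc_zero (le_of_lt hp)]
  have hes : ∀ k, Smooth (Γe k) := by
    intro k
    rw [Smooth, contDiff_iff_contDiffAt]
    intro p
    by_cases hp : p = 0
    · subst hp; exact contDiffAt_const.congr_of_eventuallyEq (he0 k)
    · exact (((Hc_smooth k).comp contDiff_snd).contDiffAt).mul (hWs p hp)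
  have hL : ∀ k, Lop (Γe k) = fun p => Hc k p.2 * ω p + deriv (Hc k) p.2 * (ζ p * hk p) := by
    intro k
    funext p
    by_cases hp : p = 0
    · subst hp
      rw [(Lop_congr (he0 k)).eq_of_nhds, Lop_zero]
      have : Hc k (0 : Spc n × ℝ).2 = 0 := Hc_zero (by simp)
      rw [this, Hd_zero_left (by simp)]; simp
    · rw [Lop_time_mul (Hc_smooth k) (hWs p hp), hLW p hp]
  have hωint : Integrable ω := hωs.continuous.integrable_of_hasCompactSupport (hc_of_tsupp hωsupp)
  refine ⟨W, ω, Γe, G, hωs, hωsupp, hes, fun k => tsupp_of_zero fun p hp => by simp [Γe, hW0 p hp],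
    hWint, hW0, ?_, hGint, ?_, ?_⟩
  · refine Hc_dct hWint (Eventually.of_forall fun p hp => ?_)
    simp [W, hk_zero_of_nonpos hp]
  · intro i
    have h0 : ∀ᵐ p : Spc n × ℝ, p.2 ≤ 0 → G i p = 0 := by
      filter_upwards [ae_ne_zero] with p hp h
      rw [hGeq i p hp, hk_dx_nonpos hp h, hk_zero_of_nonpos h]; simp
    refine (Hc_dct (hGint i) h0).congr fun k => integral_congr_ae ?_
    filter_upwards [ae_ne_zero] with p hp
    have : dd (eX i) (Γe k) p = Hc k p.2 * G i p := by
      show dd (eX i) (fun q => Hc k q.2 * W q) p = _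
      have hd : DifferentiableAt ℝ (fun q : Spc n × ℝ => Hc k q.2) p :=
        ((Hc_smooth k).differentiable (by simp)).comp differentiable_snd p
      rw [dd_mul hd (smoothAt_diff (hWs p hp)),
        dd_time ((Hc_smooth k).differentiable (by simp))]
      simp [eX, G]
    rw [this]
  · intro u M p hu hM hc
    have h1 := approx_id hu hM hc hζs.continuous (by simpa using hζ1.self_of_nhds) hζabs
    have hub : ∀ f : Spc n × ℝ → ℝ, Integrable f → Integrable (fun q => u (p - q) * f q) := fun f hf =>
      hf.bdd_mul (c := M) (hu.comp (measurable_const.sub measurable_id)).aestronglyMeasurable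
        (Eventually.of_forall fun q => hM _)
    have hHω : ∀ k, Integrable (fun q : Spc n × ℝ => Hc k q.2 * ω q) := fun k =>
      hωint.bdd_mul (c := 1) ((Hc_smooth k).continuous.comp continuous_snd).aestronglyMeasurable
        (Eventually.of_forall fun q => by
          rw [Real.norm_of_nonneg (Hc_nonneg k _)]; exact Hc_le_one k _)
    have h2 : Tendsto (fun k => cv u (fun q => Hc k q.2 * ω q) p) atTop (nhds (cv u ω p)) := by
      have := (Hc_dct hωint hωneg).const_mul M
      rw [mul_zero] at this
      rw [tendsto_iff_dist_tendsto_zero]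
      refine squeeze_zero (fun _ => dist_nonneg) (fun k => ?_) this
      rw [Real.dist_eq, cv_eq, cv_eq, ← integral_sub (hub _ (hHω k)) (hub _ hωint), ← integral_const_mul]
      refine norm_integral_le_of_norm_le (f := fun a => u (p - a) * (Hc k a.2 * ω a) - u (p - a) * ω a)
        (g := fun a => M * |Hc k a.2 * ω a - ω a|)
        (((hHω k).sub hωint).abs.const_mul M) (Eventually.of_forall fun q => ?_)
      rw [← mul_sub, norm_mul]
      exact mul_le_mul_of_nonneg_right (hM _) (norm_nonneg _)
    have h3 : ∀ k, cv u (Lop (Γe k)) p =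
        cv u (fun q => deriv (Hc k) q.2 * (ζ q * hk q)) p + cv u (fun q => Hc k q.2 * ω q) p := by
      intro k
      have hLi : Integrable (Lop (Γe k)) := by
        refine (hes k).Lop.continuous.integrable_of_hasCompactSupport (hc_of_tsupp (r := r) (tsupp_of_zero fun p hp => ?_))
        rw [hL k]; simp [hω0 p hp, hζ0 p hp]
      have e : (fun q : Spc n × ℝ => deriv (Hc k) q.2 * (ζ q * hk q)) = fun q => Lop (Γe k) q - Hc k q.2 * ω q := by
        funext q; rw [hL k]; ring
      rw [e, cv_eq, cv_eq, cv_eq, ← integral_add (hub (fun q => Lop (Γe k) q - Hc k q.2 * ω q) (hLi.sub (hHω k))) (hub _ (hHω k))]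
      refine integral_congr_ae (Eventually.of_forall fun q => ?_)
      simp only; ring
    simp only [h3]
    exact h1.add h2

/-- bounded measurable -/
structure Bd {n : ℕ} (u : Spc n × ℝ → ℝ) (M : ℝ) : Prop where
  meas : Measurable u
  bdd : ∀ q, |u q| ≤ M

lemma Bd.locInt {n : ℕ} {u : Spc n × ℝ → ℝ} {M : ℝ} (h : Bd u M) : LocallyIntegrable u volume :=
  (locallyIntegrable_const M).mono h.meas.aestronglyMeasurable
    (Eventually.of_forall fun q => by
      rw [Real.norm_eq_abs]; exact (h.bdd q).trans (le_abs_self M))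

lemma Bd.nonneg {n : ℕ} {u : Spc n × ℝ → ℝ} {M : ℝ} (h : Bd u M) : 0 ≤ M :=
  (abs_nonneg _).trans (h.bdd 0)

lemma Bd.cv_int {n : ℕ} {u f : Spc n × ℝ → ℝ} {M : ℝ} (h : Bd u M) (hf : Integrable f) (p : Spc n × ℝ) :
    Integrable fun q => u q * f (p - q) :=
  (hf.comp_sub_left p).bdd_mul (c := M) h.meas.aestronglyMeasurable (Eventually.of_forall h.bdd)

lemma Bd.cv_dist {n : ℕ} {u f g : Spc n × ℝ → ℝ} {M : ℝ} (h : Bd u M) (hf : Integrable f)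
    (hg : Integrable g) (p : Spc n × ℝ) :
    |cv u f p - cv u g p| ≤ M * ∫ q, |f q - g q| := by
  unfold cv
  rw [← integral_sub (h.cv_int hf p) (h.cv_int hg p),
    ← integral_sub_left_eq_self (fun q => |f q - g q|) volume p, ← integral_const_mul]
  refine norm_integral_le_of_norm_le (f := fun q => u q * f (p - q) - u q * g (p - q))
    (g := fun q => M * |f (p - q) - g (p - q)|) ?_ (Eventually.of_forall fun q => ?_)
  · exact (((hf.sub hg).comp_sub_left p).abs).const_mul M
  · rw [← mul_sub, norm_mul]
    exact mul_le_mul_of_nonneg_right (h.bdd q) (norm_nonneg _)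

lemma cv_conv {n : ℕ} (u f : Spc n × ℝ → ℝ) :
    cv u f = convolution u f (ContinuousLinearMap.mul ℝ ℝ) volume := by
  funext p; rfl

lemma cv_smooth {n : ℕ} {u f : Spc n × ℝ → ℝ} {M : ℝ} (h : Bd u M) (hf : Smooth f)
    (hc : HasCompactSupport f) : Smooth (cv u f) := by
  rw [cv_conv]
  exact hc.contDiff_convolution_right _ h.locInt hf

lemma cv_dd {n : ℕ} {u f : Spc n × ℝ → ℝ} {M : ℝ} (h : Bd u M) (hf : Smooth f)
    (hc : HasCompactSupport f) (v : Spc n × ℝ) : dd v (cv u f) = cv u (dd v f) := by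
  funext p
  have h1 : ContDiff ℝ 1 f := hf.of_le (by norm_cast)
  have h2 := hc.hasFDerivAt_convolution_right (ContinuousLinearMap.mul ℝ ℝ) h.locInt h1 p
  show fderiv ℝ (cv u f) p v = _
  rw [cv_conv, h2.fderiv, convolution_precompR_apply _ h.locInt (hc.fderiv ℝ) (h1.continuous_fderiv one_ne_zero)]
  rw [cv_conv]
  rfl

lemma hcs_dd {n : ℕ} {f : Spc n × ℝ → ℝ} (hc : HasCompactSupport f) (v : Spc n × ℝ) :
    HasCompactSupport (dd v f) := hc.dd v

lemma sm_int {n : ℕ} {f : Spc n × ℝ → ℝ} (hf : Smooth f) (hc : HasCompactSupport f) : Integrable f :=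
  hf.continuous.integrable_of_hasCompactSupport hc

lemma cv_Lop {n : ℕ} {u f : Spc n × ℝ → ℝ} {M : ℝ} (h : Bd u M) (hf : Smooth f)
    (hc : HasCompactSupport f) : Lop (cv u f) = cv u (Lop f) := by
  funext p
  unfold Lop
  simp only [cv_dd h hf hc, cv_dd h (hf.dd _) (hcs_dd hc _)]
  unfold cv
  simp only [mul_sub, Finset.mul_sum]
  rw [integral_sub (h.cv_int (sm_int (hf.dd _) (hcs_dd hc _)) p)
    (integrable_finsetSum _ fun i _ => h.cv_int (sm_int ((hf.dd _).dd _) (hcs_dd (hcs_dd hc _) _)) p),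
    integral_finsetSum _ fun i _ => h.cv_int (sm_int ((hf.dd _).dd _) (hcs_dd (hcs_dd hc _) _)) p]

lemma dd_refl {n : ℕ} {f : Spc n × ℝ → ℝ} (hf : Smooth f) (p v : Spc n × ℝ) :
    dd v (fun q => f (p - q)) = fun q => - dd v f (p - q) := by
  funext q
  unfold dd
  have h1 : HasFDerivAt (fun q => p - q) (-(ContinuousLinearMap.id ℝ (Spc n × ℝ))) q :=
    (hasFDerivAt_id q).const_sub p
  have := ((hf.differentiable (p - q)).hasFDerivAt).comp q h1
  have e : HasFDerivAt (fun q => f (p - q)) _ q := this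
  rw [e.fderiv]; simp

lemma refl_smooth {n : ℕ} {f : Spc n × ℝ → ℝ} (hf : Smooth f) (p : Spc n × ℝ) :
    Smooth (fun q => f (p - q)) := hf.comp (contDiff_const.sub contDiff_id)

lemma dd_neg {n : ℕ} (f : Spc n × ℝ → ℝ) (v : Spc n × ℝ) :
    dd v (fun q => - f q) = fun q => - dd v f q := by
  funext q; unfold dd; rw [fderiv_fun_neg]; simp

lemma Ladj_refl {n : ℕ} {f : Spc n × ℝ → ℝ} (hf : Smooth f) (p : Spc n × ℝ) :
    Ladj (fun q => f (p - q)) = fun q => Lop f (p - q) := by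
  funext q
  unfold Ladj Lop
  simp only [dd_refl hf, dd_neg, dd_refl (hf.dd _), neg_neg]

lemma represent {n : ℕ} {u g Γ ω : Spc n × ℝ → ℝ} {Γe : ℕ → Spc n × ℝ → ℝ}
    {G : Fin n → Spc n × ℝ → ℝ} {M M' r : ℝ} {Ω : Set (Spc n × ℝ)} (hP : Param r Γ ω Γe G)
    (hu : Bd u M) (hg : Bd g M') (hw : WeakEq u g Ω) {p : Spc n × ℝ} (hp : closedBall p r ⊆ Ω)
    (hc : ContinuousAt u p) : u p = cv g Γ p - cv u ω p := by
  have h1 := hP.lim u M p hu.meas hu.bdd hc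
  have hcs := fun k => hc_of_tsupp (hP.e_supp k)
  have h2 : ∀ k, cv u (Lop (Γe k)) p = cv g (Γe k) p := by
    intro k
    have hz : ∀ q, q ∉ closedBall p r → Γe k (p - q) = 0 := by
      intro q hq
      by_contra h
      have := hP.e_supp k (subset_tsupport _ h)
      rw [mem_closedBall_zero_iff, ← dist_eq_norm, dist_comm] at this
      exact hq this
    have hts : tsupport (fun q => Γe k (p - q)) ⊆ closedBall p r := by
      refine closure_minimal (fun q hq => ?_) isClosed_closedBall
      by_contra h
      exact hq (hz q h)
    have := hw (fun q => Γe k (p - q)) (refl_smooth (hP.e_smooth k) p)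
      ((isCompact_closedBall p r).of_isClosed_subset (isClosed_tsupport _) hts) (hts.trans hp)
    rw [Ladj_refl (hP.e_smooth k)] at this
    exact this
  have h3 : Tendsto (fun k => cv g (Γe k) p) atTop (nhds (cv g Γ p)) := by
    have := hP.Γ_lim.const_mul M'
    rw [mul_zero] at this
    rw [tendsto_iff_dist_tendsto_zero]
    exact squeeze_zero (fun _ => dist_nonneg)
      (fun k => hg.cv_dist (sm_int (hP.e_smooth k) (hcs k)) hP.Γ_int p) this
  simp only [h2] at h1
  linarith [tendsto_nhds_unique h1 h3]

lemma cv_cont_of_lim {n : ℕ} {g Γ : Spc n × ℝ → ℝ} {f : ℕ → Spc n × ℝ → ℝ} {M : ℝ} (hg : Bd g M)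
    (hf : ∀ k, Smooth (f k)) (hfc : ∀ k, HasCompactSupport (f k)) (hΓ : Integrable Γ)
    (hl : Tendsto (fun k => ∫ p, |f k p - Γ p|) atTop (nhds 0)) : Continuous (cv g Γ) := by
  have h1 : TendstoUniformly (fun k => cv g (f k)) (cv g Γ) atTop := by
    rw [Metric.tendstoUniformly_iff]
    intro ε hε
    have := hl.const_mul M
    rw [mul_zero] at this
    filter_upwards [this.eventually_lt_const hε] with k hk p
    rw [dist_comm, Real.dist_eq]
    exact (hg.cv_dist (sm_int (hf k) (hfc k)) hΓ p).trans_lt hk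
  exact h1.continuous (Eventually.of_forall fun k => (cv_smooth hg (hf k) (hfc k)).continuous).frequently

/-- coordinate form -/
def prj {n : ℕ} (i : Fin n) : Spc n →L[ℝ] ℝ := EuclideanSpace.proj i

/-- the linear form with given coefficients -/
def lf {n : ℕ} (a : Fin n → ℝ) : Spc n →L[ℝ] ℝ :=
  ∑ i, a i • (prj i : Spc n →L[ℝ] ℝ)

lemma lf_apply {n : ℕ} (a : Fin n → ℝ) (y : Spc n) : lf a y = ∑ i, a i * y i := by
  simp [lf, prj]

lemma lf_grad {n : ℕ} {f : Spc n → ℝ} {a : Fin n → ℝ} {x : Spc n} :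
    HasGradientAt f (WithLp.toLp 2 a) x ↔ HasFDerivAt f (lf a) x := by
  rw [hasGradientAt_iff_hasFDerivAt]
  have : (InnerProductSpace.toDual ℝ (Spc n)) (WithLp.toLp 2 a) = lf a := by
    ext y
    rw [lf_apply, InnerProductSpace.toDual_apply_apply, PiLp.inner_apply]
    simp [mul_comm]
  rw [this]

lemma slice_deriv {n : ℕ} {F : Spc n × ℝ → ℝ} {p : Spc n × ℝ} (hF : DifferentiableAt ℝ F p) :
    HasFDerivAt (fun y => F (y, p.2)) (lf fun i => dd (eX i) F p) p.1 := by
  have h1 : HasFDerivAt (fun y : Spc n => (y, p.2)) (ContinuousLinearMap.inl ℝ (Spc n) ℝ) p.1 :=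
    hasFDerivAt_prodMk_left p.1 p.2
  have h2 : HasFDerivAt (fun y => F (y, p.2)) _ p.1 := HasFDerivAt.comp p.1 (g := F) (f := fun y : Spc n => (y, p.2)) hF.hasFDerivAt h1
  have key : (lf fun i => dd (eX i) F p) = (fderiv ℝ F p).comp (ContinuousLinearMap.inl ℝ (Spc n) ℝ) := ?_
  · rw [key]; exact h2
  refine ContinuousLinearMap.ext fun y => ?_
  rw [lf_apply]
  have hy : (y, (0:ℝ)) = ∑ i, y i • (eX i : Spc n × ℝ) := by
    refine Prod.ext ?_ ?_
    · simp only [Prod.fst_sum, Prod.smul_fst, eX]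
      ext j
      simp [Pi.single_apply]
    · simp [Prod.snd_sum, eX]
  simp only [ContinuousLinearMap.comp_apply, ContinuousLinearMap.inl_apply]
  rw [hy, map_sum]
  refine Finset.sum_congr rfl fun i _ => ?_
  rw [map_smul, smul_eq_mul, mul_comm]; rfl

lemma cv_grad {n : ℕ} {g Γ ω : Spc n × ℝ → ℝ} {Γe : ℕ → Spc n × ℝ → ℝ}
    {G : Fin n → Spc n × ℝ → ℝ} {M r : ℝ} (hP : Param r Γ ω Γe G) (hg : Bd g M) (p : Spc n × ℝ) :
    HasFDerivAt (fun y => cv g Γ (y, p.2)) (lf fun i => cv g (G i) p) p.1 := by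
  have hcs := fun k => hc_of_tsupp (hP.e_supp k)
  have h1 : TendstoUniformly (fun k (y : Spc n) => lf fun i => cv g (dd (eX i) (Γe k)) (y, p.2))
      (fun y => lf fun i => cv g (G i) (y, p.2)) atTop := by
    rw [Metric.tendstoUniformly_iff]
    intro ε hε
    have h2 : Tendsto (fun k => ∑ i, M * (∫ q, |dd (eX i) (Γe k) q - G i q|) *
        ‖(prj i : Spc n →L[ℝ] ℝ)‖) atTop (nhds 0) := by
      have : Tendsto (fun k => ∑ i, M * (∫ q, |dd (eX i) (Γe k) q - G i q|) *
        ‖(prj i : Spc n →L[ℝ] ℝ)‖) atTop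
        (nhds (∑ i : Fin n, M * 0 * ‖(prj i : Spc n →L[ℝ] ℝ)‖)) :=
        tendsto_finsetSum _ fun i _ => ((hP.G_lim i).const_mul M).mul_const _
      simpa using this
    filter_upwards [h2.eventually_lt_const hε] with k hk y
    refine lt_of_le_of_lt ?_ hk
    rw [dist_comm, dist_eq_norm]
    unfold lf
    rw [← Finset.sum_sub_distrib]
    refine (norm_sum_le _ _).trans (Finset.sum_le_sum fun i _ => ?_)
    simp only []
    have e : ∀ a b : ℝ, ‖a • (prj i : Spc n →L[ℝ] ℝ) - b • prj i‖ = |a - b| * ‖(prj i : Spc n →L[ℝ] ℝ)‖ := by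
      intro a b
      have : a • (prj i : Spc n →L[ℝ] ℝ) - b • prj i = (a - b) • prj i := by
        ext y; simp [sub_mul]
      rw [this, norm_smul, Real.norm_eq_abs]
    rw [e]
    refine mul_le_mul_of_nonneg_right ?_ (norm_nonneg _)
    exact hg.cv_dist (sm_int ((hP.e_smooth k).dd _) (hcs_dd (hcs k) _)) (hP.G_int i) _
  refine hasFDerivAt_of_tendstoUniformly (f := fun k y => cv g (Γe k) (y, p.2)) h1 ?_ ?_ p.1
  · intro k y
    have := slice_deriv (p := (y, p.2)) ((cv_smooth hg (hP.e_smooth k) (hcs k)).differentiable (y, p.2))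
    simpa only [cv_dd hg (hP.e_smooth k) (hcs k)] using this
  · intro y
    have := hP.Γ_lim.const_mul M
    rw [mul_zero] at this
    rw [tendsto_iff_dist_tendsto_zero]
    exact squeeze_zero (fun _ => dist_nonneg)
      (fun k => hg.cv_dist (sm_int (hP.e_smooth k) (hcs k)) hP.Γ_int _) this

lemma int_dd_zero {n : ℕ} {f : Spc n × ℝ → ℝ} (hf : Smooth f) (hc : HasCompactSupport f) (v : Spc n × ℝ) :
    ∫ q, dd v f q = 0 := by
  have h1 : Bd (fun _ : Spc n × ℝ => (1:ℝ)) 1 := ⟨measurable_const, fun _ => by simp⟩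
  have h2 : ∀ f : Spc n × ℝ → ℝ, cv (fun _ => (1:ℝ)) f = fun _ => ∫ q, f q := by
    intro f; funext p; rw [cv_eq]; simp
  have := congrFun (cv_dd h1 hf hc v) 0
  rw [h2, h2] at this
  simp only [dd, fderiv_fun_const] at this ⊢
  simpa using this.symm

lemma weak_one {n : ℕ} : WeakEq (fun _ : Spc n × ℝ => (1:ℝ)) (fun _ => 0) univ := by
  intro φ hφ hc _
  simp only [one_mul, zero_mul, integral_zero]
  unfold Ladj
  have i1 := fun i => sm_int ((hφ.dd (eX i)).dd (eX i)) (hcs_dd (hcs_dd hc (eX i)) (eX i))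
  have i0 : Integrable (fun q => - dd eT φ q) := (sm_int (hφ.dd _) (hcs_dd hc _)).neg
  rw [integral_sub i0 (integrable_finsetSum _ fun i _ => i1 i),
    integral_neg, integral_finsetSum _ fun i _ => i1 i, int_dd_zero hφ hc]
  simp [int_dd_zero (hφ.dd _) (hcs_dd hc _)]

lemma int_omega {n : ℕ} {Γ ω : Spc n × ℝ → ℝ} {Γe : ℕ → Spc n × ℝ → ℝ}
    {G : Fin n → Spc n × ℝ → ℝ} {r : ℝ} (hP : Param r Γ ω Γe G) : ∫ q, ω q = -1 := by
  have h1 : Bd (fun _ : Spc n × ℝ => (1:ℝ)) 1 := ⟨measurable_const, fun _ => by simp⟩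
  have h0 : Bd (fun _ : Spc n × ℝ => (0:ℝ)) 1 := ⟨measurable_const, fun _ => by simp⟩
  have := represent hP h1 h0 weak_one (p := 0) (subset_univ _) continuousAt_const
  rw [cv_eq, cv_eq] at this
  simp at this
  linarith

section final
variable {n : ℕ} {ψ u : Spc n × ℝ → ℝ} {c S M C C₁ C₂ : ℝ}

lemma Sol.contAt (hs : Sol ψ c S M C C₁ C₂ u) {p : Spc n × ℝ} (hx : ‖p.1‖ < 1)
    (ht : p.2 ∈ Ioo 0 S) (hc : ContinuousAt (fun t => u (p.1, t)) p.2) : ContinuousAt u p := by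
  rw [Metric.continuousAt_iff] at hc ⊢
  intro ε hε
  obtain ⟨δ', hδ', h1⟩ := hc ε hε
  obtain ⟨h0, hS⟩ := ht
  obtain ⟨δ, hδ, hd1, hd2, hd3⟩ : ∃ δ > 0, δ < δ' ∧ δ ≤ p.2 ∧ p.2 + δ ≤ S :=
    ⟨min (δ' / 2) (min p.2 (S - p.2)), by
      refine lt_min (by positivity) (lt_min h0 (by linarith)),
      (min_le_left _ _).trans_lt (by linarith), (min_le_right _ _).trans (min_le_left _ _), by
      have := (min_le_right (δ' / 2) (min p.2 (S - p.2))).trans (min_le_right _ _)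
      linarith⟩
  have hup := h1 (x := p.2 + δ) (by rw [Real.dist_eq]; simpa [abs_of_pos hδ] using hd1)
  have hlo := h1 (x := p.2 - δ) (by rw [Real.dist_eq]; simpa [abs_of_pos hδ] using hd1)
  rw [Real.dist_eq, abs_lt] at hup hlo
  have hC1 := hs.hC1
  refine ⟨min (δ / (2 * (C₁ + 1))) (min (δ / 2) (1 - ‖p.1‖)), ?_, ?_⟩
  · refine lt_min (by positivity) (lt_min (by positivity) (by linarith))
  · rintro ⟨y, τ⟩ hq
    rw [dist_eq_norm, Prod.norm_def, lt_min_iff, lt_min_iff] at hq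
    obtain ⟨hq1, hq2, hq3⟩ := hq
    have ha : ‖y - p.1‖ < δ / (2 * (C₁ + 1)) := (le_max_left _ _).trans_lt hq1
    have hb : |τ - p.2| < δ / 2 := (le_max_right _ _).trans_lt hq2
    have hd : ‖y - p.1‖ < 1 - ‖p.1‖ := (le_max_left _ _).trans_lt hq3
    rw [abs_lt] at hb
    have hy : ‖y‖ ≤ 1 := by
      have := norm_add_le (y - p.1) p.1
      rw [sub_add_cancel] at this; linarith
    have hCy : C₁ * ‖y - p.1‖ < δ / 2 := by
      rw [lt_div_iff₀ (by positivity)] at ha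
      nlinarith [norm_nonneg (y - p.1)]
    have e1 := hs.cone p.1 y τ (p.2 + δ) hx.le hy (by linarith) hd3 (by
      rw [norm_sub_rev]; linarith)
    have e2 := hs.cone y p.1 (p.2 - δ) τ hy hx.le (by linarith) (by linarith) (by linarith)
    have e3 : u p = u (p.1, p.2) := rfl
    rw [Real.dist_eq, abs_lt, e3]
    constructor <;> linarith [hup.1, hup.2, hlo.1, hlo.2]

lemma Sol.dense (hs : Sol ψ c S M C C₁ C₂ u) (hc : 0 < c) (x : Spc n) (hx : ‖x‖ < 1) :
    Dense {t : ℝ | t ∈ Ioo 0 S → ContinuousAt u (x, t)} := by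
  rcases le_or_gt S 0 with hS | hS
  · have : {t : ℝ | t ∈ Ioo 0 S → ContinuousAt u (x, t)} = univ := by
      ext t; simp only [mem_setOf_eq, mem_univ, iff_true]
      rintro ⟨h1, h2⟩; linarith
    rw [this]; exact dense_univ
  set m : ℝ → ℝ := fun t => u (x, max 0 (min t S)) with hm
  have hmono : Monotone m := by
    intro a b hab
    have h1 : max 0 (min a S) ≤ max 0 (min b S) := max_le_max le_rfl (min_le_min hab le_rfl)
    have := hs.rate x (max 0 (min a S)) (max 0 (min b S)) (by linarith) (le_max_left _ _) h1
      (max_le hS.le (min_le_right _ _))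
    have h2 : 0 ≤ c * (max 0 (min b S) - max 0 (min a S)) := mul_nonneg hc.le (by linarith)
    simp only [hm]; linarith
  refine (hmono.countable_not_continuousAt.dense_compl ℝ).mono ?_
  intro t ht htI
  have ht' : ContinuousAt m t := by
    by_contra h; exact ht h
  refine hs.contAt (p := (x, t)) hx htI ?_
  refine ht'.congr ?_
  filter_upwards [Ioo_mem_nhds htI.1 htI.2] with s hs
  simp only [hm]
  rw [min_eq_left hs.2.le, max_eq_right hs.1.le]

lemma Sol.hu (hs : Sol ψ c S M C C₁ C₂ u) : Bd u M := ⟨hs.meas, hs.bdd⟩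

lemma Sol.hg (hs : Sol ψ c S M C C₁ C₂ u) : Bd (fun p => hv (u p)) 1 :=
  ⟨hv_measurable.comp hs.meas, fun q => by
    rw [abs_of_nonneg (hv_nonneg _)]; exact hv_le_one _⟩

lemma cv_cont_Γ {g Γ ω : Spc n × ℝ → ℝ} {Γe : ℕ → Spc n × ℝ → ℝ}
    {G : Fin n → Spc n × ℝ → ℝ} {M r : ℝ} (hP : Param r Γ ω Γe G) (hg : Bd g M) : Continuous (cv g Γ) :=
  cv_cont_of_lim hg hP.e_smooth (fun k => hc_of_tsupp (hP.e_supp k)) hP.Γ_int hP.Γ_lim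

lemma cv_cont_G {g Γ ω : Spc n × ℝ → ℝ} {Γe : ℕ → Spc n × ℝ → ℝ}
    {G : Fin n → Spc n × ℝ → ℝ} {M r : ℝ} (hP : Param r Γ ω Γe G) (hg : Bd g M) (i : Fin n) :
    Continuous (cv g (G i)) :=
  cv_cont_of_lim hg (fun k => (hP.e_smooth k).dd (eX i)) (fun k => hcs_dd (hc_of_tsupp (hP.e_supp k)) _)
    (hP.G_int i) (hP.G_lim i)

lemma Sol.rep (hs : Sol ψ c S M C C₁ C₂ u) (hc : 0 < c) {S' : ℝ} (hS' : S' < S)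
    {Γ ω : Spc n × ℝ → ℝ} {Γe : ℕ → Spc n × ℝ → ℝ} {G : Fin n → Spc n × ℝ → ℝ} {r : ℝ} (hr : 0 < r)
    (hP : Param r Γ ω Γe G) {p₀ : Spc n × ℝ}
    (hp₀ : closedBall p₀ (2 * r) ⊆ ball (0 : Spc n) 1 ×ˢ Ioo 0 S') {p : Spc n × ℝ} (hp : p ∈ ball p₀ r) :
    u p = cv (fun p => hv (u p)) Γ p - cv u ω p := by
  set R : Spc n × ℝ → ℝ := fun p => cv (fun p => hv (u p)) Γ p - cv u ω p with hR
  have hRc : Continuous R := (cv_cont_Γ hP hs.hg).sub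
    (cv_smooth hs.hu hP.ω_smooth (hc_of_tsupp hP.ω_supp)).continuous
  have hball : ∀ q ∈ ball p₀ r, closedBall q r ⊆ ball (0 : Spc n) 1 ×ˢ Ioo 0 S' := by
    intro q hq
    refine (closedBall_subset_closedBall' ?_).trans hp₀
    have := mem_ball.1 hq
    linarith
  have hcont : ∀ q ∈ ball p₀ r, ContinuousAt u q → u q = R q := fun q hq hcq =>
    represent hP hs.hu hs.hg (hs.weak S' hS') (hball q hq) hcq
  have hmem : ∀ q ∈ ball p₀ r, ‖q.1‖ < 1 ∧ q.2 ∈ Ioo 0 S := by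
    intro q hq
    have := hball q hq (mem_closedBall_self hr.le)
    exact ⟨mem_ball_zero_iff.1 this.1, this.2.1, this.2.2.trans hS'⟩
  obtain ⟨x, t⟩ := p
  obtain ⟨hx, ht⟩ := hmem _ hp
  have hd := hs.dense hc x hx
  have hline : Continuous fun s : ℝ => ((x, s) : Spc n × ℝ) := by fun_prop
  have hnb : ∀ᶠ s in nhds t, ((x, s) : Spc n × ℝ) ∈ ball p₀ r :=
    hline.continuousAt.eventually (isOpen_ball.mem_nhds hp)
  have hRt : Tendsto (fun s => R (x, s)) (nhds t) (nhds (R (x, t))) := (hRc.comp hline).tendsto t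
  refine le_antisymm ?_ ?_
  · by_contra h
    push Not at h
    have h1 := hnb.and (hRt.eventually_lt_const h)
    obtain ⟨δ, hδ, h2⟩ := Metric.eventually_nhds_iff.1 h1
    obtain ⟨s, hsd, hst⟩ := hd.exists_between (show t < t + δ by linarith)
    obtain ⟨h3, h4⟩ := h2 (y := s) (by rw [Real.dist_eq, abs_lt]; constructor <;> linarith [hst.1, hst.2])
    have h5 := hmem _ h3
    have h6 := hcont _ h3 (hsd h5.2)
    have h7 := hs.rate x t s (by linarith) ht.1.le hst.1.le h5.2.2.le
    have h8 : 0 ≤ c * (s - t) := mul_nonneg hc.le (by linarith [hst.1])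
    linarith
  · by_contra h
    push Not at h
    have h1 := hnb.and (hRt.eventually_const_lt h)
    obtain ⟨δ, hδ, h2⟩ := Metric.eventually_nhds_iff.1 h1
    obtain ⟨s, hsd, hst⟩ := hd.exists_between (show t - δ < t by linarith)
    obtain ⟨h3, h4⟩ := h2 (y := s) (by rw [Real.dist_eq, abs_lt]; constructor <;> linarith [hst.1, hst.2])
    have h5 := hmem _ h3
    have h6 := hcont _ h3 (hsd h5.2)
    have h7 := hs.rate x s t (by linarith) h5.2.1.le hst.2.le ht.2.le
    have h8 : 0 ≤ c * (t - s) := mul_nonneg hc.le (by linarith [hst.2])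
    linarith

lemma small_ball {Ω : Set (Spc n × ℝ)} {p : Spc n × ℝ} (h : Ω ∈ nhds p) :
    ∃ r, 0 < r ∧ r < 1 ∧ closedBall p (2 * r) ⊆ Ω := by
  obtain ⟨ε, hε, h1⟩ := Metric.nhds_basis_closedBall.mem_iff.1 h
  refine ⟨min (ε / 2) (1 / 2), by positivity, (min_le_right _ _).trans_lt (by norm_num), ?_⟩
  refine (closedBall_subset_closedBall ?_).trans h1
  linarith [min_le_left (ε / 2) (1 / 2)]

lemma isOpen_cyl (S' : ℝ) : IsOpen (ball (0 : Spc n) 1 ×ˢ Ioo 0 S') := isOpen_ball.prod isOpen_Ioo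

lemma Sol.contAt' (hs : Sol ψ c S M C C₁ C₂ u) (hc : 0 < c) {S' : ℝ} (hS' : S' < S) {p : Spc n × ℝ}
    (hp : p ∈ ball (0 : Spc n) 1 ×ˢ Ioo 0 S') : ContinuousAt u p := by
  obtain ⟨r, hr, hr1, hb⟩ := small_ball ((isOpen_cyl S').mem_nhds hp)
  obtain ⟨Γ, ω, Γe, G, hP⟩ := exists_param (n := n) hr hr1
  have hRc : Continuous (fun p => cv (fun p => hv (u p)) Γ p - cv u ω p) := (cv_cont_Γ hP hs.hg).sub
    (cv_smooth hs.hu hP.ω_smooth (hc_of_tsupp hP.ω_supp)).continuous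
  refine hRc.continuousAt.congr ?_
  filter_upwards [ball_mem_nhds p hr] with q hq
  exact (hs.rep hc hS' hr hP hb hq).symm

lemma Sol.grad (hs : Sol ψ c S M C C₁ C₂ u) (hc : 0 < c) {S' : ℝ} (hS' : S' < S) {p₀ : Spc n × ℝ}
    (hp : p₀ ∈ ball (0 : Spc n) 1 ×ˢ Ioo 0 S') :
    ∃ V : Spc n × ℝ → Spc n, Continuous V ∧ ∀ᶠ p in nhds p₀, HasGradientAt (fun y => u (y, p.2)) (V p) p.1 := by
  obtain ⟨r, hr, hr1, hb⟩ := small_ball ((isOpen_cyl S').mem_nhds hp)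
  obtain ⟨Γ, ω, Γe, G, hP⟩ := exists_param (n := n) hr hr1
  have hω := cv_smooth hs.hu hP.ω_smooth (hc_of_tsupp hP.ω_supp)
  refine ⟨fun p => WithLp.toLp 2 fun i => cv (fun p => hv (u p)) (G i) p - dd (eX i) (cv u ω) p, ?_, ?_⟩
  · refine (PiLp.continuous_toLp 2 _).comp (continuous_pi fun i => ?_)
    exact (cv_cont_G hP hs.hg i).sub (hω.dd _).continuous
  · filter_upwards [ball_mem_nhds p₀ hr] with p hp
    rw [lf_grad]
    have h1 := (cv_grad hP hs.hg p).sub (slice_deriv (hω.differentiable p))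
    have e : (lf fun i => cv (fun p => hv (u p)) (G i) p - dd (eX i) (cv u ω) p) =
        (lf fun i => cv (fun p => hv (u p)) (G i) p) - lf fun i => dd (eX i) (cv u ω) p := by
      refine ContinuousLinearMap.ext fun y => ?_
      simp only [ContinuousLinearMap.sub_apply, lf_apply, sub_mul, Finset.sum_sub_distrib]
    rw [e]
    refine h1.congr_of_eventuallyEq ?_
    have hline : Continuous fun y : Spc n => ((y, p.2) : Spc n × ℝ) := by fun_prop
    have : ∀ᶠ y in nhds p.1, ((y, p.2) : Spc n × ℝ) ∈ ball p₀ r :=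
      hline.continuousAt.eventually (isOpen_ball.mem_nhds hp)
    filter_upwards [this] with y hy
    exact hs.rep hc hS' hr hP hb hy

lemma Sol.smooth (hs : Sol ψ c S M C C₁ C₂ u) (hc : 0 < c) {S' : ℝ} (hS' : S' < S) {p₀ : Spc n × ℝ}
    (hp : p₀ ∈ ball (0 : Spc n) 1 ×ˢ Ioo 0 S') (h0 : u p₀ ≠ 0) :
    ∃ F : Spc n × ℝ → ℝ, Smooth F ∧ u =ᶠ[nhds p₀] F ∧ Lop F p₀ = hv (u p₀) := by
  have hcu := hs.contAt' hc hS' hp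
  have hγ : ∀ᶠ q in nhds p₀, hv (u q) = hv (u p₀) := by
    rcases lt_or_gt_of_ne h0 with h | h
    · filter_upwards [hcu.eventually_lt_const h] with q hq
      rw [hv, hv, if_neg hq.not_gt, if_neg h.not_gt]
    · filter_upwards [hcu.eventually_const_lt h] with q hq
      rw [hv, hv, if_pos hq, if_pos h]
  obtain ⟨r, hr, hr1, hb'⟩ := small_ball (inter_mem ((isOpen_cyl S').mem_nhds hp) hγ)
  have hb := hb'.trans inter_subset_left
  have hgb : ∀ q ∈ closedBall p₀ (2 * r), hv (u q) = hv (u p₀) := fun q hq => (hb' hq).2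
  obtain ⟨Γ, ω, Γe, G, hP⟩ := exists_param (n := n) hr hr1
  have hωc := hc_of_tsupp hP.ω_supp
  have hω := cv_smooth hs.hu hP.ω_smooth hωc
  set γ := hv (u p₀) with hγd
  have hconst : ∀ f : Spc n × ℝ → ℝ, (∀ q, r < ‖q‖ → f q = 0) → ∀ p ∈ ball p₀ r,
      cv (fun p => hv (u p)) f p = γ * ∫ q, f q := by
    intro f hf p hp
    rw [cv_eq, ← integral_const_mul]
    refine integral_congr_ae (Eventually.of_forall fun q => ?_)
    simp only
    by_cases hq : r < ‖q‖
    · rw [hf q hq]; simp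
    · rw [hgb]
      rw [mem_closedBall, dist_eq_norm]
      have h1 := norm_sub_le (p - p₀) q
      rw [mem_ball, dist_eq_norm] at hp
      have e : p - q - p₀ = p - p₀ - q := by abel
      rw [e]
      linarith [not_lt.1 hq]
  refine ⟨fun p => γ * (∫ q, Γ q) - cv u ω p, contDiff_const.sub hω, ?_, ?_⟩
  · filter_upwards [ball_mem_nhds p₀ hr] with p hp
    rw [hs.rep hc hS' hr hP hb hp, hconst Γ hP.Γ_zero p hp]
  · rw [Lop_sub contDiffAt_const hω.contDiffAt, cv_Lop hs.hu hP.ω_smooth hωc]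
    have e1 : Lop (fun _ : Spc n × ℝ => γ * ∫ q, Γ q) p₀ = 0 := by
      have hd : ∀ (v : Spc n × ℝ) (a : ℝ), dd v (fun _ => a) = fun _ => 0 := by
        intro v a; funext p; simp [dd]
      simp [Lop, hd]
    have hωz : ∀ q, r < ‖q‖ → ω q = 0 := fun q hq => by
      by_contra h
      have := hP.ω_supp (subset_tsupport _ h)
      rw [mem_closedBall_zero_iff] at this; linarith
    have hts : tsupport (fun q => ω (p₀ - q)) ⊆ closedBall p₀ r := by
      refine closure_minimal (fun q hq => ?_) isClosed_closedBall
      by_contra h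
      rw [mem_closedBall, dist_comm, dist_eq_norm, not_le] at h
      exact hq (hωz _ h)
    have hb2 : closedBall p₀ r ⊆ ball (0 : Spc n) 1 ×ˢ Ioo 0 S' :=
      (closedBall_subset_closedBall (by linarith)).trans hb
    have e2 := hs.weak S' hS' (fun q => ω (p₀ - q)) (refl_smooth hP.ω_smooth p₀)
      ((isCompact_closedBall p₀ r).of_isClosed_subset (isClosed_tsupport _) hts) (hts.trans hb2)
    rw [Ladj_refl hP.ω_smooth] at e2
    have e3 : cv u (Lop ω) p₀ = cv (fun p => hv (u p)) ω p₀ := e2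
    rw [e1, e3, hconst ω hωz p₀ (mem_ball_self hr), int_omega hP]
    ring

lemma Sol.ne_zero (hs : Sol ψ c S M C C₁ C₂ u) (hc : 0 < c) :
    ∀ᵐ p ∂(volume : Measure (Spc n × ℝ)), p ∈ ball (0 : Spc n) 1 ×ˢ Ioo 0 S → u p ≠ 0 := by
  set Z : Set (Spc n × ℝ) := (ball (0 : Spc n) 1 ×ˢ Ioo 0 S) ∩ {p | u p = 0} with hZ
  have hZm : MeasurableSet Z :=
    (measurableSet_ball.prod measurableSet_Ioo).inter (measurableSet_eq_fun hs.meas measurable_const)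
  have hZ0 : (volume : Measure (Spc n × ℝ)) Z = 0 := by
    rw [Measure.volume_eq_prod, Measure.measure_prod_null hZm]
    refine Eventually.of_forall fun x => ?_
    have hmain : ∀ t s, (x, t) ∈ Z → (x, s) ∈ Z → ¬ t < s := by
      rintro t s ⟨⟨hx, ht⟩, h0⟩ ⟨⟨-, hs'⟩, h0'⟩ hts
      have hx' : ‖x‖ < 1 := mem_ball_zero_iff.1 hx
      simp only [mem_setOf_eq] at h0 h0'
      have := hs.rate x t s (by linarith) ht.1.le hts.le hs'.2.le
      rw [h0, h0'] at this
      nlinarith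
    have hss : (Prod.mk x ⁻¹' Z).Subsingleton := fun t ht s hs' =>
      le_antisymm (not_lt.1 (hmain s t hs' ht)) (not_lt.1 (hmain t s ht hs'))
    exact hss.measure_zero _
  filter_upwards [measure_eq_zero_iff_ae_notMem.1 hZ0] with p hp hpm h
  exact hp ⟨hpm, h⟩

end final

lemma squeeze_within {n : ℕ} {u f g : Spc n × ℝ → ℝ} {s : Set (Spc n × ℝ)} {p : Spc n × ℝ}
    (hp : p ∈ s) (hf : Continuous f) (hg : Continuous g) (h0 : g p = 0)
    (h : ∀ q ∈ s, |u q - f q| ≤ g q) : ContinuousWithinAt u s p := by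
  have hup : u p = f p := by
    have := h p hp
    rw [h0] at this
    exact sub_eq_zero.1 (abs_nonpos_iff.1 this)
  have h1 : Tendsto g (nhdsWithin p s) (nhds 0) := by
    have := hg.continuousWithinAt (s := s) (x := p)
    rwa [ContinuousWithinAt, h0] at this
  have h2 : Tendsto (fun q => u q - f q) (nhdsWithin p s) (nhds 0) := by
    refine squeeze_zero_norm' ?_ h1
    filter_upwards [self_mem_nhdsWithin] with q hq
    exact h q hq
  have h3 : Tendsto f (nhdsWithin p s) (nhds (f p)) := hf.continuousWithinAt
  have h4 := h2.add h3
  simp only [sub_add_cancel, zero_add] at h4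
  rw [ContinuousWithinAt, hup]
  exact h4

/-- existence of a strong solution of `∂ₜu - Δu = χ_{u>0}` with smooth data
`ψ` satisfying `∂ₜψ ≥ c` and `Δψ(·,0) ≥ c`, such that the solution inherits the interior
bound `uₜ ≥ c` (in the integrated sense, and pointwise wherever the time derivative exists). -/
theorem stmt6 (n : ℕ) (hn : 1 ≤ n) (T c : ℝ) (hT : 0 < T) (hc : 0 < c)
    (ψ : Spc n × ℝ → ℝ) (hψ : ContDiff ℝ (⊤ : ℕ∞) ψ)
    (hψt : ∀ p : Spc n × ℝ, c ≤ timeDeriv ψ p)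
    (hψlap : ∀ x ∈ closedBall (0 : Spc n) 1, c ≤ lapl ψ (x, 0)) :
    ∃ u : Spc n × ℝ → ℝ,
      ContinuousOn u (closedBall (0 : Spc n) 1 ×ˢ Icc 0 T) ∧
      IsStrongSolution u 1 (ball (0 : Spc n) 1 ×ˢ Ioo 0 T) ∧
      (∀ p ∈ (closedBall (0 : Spc n) 1 ×ˢ ({0} : Set ℝ)) ∪ (sphere (0 : Spc n) 1 ×ˢ Icc 0 T),
        u p = ψ p) ∧
      (∀ x ∈ ball (0 : Spc n) 1, ∀ t₁ t₂ : ℝ, 0 ≤ t₁ → t₁ ≤ t₂ → t₂ ≤ T →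
        c * (t₂ - t₁) ≤ u (x, t₂) - u (x, t₁)) ∧
      (∀ p ∈ ball (0 : Spc n) 1 ×ˢ Ioo 0 T, ∀ d : ℝ,
        HasDerivAt (fun s => u (p.1, s)) d p.2 → c ≤ d) := by
  obtain ⟨M, C, C₁, C₂, u, hs⟩ := exists_sol hn hc (S := T + 2) (by linarith) hψ hψt hψlap
  have hψc : Continuous ψ := ContDiff.continuous hψ
  have hS' : T + 1 < T + 2 := by linarith
  have hsub : ∀ p ∈ ball (0 : Spc n) 1 ×ˢ Ioo 0 T, p ∈ ball (0 : Spc n) 1 ×ˢ Ioo 0 (T + 1) := by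
    rintro p ⟨h1, h2, h3⟩
    exact ⟨h1, h2, by linarith⟩
  refine ⟨u, ?_, ⟨?_, ?_, ?_, ?_⟩, ?_, ?_, ?_⟩
  · rintro p hp
    obtain ⟨h1, h2, h3⟩ := id hp
    have h1' : ‖p.1‖ ≤ 1 := by simpa using h1
    by_cases hx : ‖p.1‖ = 1
    · refine squeeze_within (f := ψ) (g := fun q => C * (1 - ‖q.1‖ ^ 2)) hp hψc (by fun_prop)
        (by simp [hx]) ?_
      rintro q ⟨k1, k2, k3⟩
      exact hs.barrier q.1 q.2 (by simpa using k1) k2 (by linarith)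
    by_cases ht : p.2 = 0
    · refine squeeze_within (f := fun q => ψ (q.1, 0)) (g := fun q => C₂ * q.2) hp
        (by fun_prop) (by fun_prop) (by simp [ht]) ?_
      rintro q ⟨k1, k2, k3⟩
      exact hs.init q.1 q.2 (by simpa using k1) k2 (by linarith)
    · refine (hs.contAt' hc hS' (p := p) ⟨?_, ?_, ?_⟩).continuousWithinAt
      · simpa using lt_of_le_of_ne h1' hx
      · exact lt_of_le_of_ne h2 (Ne.symm ht)
      · linarith
  · exact fun p hp => (hs.contAt' hc hS' (hsub p hp)).continuousWithinAt
  · intro p hp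
    obtain ⟨V, hV, h⟩ := hs.grad hc hS' (hsub p hp)
    have h1 := h.self_of_nhds
    have : spGrad u p = V p := h1.gradient
    rw [this]
    exact h1
  · intro p hp
    obtain ⟨V, hV, h⟩ := hs.grad hc hS' (hsub p hp)
    have : ContinuousAt (fun p => spGrad u p) p := by
      refine hV.continuousAt.congr ?_
      filter_upwards [h] with q hq
      exact hq.gradient.symm
    exact this.continuousWithinAt
  · rw [ae_restrict_iff' (isOpen_cyl T).measurableSet]
    filter_upwards [hs.ne_zero hc] with p h0 hp
    have hp' := hsub p hp
    have h0' : u p ≠ 0 := h0 ⟨hp.1, hp.2.1, by linarith [hp.2.2]⟩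
    obtain ⟨F, hF, hfF, hL⟩ := hs.smooth hc hS' hp' h0'
    have ht := timeDeriv_hasDeriv hF.differentiable hfF
    refine ⟨?_, fun i => ?_, ?_⟩
    · rw [timeDeriv_eq hF.differentiable hfF]; exact ht
    · have := secondPartial_hasDeriv hF hfF i
      have h2 : secondPartial u i i p = _ := this.deriv
      rw [h2]; exact this
    · rw [timeDeriv_eq hF.differentiable hfF, lapl_eq hF hfF]
      exact hL
  · rintro p (⟨h1, h2⟩ | ⟨h1, h2, h3⟩)
    · have h2' : p.2 = 0 := h2
      have := hs.init p.1 p.2 (by simpa using h1) h2'.ge (by linarith)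
      rw [h2', mul_zero] at this
      have := sub_eq_zero.1 (abs_nonpos_iff.1 this)
      rwa [← h2'] at this
    · have hx : ‖p.1‖ = 1 := by simpa using h1
      have := hs.barrier p.1 p.2 hx.le h2 (by linarith)
      rw [hx, one_pow, sub_self, mul_zero] at this
      exact sub_eq_zero.1 (abs_nonpos_iff.1 this)
  · intro x hx t₁ t₂ h1 h2 h3
    have : ‖x‖ < 1 := by simpa using hx
    exact hs.rate x t₁ t₂ (by linarith) h1 h2 (by linarith)
  · rintro p ⟨hx, h1, h2⟩ d hd
    have hx' : ‖p.1‖ < 1 := by simpa using hx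
    have hd' := (hasDerivAt_iff_tendsto_slope.1 hd).mono_left
      (nhdsWithin_mono p.2 (t := {p.2}ᶜ) (s := Ioi p.2) (fun y hy => ne_of_gt hy))
    refine ge_of_tendsto hd' ?_
    filter_upwards [Ioo_mem_nhdsGT h2] with s hsI
    have := hs.rate p.1 p.2 s (by linarith) h1.le hsI.1.le (by linarith [hsI.2])
    rw [slope_def_field, le_div_iff₀ (by linarith [hsI.1])]
    exact this

end
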